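/- Suppose V : ℝ^d → ℝ with ∫ e^{-V(x)}dx = 1 is twice continuously differentiable and for some M, m > 0, ‖V''‖_{L_∞} ≤ M and V''(x) ⪰ m·I_d for all x ∈ ℝ^d. Let f ∈ C^s with s = k+1+ρ, integer k ≥ 0, ρ ∈ (0,1]. Then there are constants c_0 > 0 (absolute) and C depending only on M, m, s such that for all d ≤ c_0·n: sup over θ ∈ ℝ^d of the ‖·‖_{ψ_1}-norm (under P_θ) of f_k(θ̂) − f(θ) − n^{-1}·Σ_{j=1}^n ⟨V'(ξ_j), 𝓘^{-1} f'(θ)⟩ is at most C·‖f‖_{C^s}·[ n^{-1/2}·(d/n)^{ρ/2} + (√(d/n))^s ]. -/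

import Mathlib

open MeasureTheory Real
open scoped RealInnerProductSpace BigOperators ENNReal NNReal

noncomputable section

abbrev Euc (d : ℕ) : Type := EuclideanSpace ℝ (Fin d)

/-- The noise distribution with density `e^{-V(x)}` w.r.t. Lebesgue measure. -/
def noiseMeasure {d : ℕ} (V : Euc d → ℝ) : Measure (Euc d) :=
  MeasureTheory.volume.withDensity fun x => ENNReal.ofReal (Real.exp (-(V x)))

/-- The joint distribution of an i.i.d. sample `X_1, …, X_n` from `P_θ(dx) = e^{-V(x-θ)}dx`. -/
def sampleMeasure {d : ℕ} (V : Euc d → ℝ) (n : ℕ) (θ : Euc d) : Measure (Fin n → Euc d) :=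
  Measure.pi fun _ => (noiseMeasure V).map (fun x => θ + x)

/-- `ψ_α`-norm of a random variable: `sup_{p ≥ 1} p^{-1/α} (E|η|^p)^{1/p}`. -/
def psiNorm {Ω : Type*} [MeasurableSpace Ω] (α : ℝ) (μ : Measure Ω) (η : Ω → ℝ) : ℝ :=
  ⨆ p : {p : ℝ // 1 ≤ p}, (p : ℝ) ^ (-(1 / α)) * (∫ ω, |η ω| ^ (p : ℝ) ∂μ) ^ ((1 : ℝ) / (p : ℝ))

/-- `f` belongs to the Hölder ball of radius `B` in `C^s`, `s = l + ρ`. -/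
def holderCLe {d : ℕ} (l : ℕ) (ρ : ℝ) (f : Euc d → ℝ) (B : ℝ) : Prop :=
  ContDiff ℝ l f ∧
  (∀ j : ℕ, j ≤ l → ∀ x, ‖iteratedFDeriv ℝ j f x‖ ≤ B) ∧
  (∀ x y, ‖iteratedFDeriv ℝ l f x - iteratedFDeriv ℝ l f y‖ ≤ B * ‖x - y‖ ^ ρ)

/-- The operator `(T g)(θ) = E_θ g(θ̂)`. -/
def Texp {d : ℕ} (V : Euc d → ℝ) (n : ℕ) (hatθ : (Fin n → Euc d) → Euc d) (g : Euc d → ℝ) :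
    Euc d → ℝ :=
  fun θ => ∫ x, g (hatθ x) ∂ sampleMeasure V n θ

/-- The operator `𝓑 = 𝓣 - Id`. -/
def Bop {d : ℕ} (V : Euc d → ℝ) (n : ℕ) (hatθ : (Fin n → Euc d) → Euc d) :
    (Euc d → ℝ) → Euc d → ℝ :=
  fun g θ => Texp V n hatθ g θ - g θ

/-- The bias-corrected functional `f_k = Σ_{j=0}^k (-1)^j 𝓑^j f`. -/
def biasCorrect {d : ℕ} (V : Euc d → ℝ) (n : ℕ) (hatθ : (Fin n → Euc d) → Euc d) (k : ℕ)
    (f : Euc d → ℝ) : Euc d → ℝ :=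
  fun θ => ∑ j ∈ Finset.range (k + 1), (-1 : ℝ) ^ j * (Bop V n hatθ)^[j] f θ

/-- The Poincaré constant `c(V)` of the distribution `e^{-V(x)}dx`. -/
def poincareConst {d : ℕ} (V : Euc d → ℝ) : ℝ :=
  sInf {C : ℝ | 0 ≤ C ∧ ∀ g : Euc d → ℝ, LocallyLipschitz g →
    ∫ x, (g x - ∫ y, g y ∂ noiseMeasure V) ^ 2 ∂ noiseMeasure V ≤
      C * ∫ x, ‖gradient g x‖ ^ 2 ∂ noiseMeasure V}


section Development

open Real

/-- One-dimensional Brunn–Minkowski inequality. -/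
lemma volume_add_le_of_add_mem {A B S : Set ℝ} (hA : MeasurableSet A) (hB : MeasurableSet B)
    (hAn : A.Nonempty) (hBn : B.Nonempty) (h : ∀ a ∈ A, ∀ b ∈ B, a + b ∈ S) :
    volume A + volume B ≤ volume S := by
  have key : ∀ K ⊆ A, IsCompact K → ∀ L ⊆ B, IsCompact L → K.Nonempty → L.Nonempty →
      volume K + volume L ≤ volume S := by
    intro K hK hKc L hL hLc hKn hLn
    obtain ⟨k, hk, hkmax⟩ := hKc.exists_isGreatest hKn
    obtain ⟨l, hl, hlmin⟩ := hLc.exists_isLeast hLn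
    have h1 : volume ((fun x => x + l) '' K) = volume K := by
      rw [Set.image_add_right, measure_preimage_add_right]
    have h2 : volume ((fun x => k + x) '' L) = volume L := by
      rw [Set.image_add_left, measure_preimage_add]
    have hd : AEDisjoint volume ((fun x => x + l) '' K) ((fun x => k + x) '' L) := by
      refine measure_mono_null (t := {k + l}) ?_ (by simp)
      rintro _ ⟨⟨x, hx, rfl⟩, ⟨y, hy, hxy⟩⟩
      have := hkmax hx
      have := hlmin hy
      simp only [Set.mem_singleton_iff] at *
      linarith
    rw [← h1, ← h2, ← measure_union₀ _ hd]
    · refine measure_mono ?_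
      rintro _ (⟨x, hx, rfl⟩ | ⟨x, hx, rfl⟩)
      · exact h _ (hK hx) _ (hL hl)
      · exact h _ (hK hk) _ (hL hx)
    · exact (hLc.image (by fun_prop)).measurableSet.nullMeasurableSet
  obtain ⟨a, ha⟩ := hAn
  obtain ⟨b, hb⟩ := hBn
  rw [hA.measure_eq_iSup_isCompact, hB.measure_eq_iSup_isCompact]
  simp only [iSup_and']
  refine ENNReal.biSup_add_biSup_le' ⟨∅, by simp⟩ ⟨∅, by simp⟩ ?_
  rintro K ⟨hK, hKc⟩ L ⟨hL, hLc⟩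
  refine le_trans (add_le_add (measure_mono (Set.subset_insert a K))
    (measure_mono (Set.subset_insert b L))) ?_
  exact key _ (Set.insert_subset ha hK) (hKc.insert a) _ (Set.insert_subset hb hL) (hLc.insert b)
    (Set.insert_nonempty _ _) (Set.insert_nonempty _ _)

lemma lintegral_add_le_of_mul_le_sq {F G H : ℝ → ℝ} (hF : Measurable F) (hG : Measurable G)
    (hH : Measurable H) (hF0 : ∀ x, 0 ≤ F x) (hG0 : ∀ x, 0 ≤ G x) (hH0 : ∀ x, 0 ≤ H x)
    (hF1 : ∀ x, F x ≤ 1) (hG1 : ∀ x, G x ≤ 1) (hFs : ∀ t < 1, ∃ x, t < F x)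
    (hGs : ∀ t < 1, ∃ x, t < G x) (h : ∀ x y, F x * G y ≤ H (x + y) ^ 2) :
    (∫⁻ x, ENNReal.ofReal (F x)) + ∫⁻ x, ENNReal.ofReal (G x) ≤ ∫⁻ x, ENNReal.ofReal (H x) := by
  rw [lintegral_eq_lintegral_meas_lt _ (ae_of_all _ hF0) hF.aemeasurable,
    lintegral_eq_lintegral_meas_lt _ (ae_of_all _ hG0) hG.aemeasurable,
    lintegral_eq_lintegral_meas_lt _ (ae_of_all _ hH0) hH.aemeasurable, ← lintegral_add_left]
  · refine setLIntegral_mono' measurableSet_Ioi fun t (ht : 0 < t) => ?_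
    rcases lt_or_ge t 1 with h1 | h1
    · refine volume_add_le_of_add_mem (measurableSet_lt measurable_const hF)
        (measurableSet_lt measurable_const hG) (hFs t h1) (hGs t h1) ?_
      intro x (hx : t < F x) y (hy : t < G y)
      have := h x y
      have : t * t < F x * G y := mul_lt_mul'' hx hy ht.le ht.le
      show t < H (x + y)
      exact lt_of_pow_lt_pow_left₀ 2 (hH0 _) (by nlinarith)
    · have e1 : {a | t < F a} = ∅ := by
        ext a; simpa using (hF1 a).trans h1
      have e2 : {a | t < G a} = ∅ := by
        ext a; simpa using (hG1 a).trans h1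
      simp [e1, e2]
  · exact Antitone.measurable fun s t hst => measure_mono fun x hx => lt_of_le_of_lt hst hx

lemma ENNReal.four_mul_mul_le_add_sq (x y : ℝ≥0∞) : 4 * (x * y) ≤ (x + y) ^ 2 := by
  wlog hxy : x ≤ y generalizing x y
  · rw [mul_comm x, add_comm x]
    exact this y x (le_of_not_ge hxy)
  obtain ⟨c, rfl⟩ := exists_add_of_le hxy
  calc 4 * (x * (x + c)) ≤ 4 * (x * (x + c)) + c ^ 2 := le_self_add
    _ = (x + (x + c)) ^ 2 := by ring

lemma prekopa_leindler_real_of_bounded {f g h : ℝ → ℝ≥0∞} (hf : Measurable f) (hg : Measurable g)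
    (hh : Measurable h) (hfb : ⨆ x, f x ≠ ∞) (hgb : ⨆ x, g x ≠ ∞)
    (H : ∀ x y, f x * g y ≤ h (x + y) ^ 2) :
    4 * ((∫⁻ x, f x) * ∫⁻ x, g x) ≤ (∫⁻ x, h x) ^ 2 := by
  set a := ⨆ x, f x with ha
  set b := ⨆ x, g x with hb
  have hfa : ∀ x, f x ≤ a := fun x => le_iSup f x
  have hgb' : ∀ x, g x ≤ b := fun x => le_iSup g x
  rcases eq_or_ne a 0 with h0 | h0
  · have : ∀ x, f x = 0 := fun x => by simpa [h0] using hfa x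
    simp [this]
  rcases eq_or_ne b 0 with h0' | h0'
  · have : ∀ x, g x = 0 := fun x => by simpa [h0'] using hgb' x
    simp [this]
  set α := a.toReal
  set β := b.toReal
  have hα : 0 < α := ENNReal.toReal_pos h0 hfb
  have hβ : 0 < β := ENNReal.toReal_pos h0' hgb
  have haα : ENNReal.ofReal α = a := ENNReal.ofReal_toReal hfb
  have hbβ : ENNReal.ofReal β = b := ENNReal.ofReal_toReal hgb
  set s := √(α * β) with hs
  have hs0 : 0 < s := Real.sqrt_pos.2 (by positivity)
  have hss : s ^ 2 = α * β := Real.sq_sqrt (by positivity)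
  have hft : ∀ x, f x ≠ ∞ := fun x => ne_top_of_le_ne_top hfb (hfa x)
  have hgt : ∀ x, g x ≠ ∞ := fun x => ne_top_of_le_ne_top hgb (hgb' x)
  set F := fun x => (f x).toReal / α with hF
  set G := fun x => (g x).toReal / β with hG
  set K := fun x => (min (h x) (ENNReal.ofReal s)).toReal / s with hK
  have main := lintegral_add_le_of_mul_le_sq (F := F) (G := G) (H := K)
    (hf.ennreal_toReal.div_const _) (hg.ennreal_toReal.div_const _)
    ((hh.min measurable_const).ennreal_toReal.div_const _)
    (fun x => by positivity) (fun x => by positivity) (fun x => by positivity)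
    (fun x => (div_le_one hα).2 (ENNReal.toReal_mono hfb (hfa x)))
    (fun x => (div_le_one hβ).2 (ENNReal.toReal_mono hgb (hgb' x)))
    ?_ ?_ ?_
  · have eF : ∫⁻ x, f x = a * ∫⁻ x, ENNReal.ofReal (F x) := by
      rw [← lintegral_const_mul' _ _ hfb]
      refine lintegral_congr fun x => ?_
      rw [← haα, ← ENNReal.ofReal_mul hα.le, mul_div_cancel₀ _ hα.ne', ENNReal.ofReal_toReal (hft x)]
    have eG : ∫⁻ x, g x = b * ∫⁻ x, ENNReal.ofReal (G x) := by
      rw [← lintegral_const_mul' _ _ hgb]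
      refine lintegral_congr fun x => ?_
      rw [← hbβ, ← ENNReal.ofReal_mul hβ.le, mul_div_cancel₀ _ hβ.ne', ENNReal.ofReal_toReal (hgt x)]
    have eK : ENNReal.ofReal s * ∫⁻ x, ENNReal.ofReal (K x) ≤ ∫⁻ x, h x := by
      rw [← lintegral_const_mul' _ _ ENNReal.ofReal_ne_top]
      refine lintegral_mono fun x => ?_
      rw [← ENNReal.ofReal_mul hs0.le, mul_div_cancel₀ _ hs0.ne',
        ENNReal.ofReal_toReal (ne_top_of_le_ne_top ENNReal.ofReal_ne_top (min_le_right _ _))]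
      exact min_le_left _ _
    have es : ENNReal.ofReal s ^ 2 = a * b := by
      rw [← ENNReal.ofReal_pow hs0.le, hss, ENNReal.ofReal_mul hα.le, haα, hbβ]
    calc 4 * ((∫⁻ x, f x) * ∫⁻ x, g x)
        = ENNReal.ofReal s ^ 2 *
          (4 * ((∫⁻ x, ENNReal.ofReal (F x)) * ∫⁻ x, ENNReal.ofReal (G x))) := by
          rw [eF, eG, es]; ring
      _ ≤ ENNReal.ofReal s ^ 2 * (∫⁻ x, ENNReal.ofReal (K x)) ^ 2 := by
          gcongr
          exact (ENNReal.four_mul_mul_le_add_sq _ _).trans (by gcongr)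
      _ = (ENNReal.ofReal s * ∫⁻ x, ENNReal.ofReal (K x)) ^ 2 := by ring
      _ ≤ _ := by gcongr
  · intro t ht
    by_cases ht0 : t < 0
    · exact ⟨0, ht0.trans_le (by positivity)⟩
    have : ENNReal.ofReal (t * α) < ⨆ x, f x := by
      rw [← ha, ← haα]
      exact (ENNReal.ofReal_lt_ofReal_iff hα).2 (by nlinarith)
    obtain ⟨x, hx⟩ := lt_iSup_iff.1 this
    refine ⟨x, (lt_div_iff₀ hα).2 ?_⟩
    exact (ENNReal.ofReal_lt_iff_lt_toReal (mul_nonneg (not_lt.1 ht0) hα.le) (hft x)).1 hx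
  · intro t ht
    by_cases ht0 : t < 0
    · exact ⟨0, ht0.trans_le (by positivity)⟩
    have : ENNReal.ofReal (t * β) < ⨆ x, g x := by
      rw [← hb, ← hbβ]
      exact (ENNReal.ofReal_lt_ofReal_iff hβ).2 (by nlinarith)
    obtain ⟨x, hx⟩ := lt_iSup_iff.1 this
    refine ⟨x, (lt_div_iff₀ hβ).2 ?_⟩
    exact (ENNReal.ofReal_lt_iff_lt_toReal (mul_nonneg (not_lt.1 ht0) hβ.le) (hgt x)).1 hx
  · intro x y
    simp only [hF, hG, hK]
    rw [div_mul_div_comm, div_pow, hss]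
    gcongr
    rw [← ENNReal.toReal_mul, ← ENNReal.toReal_pow]
    refine ENNReal.toReal_mono
      (ENNReal.pow_ne_top (ne_top_of_le_ne_top ENNReal.ofReal_ne_top (min_le_right _ _))) ?_
    rcases le_total (h (x + y)) (ENNReal.ofReal s) with h1 | h1
    · rw [min_eq_left h1]; exact H x y
    · rw [min_eq_right h1, ← ENNReal.ofReal_pow hs0.le, hss, ENNReal.ofReal_mul hα.le, haα, hbβ]
      exact mul_le_mul' (hfa x) (hgb' y)

lemma iSup_lintegral_min_natCast {α : Type*} [MeasurableSpace α] {μ : Measure α} {f : α → ℝ≥0∞}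
    (hf : Measurable f) : ⨆ N : ℕ, ∫⁻ x, min (f x) N ∂μ = ∫⁻ x, f x ∂μ := by
  rw [← lintegral_iSup (fun N => hf.min measurable_const)]
  · refine lintegral_congr fun x => ?_
    rw [← inf_iSup_eq, ENNReal.iSup_natCast, inf_top_eq]
  · intro i j hij x
    have : (i : ℝ≥0∞) ≤ j := by exact_mod_cast hij
    exact min_le_min le_rfl this

lemma prekopa_leindler_real {f g h : ℝ → ℝ≥0∞} (hf : Measurable f) (hg : Measurable g)
    (hh : Measurable h) (H : ∀ x y, f x * g y ≤ h ((1 / 2 : ℝ) * (x + y)) ^ 2) :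
    (∫⁻ x, f x) * ∫⁻ x, g x ≤ (∫⁻ x, h x) ^ 2 := by
  have h2 : ∫⁻ x, h ((1 / 2 : ℝ) * x) = 2 * ∫⁻ x, h x := by
    rw [← lintegral_map hh (measurable_const_mul _), Real.map_volume_mul_left (by norm_num),
      lintegral_smul_measure]
    norm_num
  have key : 4 * ((∫⁻ x, f x) * ∫⁻ x, g x) ≤ (∫⁻ x, h ((1 / 2 : ℝ) * x)) ^ 2 := by
    rw [← iSup_lintegral_min_natCast hf, ← iSup_lintegral_min_natCast hg, ENNReal.iSup_mul,
      ENNReal.mul_iSup]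
    refine iSup_le fun N => ?_
    rw [ENNReal.mul_iSup, ENNReal.mul_iSup]
    refine iSup_le fun N' => ?_
    refine prekopa_leindler_real_of_bounded (hf.min measurable_const) (hg.min measurable_const)
      (hh.comp (measurable_const_mul _)) ?_ ?_ ?_
    · exact ne_top_of_le_ne_top (ENNReal.natCast_ne_top N) (iSup_le fun x => min_le_right _ _)
    · exact ne_top_of_le_ne_top (ENNReal.natCast_ne_top N') (iSup_le fun x => min_le_right _ _)
    · exact fun x y => (mul_le_mul' (min_le_left _ _) (min_le_left _ _)).trans (H x y)
  rw [h2, mul_pow, show (2 : ℝ≥0∞) ^ 2 = 4 by norm_num] at key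
  exact (ENNReal.mul_le_mul_iff_right (by norm_num) (by norm_num)).1 key

lemma prekopa_leindler_pi (d : ℕ) : ∀ {f g h : (Fin d → ℝ) → ℝ≥0∞}, Measurable f → Measurable g →
    Measurable h → (∀ x y, f x * g y ≤ h ((1 / 2 : ℝ) • (x + y)) ^ 2) →
    (∫⁻ x, f x) * ∫⁻ x, g x ≤ (∫⁻ x, h x) ^ 2 := by
  induction d with
  | zero =>
    intro f g h hf hg hh H
    have : (volume : Measure (Fin 0 → ℝ)) = Measure.dirac 0 := by
      rw [volume_pi, Measure.pi_of_empty _ 0]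
    simp only [this, lintegral_dirac]
    simpa using H 0 0
  | succ d ih =>
    intro f g h hf hg hh H
    have e := (volume_preserving_piFinSuccAbove (fun _ : Fin (d + 1) => ℝ) 0).symm
    have tr : ∀ {u : (Fin (d + 1) → ℝ) → ℝ≥0∞}, Measurable u →
        ∫⁻ x, u x = ∫⁻ a : ℝ, ∫⁻ b : Fin d → ℝ, u (Fin.cons a b) := by
      intro u hu
      rw [← e.lintegral_comp hu, Measure.volume_eq_prod, lintegral_prod]
      · refine lintegral_congr fun a => lintegral_congr fun b => congrArg u ?_
        simp [Fin.insertNthEquiv]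
      · exact (hu.comp e.measurable).aemeasurable
    have hcons : Measurable fun p : ℝ × (Fin d → ℝ) => (Fin.cons p.1 p.2 : Fin (d + 1) → ℝ) := by
      refine measurable_pi_iff.2 (Fin.cases measurable_fst fun j => ?_)
      exact (measurable_pi_apply j).comp measurable_snd
    have mm : ∀ {u : (Fin (d + 1) → ℝ) → ℝ≥0∞}, Measurable u →
        Measurable fun a : ℝ => ∫⁻ b : Fin d → ℝ, u (Fin.cons a b) := by
      intro u hu
      exact (hu.comp hcons).lintegral_prod_right'
    rw [tr hf, tr hg, tr hh]
    refine prekopa_leindler_real (mm hf) (mm hg) (mm hh) fun x y => ?_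
    have ms : ∀ {u : (Fin (d + 1) → ℝ) → ℝ≥0∞}, Measurable u → ∀ a : ℝ,
        Measurable fun b : Fin d → ℝ => u (Fin.cons a b) := fun hu a =>
      hu.comp (hcons.comp (measurable_const.prodMk measurable_id))
    refine ih (ms hf x) (ms hg y) (ms hh _) fun u v => ?_
    convert H (Fin.cons x u) (Fin.cons y v) using 3
    ext i
    refine Fin.cases ?_ (fun j => ?_) i <;> simp
    ring

/-- The Prékopa–Leindler inequality at the midpoint. -/
theorem prekopa_leindler {d : ℕ} {f g h : Euc d → ℝ≥0∞} (hf : Measurable f) (hg : Measurable g)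
    (hh : Measurable h) (H : ∀ x y, f x * g y ≤ h ((1 / 2 : ℝ) • (x + y)) ^ 2) :
    (∫⁻ x, f x) * ∫⁻ x, g x ≤ (∫⁻ x, h x) ^ 2 := by
  have e := PiLp.volume_preserving_toLp (Fin d)
  rw [← e.lintegral_comp hf, ← e.lintegral_comp hg, ← e.lintegral_comp hh]
  exact prekopa_leindler_pi d (hf.comp e.measurable) (hg.comp e.measurable) (hh.comp e.measurable)
    fun x y => H _ _

lemma one_add_sq_half_le_cosh (t : ℝ) : 1 + t ^ 2 / 2 ≤ Real.cosh t := by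
  have h := Real.cosh_sq (t / 2)
  have h1 : (t / 2) ^ 2 ≤ Real.sinh (t / 2) ^ 2 := by
    rw [sq_le_sq]
    have := Real.self_le_sinh_iff (x := |t / 2|)
    rw [Real.abs_sinh]
    exact this.2 (abs_nonneg _)
  have h2 : Real.cosh t = Real.cosh (t / 2) ^ 2 + Real.sinh (t / 2) ^ 2 := by
    rw [← Real.cosh_two_mul]; congr 1; ring
  nlinarith

/-- The variance of a bounded function is controlled by the product of its Laplace transforms. -/
lemma one_add_sq_mul_variance_le {α : Type*} [MeasurableSpace α] {μ : Measure α}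
    [IsProbabilityMeasure μ] {g : α → ℝ} {N : ℝ} (hg : Measurable g) (hN : ∀ x, |g x| ≤ N)
    (ε : ℝ) :
    1 + ε ^ 2 * (∫ x, g x ^ 2 ∂μ - (∫ x, g x ∂μ) ^ 2) ≤
      (∫ x, Real.exp (ε * g x) ∂μ) * ∫ x, Real.exp (-(ε * g x)) ∂μ := by
  have ig : Integrable g μ := Integrable.of_bound hg.aestronglyMeasurable N (ae_of_all _ hN)
  have ig2 : Integrable (fun x => g x ^ 2) μ := by
    refine Integrable.of_bound (hg.pow_const 2).aestronglyMeasurable (N ^ 2) (ae_of_all _ fun x => ?_)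
    rw [Real.norm_eq_abs, abs_pow]
    exact pow_le_pow_left₀ (abs_nonneg _) (hN x) 2
  have ie : ∀ c : ℝ, Integrable (fun x => Real.exp (c * g x)) μ := fun c => by
    refine Integrable.of_bound (hg.const_mul c).exp.aestronglyMeasurable (Real.exp (|c| * N))
      (ae_of_all _ fun x => ?_)
    rw [Real.norm_eq_abs, Real.abs_exp]
    refine Real.exp_le_exp.2 ((le_abs_self _).trans ?_)
    rw [abs_mul]
    exact mul_le_mul_of_nonneg_left (hN x) (abs_nonneg _)
  have ie' : Integrable (fun x => Real.exp (-(ε * g x))) μ := by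
    simpa [neg_mul] using ie (-ε)
  have i1 : Integrable (fun p : α × α => Real.exp (ε * g p.1) * Real.exp (-(ε * g p.2)))
      (μ.prod μ) := (ie ε).mul_prod ie'
  have i2 : Integrable (fun p : α × α => Real.exp (-(ε * g p.1)) * Real.exp (ε * g p.2))
      (μ.prod μ) := ie'.mul_prod (ie ε)
  have e1 := integral_prod_mul (μ := μ) (ν := μ) (fun x => Real.exp (ε * g x))
    (fun x => Real.exp (-(ε * g x)))
  have e2 := integral_prod_mul (μ := μ) (ν := μ) (fun x => Real.exp (-(ε * g x)))
    (fun x => Real.exp (ε * g x))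
  have j1 : Integrable (fun p : α × α => g p.1 ^ 2 * 1) (μ.prod μ) :=
    ig2.mul_prod (integrable_const 1)
  have j2 : Integrable (fun p : α × α => 1 * g p.2 ^ 2) (μ.prod μ) :=
    (integrable_const (1:ℝ)).mul_prod ig2
  have j3 : Integrable (fun p : α × α => g p.1 * g p.2) (μ.prod μ) := ig.mul_prod ig
  have j12 : Integrable (fun p : α × α => g p.1 ^ 2 * 1 + 1 * g p.2 ^ 2) (μ.prod μ) := j1.add j2
  have j4 : Integrable (fun p : α × α => g p.1 ^ 2 * 1 + 1 * g p.2 ^ 2 - 2 * (g p.1 * g p.2))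
      (μ.prod μ) := j12.sub (j3.const_mul 2)
  have f1 := integral_prod_mul (μ := μ) (ν := μ) (fun x => g x ^ 2) (fun _ => (1 : ℝ))
  have f2 := integral_prod_mul (μ := μ) (ν := μ) (fun _ => (1 : ℝ)) (fun x => g x ^ 2)
  have f3 := integral_prod_mul (μ := μ) (ν := μ) g g
  have key : ∫ p : α × α, (2 + ε ^ 2 * (g p.1 ^ 2 * 1 + 1 * g p.2 ^ 2 - 2 * (g p.1 * g p.2)))
      ∂(μ.prod μ) ≤ ∫ p : α × α, (Real.exp (ε * g p.1) * Real.exp (-(ε * g p.2)) +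
        Real.exp (-(ε * g p.1)) * Real.exp (ε * g p.2)) ∂(μ.prod μ) := by
    refine integral_mono ?_ (i1.add i2) fun p => ?_
    · exact (integrable_const _).add (j4.const_mul _)
    · simp only
      rw [← Real.exp_add, ← Real.exp_add]
      have := one_add_sq_half_le_cosh (ε * (g p.1 - g p.2))
      rw [Real.cosh_eq] at this
      have a1 : ε * g p.1 + -(ε * g p.2) = ε * (g p.1 - g p.2) := by ring
      have a2 : -(ε * g p.1) + ε * g p.2 = -(ε * (g p.1 - g p.2)) := by ring
      rw [a1, a2]
      nlinarith
  rw [integral_add i1 i2, e1, e2, integral_add (integrable_const _)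
    (j4.const_mul _), integral_const_mul,
    integral_sub j12 (j3.const_mul 2), integral_add j1 j2, f1, f2,
    integral_const_mul, f3] at key
  simp only [integral_const, probReal_univ, smul_eq_mul, mul_one, one_mul] at key
  nlinarith

/-- The infimal convolution of `g` with `(c / 2) ‖·‖²`-type costs. -/
def infConv {E : Type*} [NormedAddCommGroup E] (c : ℝ) (g : E → ℝ) (x : E) : ℝ :=
  ⨅ y, (g y + c * ‖x - y‖ ^ 2)

section infConv

variable {E : Type*} [NormedAddCommGroup E] {c N Λ : ℝ} {g : E → ℝ}

lemma infConv_bddBelow (hc : 0 ≤ c) (hN : ∀ x, |g x| ≤ N) (x : E) :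
    BddBelow (Set.range fun y => g y + c * ‖x - y‖ ^ 2) := by
  refine ⟨-N, ?_⟩
  rintro _ ⟨y, rfl⟩
  have := (abs_le.1 (hN y)).1
  have : 0 ≤ c * ‖x - y‖ ^ 2 := by positivity
  simp only
  linarith

lemma infConv_le (hc : 0 ≤ c) (hN : ∀ x, |g x| ≤ N) (x y : E) :
    infConv c g x ≤ g y + c * ‖x - y‖ ^ 2 :=
  ciInf_le (infConv_bddBelow hc hN x) y

lemma infConv_le_self (hc : 0 ≤ c) (hN : ∀ x, |g x| ≤ N) (x : E) : infConv c g x ≤ g x := by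
  simpa using infConv_le hc hN x x

lemma measurable_infConv [MeasurableSpace E] [BorelSpace E] (hc : 0 ≤ c) (hN : ∀ x, |g x| ≤ N) :
    Measurable (infConv c g) := by
  refine UpperSemicontinuous.measurable (f := infConv c g) ?_
  exact upperSemicontinuous_ciInf (fun x => infConv_bddBelow hc hN x)
    fun y => Continuous.upperSemicontinuous (by fun_prop)

lemma sub_infConv_le_of_slope {s δ : ℝ} (hc : 0 < c) {x : E}
    (hΛ : ∀ y, |g x - g y| ≤ Λ * ‖x - y‖) (hδ : Λ ≤ c * δ)
    (h : ∀ y, ‖x - y‖ < δ → |g x - g y| ≤ s * ‖x - y‖) :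
    g x - infConv c g x ≤ s ^ 2 / (4 * c) := by
  have : g x - s ^ 2 / (4 * c) ≤ infConv c g x := by
    refine le_ciInf fun y => ?_
    have hy0 : 0 ≤ ‖x - y‖ := norm_nonneg _
    rcases lt_or_ge ‖x - y‖ δ with h1 | h1
    · have h2 := (abs_le.1 (h y h1)).2
      have h3 : s * ‖x - y‖ ≤ s ^ 2 / (4 * c) + c * ‖x - y‖ ^ 2 := by
        rw [← sub_nonneg]
        have : s ^ 2 / (4 * c) + c * ‖x - y‖ ^ 2 - s * ‖x - y‖ =
          (s - 2 * c * ‖x - y‖) ^ 2 / (4 * c) := by field_simp; ring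
        rw [this]; positivity
      linarith
    · have h2 := (abs_le.1 (hΛ y)).2
      have h3 : 0 ≤ s ^ 2 / (4 * c) := by positivity
      have h4 : Λ * ‖x - y‖ ≤ c * ‖x - y‖ ^ 2 := by
        have : Λ ≤ c * ‖x - y‖ := hδ.trans (by gcongr)
        nlinarith
      linarith
  linarith

end infConv

/-- Midpoint strong convexity with modulus `m`. -/
def MidStrongConvex {E : Type*} [NormedAddCommGroup E] [NormedSpace ℝ E] (m : ℝ) (V : E → ℝ) :
    Prop :=
  ∀ x y, V ((1 / 2 : ℝ) • (x + y)) ≤ (V x + V y) / 2 - m / 8 * ‖x - y‖ ^ 2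

lemma lintegral_noiseMeasure {d : ℕ} {V : Euc d → ℝ} (hV : Measurable V) {f : Euc d → ℝ≥0∞}
    (hf : Measurable f) :
    ∫⁻ x, f x ∂noiseMeasure V = ∫⁻ x, ENNReal.ofReal (Real.exp (-(V x))) * f x := by
  rw [noiseMeasure, lintegral_withDensity_eq_lintegral_mul _ (by fun_prop) hf]
  rfl

/-- Maurey's property (τ) for strongly log-concave measures. -/
lemma integral_exp_infConv_mul_le {d : ℕ} {V : Euc d → ℝ} (hV : Measurable V)
    [IsProbabilityMeasure (noiseMeasure V)] {m : ℝ} (hm : 0 < m) (hmid : MidStrongConvex m V)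
    {g : Euc d → ℝ} (hg : Measurable g) {N : ℝ} (hN : ∀ x, |g x| ≤ N) {ε : ℝ} (hε : 0 < ε) :
    (∫ x, Real.exp (ε * infConv (m / (4 * ε)) g x) ∂noiseMeasure V) *
      ∫ x, Real.exp (-(ε * g x)) ∂noiseMeasure V ≤ 1 := by
  have hc : 0 ≤ m / (4 * ε) := by positivity
  have hQ := measurable_infConv (E := Euc d) hc hN
  have one : ∫⁻ x, ENNReal.ofReal (Real.exp (-(V x))) = 1 := by
    have := lintegral_noiseMeasure hV (f := fun _ => 1) measurable_const
    simpa using this.symm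
  have PL := prekopa_leindler (d := d)
    (f := fun x => ENNReal.ofReal (Real.exp (-(V x))) *
      ENNReal.ofReal (Real.exp (ε * infConv (m / (4 * ε)) g x)))
    (g := fun x => ENNReal.ofReal (Real.exp (-(V x))) *
      ENNReal.ofReal (Real.exp (-(ε * g x))))
    (h := fun x => ENNReal.ofReal (Real.exp (-(V x))))
    (by fun_prop) (by fun_prop) (by fun_prop) ?_
  · rw [← lintegral_noiseMeasure hV (by fun_prop), ← lintegral_noiseMeasure hV (by fun_prop), one,
      one_pow] at PL
    rw [integral_eq_lintegral_of_nonneg_ae (ae_of_all _ fun x => (Real.exp_pos _).le)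
      (by fun_prop), integral_eq_lintegral_of_nonneg_ae (ae_of_all _ fun x => (Real.exp_pos _).le)
      (by fun_prop), ← ENNReal.toReal_mul]
    exact ENNReal.toReal_le_of_le_ofReal zero_le_one (by simpa using PL)
  · intro x y
    rw [← ENNReal.ofReal_mul (Real.exp_pos _).le, ← ENNReal.ofReal_mul (Real.exp_pos _).le,
      ← ENNReal.ofReal_mul (by positivity), ← ENNReal.ofReal_pow (Real.exp_pos _).le]
    refine ENNReal.ofReal_le_ofReal ?_
    rw [← Real.exp_add, ← Real.exp_add, ← Real.exp_add, ← Real.exp_nat_mul]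
    refine Real.exp_le_exp.2 ?_
    have h1 := infConv_le hc hN x y
    have h2 := hmid x y
    have h3 : ε * infConv (m / (4 * ε)) g x ≤ ε * g y + m / 4 * ‖x - y‖ ^ 2 := by
      calc _ ≤ ε * (g y + m / (4 * ε) * ‖x - y‖ ^ 2) := by gcongr
        _ = _ := by field_simp
    push_cast
    nlinarith

/-- Poincaré inequality for strongly log-concave measures, with an upper bound `G` for the local
slope in place of the gradient. -/
theorem variance_le_of_slope {d : ℕ} {V : Euc d → ℝ} (hV : Measurable V)
    [IsProbabilityMeasure (noiseMeasure V)] {m : ℝ} (hm : 0 < m) (hmid : MidStrongConvex m V)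
    {g : Euc d → ℝ} {N Λ : ℝ} (hN : ∀ x, |g x| ≤ N) (hΛ : ∀ x y, |g x - g y| ≤ Λ * ‖x - y‖)
    {G : Euc d → ℝ}
    (hslope : ∀ x, ∀ a > 0, ∃ δ > 0, ∀ y, ‖x - y‖ < δ → |g x - g y| ≤ (G x + a) * ‖x - y‖) :
    ENNReal.ofReal (∫ x, g x ^ 2 ∂noiseMeasure V - (∫ x, g x ∂noiseMeasure V) ^ 2) ≤
      ∫⁻ x, ENNReal.ofReal (G x ^ 2 / m) ∂noiseMeasure V := by
  set μ := noiseMeasure V with hμ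
  have hgc : Continuous g := by
    have : LipschitzWith (Real.toNNReal Λ) g := LipschitzWith.of_dist_le_mul fun x y => by
      rw [Real.dist_eq, dist_eq_norm]
      exact (hΛ x y).trans (mul_le_mul_of_nonneg_right (Real.le_coe_toNNReal _) (norm_nonneg _))
    exact this.continuous
  have hgm := hgc.measurable
  set v := ∫ x, g x ^ 2 ∂μ - (∫ x, g x ∂μ) ^ 2 with hv
  set e : ℕ → ℝ := fun n => 1 / ((n : ℝ) + 1) with he
  have he0 : ∀ n, 0 < e n := fun n => by positivity
  have het : Filter.Tendsto e Filter.atTop (nhds 0) := tendsto_one_div_add_atTop_nhds_zero_nat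
  have hc0 : ∀ n, 0 < m / (4 * e n) := fun n => div_pos hm (mul_pos (by norm_num) (he0 n))
  set k : ℕ → Euc d → ℝ := fun n x => (g x - infConv (m / (4 * e n)) g x) / e n with hk
  have hkm : ∀ n, Measurable (k n) := fun n =>
    (hgm.sub (measurable_infConv (hc0 n).le hN)).div_const _
  have hk0 : ∀ n x, 0 ≤ k n x := fun n x =>
    div_nonneg (sub_nonneg.2 (infConv_le_self (hc0 n).le hN x)) (he0 n).le
  have hkb : ∀ n x s δ, |Λ| ≤ m / (4 * e n) * δ →
      (∀ y, ‖x - y‖ < δ → |g x - g y| ≤ s * ‖x - y‖) → k n x ≤ s ^ 2 / m := by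
    intro n x s δ hδ h
    have := sub_infConv_le_of_slope (hc0 n)
      (fun y => (hΛ x y).trans (mul_le_mul_of_nonneg_right (le_abs_self Λ) (norm_nonneg _))) hδ h
    have e0 := he0 n
    rw [hk]
    simp only
    rw [div_le_iff₀ (he0 n)]
    refine this.trans (le_of_eq ?_)
    field_simp
  have hkΛ : ∀ n x, k n x ≤ |Λ| ^ 2 / m := fun n x =>
    hkb n x |Λ| (|Λ| / (m / (4 * e n)))
      (by rw [mul_div_cancel₀ _ (hc0 n).ne'])
      fun y _ => (hΛ x y).trans (mul_le_mul_of_nonneg_right (le_abs_self Λ) (norm_nonneg _))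
  have ik : ∀ n, Integrable (k n) μ := fun n =>
    Integrable.of_bound (hkm n).aestronglyMeasurable (|Λ| ^ 2 / m) (ae_of_all _ fun x => by
      rw [Real.norm_eq_abs, abs_of_nonneg (hk0 n x)]; exact hkΛ n x)
  have ie : ∀ c : ℝ, ∀ u : Euc d → ℝ, Measurable u → (∀ x, |u x| ≤ N) →
      Integrable (fun x => Real.exp (c * u x)) μ := fun c u hu huN => by
    refine Integrable.of_bound (hu.const_mul c).exp.aestronglyMeasurable (Real.exp (|c| * N))
      (ae_of_all _ fun x => ?_)
    rw [Real.norm_eq_abs, Real.abs_exp]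
    refine Real.exp_le_exp.2 ((le_abs_self _).trans ?_)
    rw [abs_mul]
    exact mul_le_mul_of_nonneg_left (huN x) (abs_nonneg _)
  have main : ∀ n, v ≤ Real.exp (2 * e n * N) * ∫ x, k n x ∂μ := by
    intro n
    have A := integral_exp_infConv_mul_le hV hm hmid hgm hN (he0 n)
    have Bv := one_add_sq_mul_variance_le (μ := μ) hgm hN (e n)
    set ε := e n
    have hε := he0 n
    have hQN : ∀ x, |infConv (m / (4 * ε)) g x| ≤ N := fun x => by
      refine abs_le.2 ⟨?_, (infConv_le_self (hc0 n).le hN x).trans (abs_le.1 (hN x)).2⟩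
      refine le_ciInf fun y => ?_
      have := (abs_le.1 (hN y)).1
      have h0 := hc0 n
      have : 0 ≤ m / (4 * ε) * ‖x - y‖ ^ 2 := mul_nonneg h0.le (by positivity)
      linarith
    have low : ∫ x, Real.exp (ε * g x) ∂μ - ε ^ 2 * Real.exp (ε * N) * ∫ x, k n x ∂μ ≤
        ∫ x, Real.exp (ε * infConv (m / (4 * ε)) g x) ∂μ := by
      rw [← integral_const_mul, ← integral_sub (ie ε g hgm hN) ((ik n).const_mul _)]
      refine integral_mono ((ie ε g hgm hN).sub ((ik n).const_mul _))
        (ie ε _ (measurable_infConv (hc0 n).le hN) hQN) fun x => ?_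
      simp only
      have h1 : ε * infConv (m / (4 * ε)) g x = ε * g x + -(ε ^ 2 * k n x) := by
        have : k n x = (g x - infConv (m / (4 * ε)) g x) / ε := rfl
        rw [this]; field_simp; ring
      rw [h1, Real.exp_add]
      have h2 := Real.add_one_le_exp (-(ε ^ 2 * k n x))
      have h3 : Real.exp (ε * g x) ≤ Real.exp (ε * N) :=
        Real.exp_le_exp.2 (by nlinarith [(abs_le.1 (hN x)).2])
      have h4 := Real.exp_pos (ε * g x)
      have h5 : 0 ≤ ε ^ 2 * k n x := mul_nonneg (sq_nonneg _) (hk0 n x)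
      nlinarith
    have hB0 : 0 ≤ ∫ x, Real.exp (-(ε * g x)) ∂μ := integral_nonneg fun x => (Real.exp_pos _).le
    have hB1 : ∫ x, Real.exp (-(ε * g x)) ∂μ ≤ Real.exp (ε * N) := by
      have : ∫ x, Real.exp (-(ε * g x)) ∂μ ≤ ∫ x, Real.exp (ε * N) ∂μ := by
        refine integral_mono (by simpa [neg_mul] using ie (-ε) g hgm hN) (integrable_const _)
          fun x => Real.exp_le_exp.2 ?_
        nlinarith [(abs_le.1 (hN x)).1]
      simpa using this
    have hK0 : 0 ≤ ∫ x, k n x ∂μ := integral_nonneg (hk0 n)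
    have h6 : ε ^ 2 * v ≤ ε ^ 2 * Real.exp (ε * N) * (∫ x, k n x ∂μ) *
        ∫ x, Real.exp (-(ε * g x)) ∂μ := by
      have := mul_le_mul_of_nonneg_right low hB0
      nlinarith
    have h7 : ε ^ 2 * v ≤ ε ^ 2 * (Real.exp (2 * ε * N) * ∫ x, k n x ∂μ) := by
      refine h6.trans ?_
      calc _ ≤ ε ^ 2 * Real.exp (ε * N) * (∫ x, k n x ∂μ) * Real.exp (ε * N) := by gcongr
        _ = ε ^ 2 * ((Real.exp (ε * N) * Real.exp (ε * N)) * ∫ x, k n x ∂μ) := by ring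
        _ = _ := by rw [← Real.exp_add]; ring_nf
    exact le_of_mul_le_mul_left h7 (by positivity)
  have hexp : Filter.Tendsto (fun n => ENNReal.ofReal (Real.exp (2 * e n * N))) Filter.atTop
      (nhds 1) := by
    have : Filter.Tendsto (fun n => Real.exp (2 * e n * N)) Filter.atTop (nhds (Real.exp (2 * 0 * N))) :=
      (Real.continuous_exp.tendsto _).comp ((het.const_mul 2).mul_const N)
    simpa using ENNReal.tendsto_ofReal this
  have hlim : Filter.limsup (fun n => ∫⁻ x, ENNReal.ofReal (k n x) ∂μ) Filter.atTop ≤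
      ∫⁻ x, ENNReal.ofReal (G x ^ 2 / m) ∂μ := by
    refine (limsup_lintegral_le (fun _ => ENNReal.ofReal (|Λ| ^ 2 / m))
      (fun n => (hkm n).ennreal_ofReal)
      (fun n => ae_of_all _ fun x => ENNReal.ofReal_le_ofReal (hkΛ n x)) (by simp)).trans ?_
    refine lintegral_mono fun x => ?_
    have hx : ∀ a > 0, Filter.limsup (fun n => ENNReal.ofReal (k n x)) Filter.atTop ≤
        ENNReal.ofReal ((G x + a) ^ 2 / m) := by
      intro a ha
      obtain ⟨δ, hδ, hδ'⟩ := hslope x a ha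
      refine Filter.limsup_le_of_le (by isBoundedDefault) ?_
      have ev : ∀ᶠ n in Filter.atTop, e n * (4 * |Λ|) < m * δ := by
        have : Filter.Tendsto (fun n => e n * (4 * |Λ|)) Filter.atTop (nhds 0) := by
          simpa using het.mul_const (4 * |Λ|)
        exact this.eventually_lt_const (by positivity)
      filter_upwards [ev] with n hn
      refine ENNReal.ofReal_le_ofReal (hkb n x _ δ ?_ hδ')
      rw [div_mul_eq_mul_div, le_div_iff₀ (mul_pos (by norm_num) (he0 n))]
      linarith
    have cont : Filter.Tendsto (fun a : ℝ => ENNReal.ofReal ((G x + a) ^ 2 / m))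
        (nhdsWithin 0 (Set.Ioi 0)) (nhds (ENNReal.ofReal ((G x + 0) ^ 2 / m))) := by
      refine (ENNReal.continuous_ofReal.tendsto _).comp (tendsto_nhdsWithin_of_tendsto_nhds ?_)
      exact Continuous.tendsto (f := fun a : ℝ => (G x + a) ^ 2 / m) (by fun_prop) 0
    rw [add_zero] at cont
    exact ge_of_tendsto cont (by filter_upwards [self_mem_nhdsWithin] with a ha using hx a ha)
  refine le_trans ?_ hlim
  have h8 : ∀ n, ENNReal.ofReal v ≤ ENNReal.ofReal (Real.exp (2 * e n * N)) *
      ∫⁻ x, ENNReal.ofReal (k n x) ∂μ := fun n => by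
    rw [← ofReal_integral_eq_lintegral_ofReal (ik n) (ae_of_all _ (hk0 n)),
      ← ENNReal.ofReal_mul (Real.exp_pos _).le]
    exact ENNReal.ofReal_le_ofReal (main n)
  have h9 : ENNReal.ofReal v ≤ Filter.limsup (fun n => ENNReal.ofReal (Real.exp (2 * e n * N)) *
      ∫⁻ x, ENNReal.ofReal (k n x) ∂μ) Filter.atTop :=
    Filter.le_limsup_of_frequently_le (Filter.Frequently.of_forall h8) (by isBoundedDefault)
  refine h9.trans ((ENNReal.limsup_mul_le' ?_ ?_).trans ?_)
  · left; rw [hexp.limsup_eq]; simp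
  · left; rw [hexp.limsup_eq]; simp
  · rw [hexp.limsup_eq, one_mul]

/-- The variance, written as the difference of two moments. -/
def varSub {α : Type*} [MeasurableSpace α] (μ : Measure α) (g : α → ℝ) : ℝ :=
  ∫ x, g x ^ 2 ∂μ - (∫ x, g x ∂μ) ^ 2

section varSub

variable {α β : Type*} [MeasurableSpace α] [MeasurableSpace β] {μ : Measure α} {ν : Measure β}
  [IsProbabilityMeasure μ] [IsProbabilityMeasure ν]

lemma integrable_of_abs_le {g : α → ℝ} {N : ℝ} (hg : Measurable g) (hN : ∀ x, |g x| ≤ N) :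
    Integrable g μ := Integrable.of_bound hg.aestronglyMeasurable N (ae_of_all _ hN)

lemma abs_sq_le_of_abs_le {a N : ℝ} (h : |a| ≤ N) : |a ^ 2| ≤ N ^ 2 := by
  rw [abs_pow]; exact pow_le_pow_left₀ (abs_nonneg _) h 2

lemma abs_integral_le_of_abs_le {g : α → ℝ} {N : ℝ} (hN : ∀ x, |g x| ≤ N) :
    |∫ x, g x ∂μ| ≤ N := by
  have := norm_integral_le_of_norm_le_const (μ := μ) (f := g) (C := N) (ae_of_all _ hN)
  simpa using this

lemma varSub_eq_integral_sub_sq {g : α → ℝ} {N : ℝ} (hg : Measurable g) (hN : ∀ x, |g x| ≤ N) :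
    varSub μ g = ∫ x, (g x - ∫ y, g y ∂μ) ^ 2 ∂μ := by
  have ig := integrable_of_abs_le (μ := μ) hg hN
  have ig2 := integrable_of_abs_le (μ := μ) (hg.pow_const 2) fun x => abs_sq_le_of_abs_le (hN x)
  set c := ∫ y, g y ∂μ with hc
  have : ∀ x, (g x - c) ^ 2 = (g x ^ 2 - 2 * c * g x) + c ^ 2 := fun x => by ring
  have ig3 : Integrable (fun x => g x ^ 2 - 2 * c * g x) μ := ig2.sub (ig.const_mul _)
  simp only [this]
  rw [integral_add ig3 (integrable_const _), integral_sub ig2 (ig.const_mul _), integral_const_mul, ← hc, varSub, ← hc]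
  simp
  ring

lemma varSub_nonneg {g : α → ℝ} {N : ℝ} (hg : Measurable g) (hN : ∀ x, |g x| ≤ N) :
    0 ≤ varSub μ g := by
  rw [varSub_eq_integral_sub_sq hg hN]
  exact integral_nonneg fun x => sq_nonneg _

lemma measurable_integral_prod_left {Φ : α × β → ℝ} (hΦ : Measurable Φ) :
    Measurable fun b => ∫ a, Φ (a, b) ∂μ :=
  (StronglyMeasurable.integral_prod_left' hΦ.stronglyMeasurable).measurable

lemma measurable_integral_prod_right {Φ : α × β → ℝ} (hΦ : Measurable Φ) :
    Measurable fun a => ∫ b, Φ (a, b) ∂ν :=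
  (StronglyMeasurable.integral_prod_right' hΦ.stronglyMeasurable).measurable

/-- Convexity of the variance. -/
lemma varSub_integral_le {Φ : α × β → ℝ} {N : ℝ} (hΦ : Measurable Φ) (hN : ∀ x, |Φ x| ≤ N) :
    varSub ν (fun t => ∫ y, Φ (y, t) ∂μ) ≤ ∫ y, varSub ν (fun t => Φ (y, t)) ∂μ := by
  have hs : ∀ y, Measurable fun t => Φ (y, t) := fun y => hΦ.comp measurable_prodMk_left
  have hs' : ∀ t, Measurable fun y => Φ (y, t) := fun t => hΦ.comp measurable_prodMk_right
  have hmΦ := measurable_integral_prod_right (ν := ν) hΦ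
  set D : α × β → ℝ := fun p => Φ p - ∫ t, Φ (p.1, t) ∂ν with hD
  have hDm : Measurable D := hΦ.sub (hmΦ.comp measurable_fst)
  have hDN : ∀ p, |D p| ≤ N + N := fun p =>
    (abs_sub _ _).trans (add_le_add (hN p) (abs_integral_le_of_abs_le fun t => hN _))
  have hψ : ∫ t, ∫ y, Φ (y, t) ∂μ ∂ν = ∫ y, ∫ t, Φ (y, t) ∂ν ∂μ :=
    (integral_integral_swap (f := fun y t => Φ (y, t)) (integrable_of_abs_le hΦ hN)).symm
  rw [varSub_eq_integral_sub_sq (measurable_integral_prod_left hΦ)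
    fun t => abs_integral_le_of_abs_le fun y => hN _, hψ]
  have e1 : ∀ t, (∫ y, Φ (y, t) ∂μ) - ∫ y, ∫ t, Φ (y, t) ∂ν ∂μ = ∫ y, D (y, t) ∂μ := fun t => by
    rw [hD, ← integral_sub (integrable_of_abs_le (hs' t) fun y => hN _)
      (integrable_of_abs_le hmΦ fun y => abs_integral_le_of_abs_le fun t => hN _)]
  have e2 : ∀ y, varSub ν (fun t => Φ (y, t)) = ∫ t, D (y, t) ^ 2 ∂ν := fun y =>
    varSub_eq_integral_sub_sq (hs y) fun t => hN _
  simp only [e1, e2]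
  have iD2 : Integrable (fun p => D p ^ 2) (μ.prod ν) :=
    integrable_of_abs_le (hDm.pow_const 2) fun p => abs_sq_le_of_abs_le (hDN p)
  rw [integral_integral_swap (f := fun y t => D (y, t) ^ 2) iD2]
  refine integral_mono ?_ ?_ fun t => ?_
  · exact integrable_of_abs_le ((measurable_integral_prod_left hDm).pow_const 2)
      fun t => abs_sq_le_of_abs_le (abs_integral_le_of_abs_le fun y => hDN _)
  · exact integrable_of_abs_le (measurable_integral_prod_left (hDm.pow_const 2))
      fun t => abs_integral_le_of_abs_le fun y => abs_sq_le_of_abs_le (hDN _)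
  · have := varSub_nonneg (μ := μ) (hDm.comp (measurable_prodMk_right (y := t))) fun y => hDN _
    simpa [varSub] using this

/-- Law of total variance. -/
lemma varSub_prod {Φ : α × β → ℝ} {N : ℝ} (hΦ : Measurable Φ) (hN : ∀ x, |Φ x| ≤ N) :
    varSub (μ.prod ν) Φ =
      ∫ t, varSub μ (fun y => Φ (y, t)) ∂ν + varSub ν (fun t => ∫ y, Φ (y, t) ∂μ) := by
  simp only [varSub]
  rw [integral_sub, integral_prod_symm _ (integrable_of_abs_le (hΦ.pow_const 2) fun p =>
    abs_sq_le_of_abs_le (hN p)), integral_prod_symm _ (integrable_of_abs_le hΦ hN)]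
  · ring
  · exact integrable_of_abs_le (measurable_integral_prod_left (hΦ.pow_const 2))
      fun t => abs_integral_le_of_abs_le fun y => abs_sq_le_of_abs_le (hN _)
  · exact integrable_of_abs_le ((measurable_integral_prod_left hΦ).pow_const 2)
      fun t => abs_sq_le_of_abs_le (abs_integral_le_of_abs_le fun y => hN _)

lemma measurable_varSub_left {Φ : α × β → ℝ} (hΦ : Measurable Φ) :
    Measurable fun b => varSub μ fun a => Φ (a, b) :=
  (measurable_integral_prod_left (hΦ.pow_const 2)).sub
    ((measurable_integral_prod_left hΦ).pow_const 2)

lemma measurable_varSub_right {Φ : α × β → ℝ} (hΦ : Measurable Φ) :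
    Measurable fun a => varSub ν fun b => Φ (a, b) :=
  (measurable_integral_prod_right (hΦ.pow_const 2)).sub
    ((measurable_integral_prod_right hΦ).pow_const 2)

lemma abs_varSub_le {g : α → ℝ} {N : ℝ} (hN : ∀ x, |g x| ≤ N) : |varSub μ g| ≤ N ^ 2 + N ^ 2 :=
  (abs_sub _ _).trans (add_le_add
    (abs_integral_le_of_abs_le fun x => abs_sq_le_of_abs_le (hN x))
    (abs_sq_le_of_abs_le (abs_integral_le_of_abs_le hN)))

end varSub

section tensor

variable {E : Type*} [MeasurableSpace E] (μ : Measure E) [IsProbabilityMeasure μ]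

lemma measurePreserving_finCons (n : ℕ) :
    MeasurePreserving (fun p : E × (Fin n → E) => (Fin.cons p.1 p.2 : Fin (n + 1) → E))
      (μ.prod (Measure.pi fun _ => μ)) (Measure.pi fun _ => μ) := by
  have e := (measurePreserving_piFinSuccAbove (fun _ : Fin (n + 1) => μ) 0).symm
  convert e using 1
  ext p : 1
  simp [Fin.insertNthEquiv]

/-- Efron–Stein inequality, with the conditional variances replaced by upper bounds. -/
theorem varSub_pi_le (n : ℕ) : ∀ {Φ : (Fin n → E) → ℝ} {N : ℝ} (_ : Measurable Φ)
    (_ : ∀ x, |Φ x| ≤ N) {b : Fin n → (Fin n → E) → ℝ≥0∞} (_ : ∀ i, Measurable (b i))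
    (_ : ∀ i x, ENNReal.ofReal (varSub μ fun y => Φ (Function.update x i y)) ≤
      ∫⁻ y, b i (Function.update x i y) ∂μ),
    ENNReal.ofReal (varSub (Measure.pi fun _ => μ) Φ) ≤
      ∑ i, ∫⁻ x, b i x ∂(Measure.pi fun _ => μ) := by
  induction n with
  | zero =>
    intro Φ N hΦ hN b hb h
    simp [varSub, Measure.pi_of_empty _ (fun i : Fin 0 => i.elim0)]
  | succ n ih =>
    intro Φ N hΦ hN b hb h
    have mp := measurePreserving_finCons μ n
    set Q : Measure (Fin n → E) := Measure.pi fun _ => μ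
    set e : E × (Fin n → E) → (Fin (n + 1) → E) := fun p => Fin.cons p.1 p.2 with he
    have hem : Measurable e := mp.measurable
    have hΨ : Measurable fun p => Φ (e p) := hΦ.comp hem
    have v0 : varSub (Measure.pi fun _ => μ) Φ = varSub (μ.prod Q) (fun p => Φ (e p)) := by
      rw [varSub, varSub, ← mp.map_eq, integral_map hem.aemeasurable
        (hΦ.pow_const 2).aestronglyMeasurable, integral_map hem.aemeasurable
        hΦ.aestronglyMeasurable]
    have l0 : ∀ i, ∫⁻ x, b i x ∂(Measure.pi fun _ => μ) = ∫⁻ z, ∫⁻ y, b i (e (y, z)) ∂μ ∂Q := by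
      intro i
      rw [← mp.map_eq, lintegral_map (hb i) hem, lintegral_prod_symm
        (fun p => b i (e p)) ((hb i).comp hem).aemeasurable]
    have hs : ∀ z, Measurable fun y => Φ (e (y, z)) := fun z => hΨ.comp measurable_prodMk_right
    have h1 : ∀ z, ENNReal.ofReal (varSub μ fun y => Φ (e (y, z))) ≤ ∫⁻ y, b 0 (e (y, z)) ∂μ := by
      intro z
      obtain ⟨y0⟩ : Nonempty E := nonempty_of_isProbabilityMeasure μ
      have := h 0 (Fin.cons y0 z)
      simpa only [Fin.update_cons_zero] using this
    rw [v0, varSub_prod hΨ fun p => hN _]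
    refine ENNReal.ofReal_add_le.trans ?_
    rw [Fin.sum_univ_succ]
    refine add_le_add ?_ ?_
    · rw [l0, ofReal_integral_eq_lintegral_ofReal]
      · exact lintegral_mono h1
      · exact integrable_of_abs_le (measurable_varSub_left hΨ) fun z => abs_varSub_le fun y => hN _
      · exact ae_of_all _ fun z => varSub_nonneg (hs z) fun y => hN _
    · have := ih (Φ := fun z => ∫ y, Φ (e (y, z)) ∂μ) (N := N) (measurable_integral_prod_left hΨ)
        (fun z => abs_integral_le_of_abs_le fun y => hN _)
        (b := fun j z => ∫⁻ y, b j.succ (e (y, z)) ∂μ)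
        (fun j => ((hb j.succ).comp hem).lintegral_prod_left') ?_
      · simpa only [l0] using this
      · intro j z
        have mu : Measurable fun p : E × E => e (p.1, Function.update z j p.2) := by
          refine hem.comp (measurable_fst.prodMk ?_)
          exact (measurable_update z).comp measurable_snd
        have hup := hΦ.comp mu
        have c1 := varSub_integral_le (μ := μ) (ν := μ) hup fun p => hN _
        refine (ENNReal.ofReal_le_ofReal c1).trans ?_
        rw [ofReal_integral_eq_lintegral_ofReal]
        · rw [lintegral_lintegral_swap (f := fun y z_1 => b j.succ (e (z_1, Function.update z j y)))
            (((hb j.succ).comp mu).comp measurable_swap).aemeasurable]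
          refine lintegral_mono fun y => ?_
          have := h j.succ (Fin.cons y z)
          simp only [← Fin.cons_update] at this
          exact this
        · exact integrable_of_abs_le (measurable_varSub_right hup)
            fun z => abs_varSub_le fun y => hN _
        · exact ae_of_all _ fun y => varSub_nonneg (hup.comp measurable_prodMk_left) fun t => hN _

end tensor

/-- `V` is twice continuously differentiable with `m ≤ V'' ≤ M`. -/
structure RegPotential {d : ℕ} (M m : ℝ) (V : Euc d → ℝ) : Prop where
  contDiff : ContDiff ℝ 2 V
  bound : ∀ x, ‖iteratedFDeriv ℝ 2 V x‖ ≤ M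
  lower : ∀ x u : Euc d, m * ‖u‖ ^ 2 ≤ iteratedFDeriv ℝ 2 V x ![u, u]

/-- The Hessian as a linear operator. -/
def hess {d : ℕ} (V : Euc d → ℝ) (x : Euc d) : Euc d →L[ℝ] Euc d := fderiv ℝ (gradient V) x

lemma inner_gradient_eq {d : ℕ} (V : Euc d → ℝ) (x v : Euc d) :
    ⟪gradient V x, v⟫ = fderiv ℝ V x v := by
  rw [gradient, InnerProductSpace.toDual_symm_apply]

namespace RegPotential

variable {d : ℕ} {M m : ℝ} {V : Euc d → ℝ} (h : RegPotential M m V)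

include h

lemma differentiable : Differentiable ℝ V := h.contDiff.differentiable (by norm_num)

lemma contDiff_gradient : ContDiff ℝ 1 (gradient V) := by
  have : ContDiff ℝ 1 (fderiv ℝ V) := h.contDiff.fderiv_right (by norm_num)
  exact (InnerProductSpace.toDual ℝ (Euc d)).symm.contDiff.comp this

lemma continuous_gradient : Continuous (gradient V) := h.contDiff_gradient.continuous

lemma hasFDerivAt_gradient (x : Euc d) : HasFDerivAt (gradient V) (hess V x) x :=
  (h.contDiff_gradient.differentiable (by norm_num) x).hasFDerivAt

lemma continuous_hess : Continuous (hess V) := h.contDiff_gradient.continuous_fderiv (by norm_num)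

lemma inner_hess (x u v : Euc d) : ⟪hess V x u, v⟫ = iteratedFDeriv ℝ 2 V x ![u, v] := by
  rw [iteratedFDeriv_two_apply]
  have h1 : HasFDerivAt (fun y => ⟪gradient V y, v⟫) ((innerSL ℝ v).comp (hess V x)) x := by
    have := (innerSL ℝ v).hasFDerivAt.comp x (h.hasFDerivAt_gradient x)
    refine this.congr_of_eventuallyEq (Filter.Eventually.of_forall fun y => ?_)
    simp
  have hd : DifferentiableAt ℝ (fderiv ℝ V) x :=
    (h.contDiff.fderiv_right (m := 1) (by norm_num)).differentiable (by norm_num) x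
  have h2 : HasFDerivAt (fun y => fderiv ℝ V y v)
      ((ContinuousLinearMap.apply ℝ ℝ v).comp (fderiv ℝ (fderiv ℝ V) x)) x :=
    (ContinuousLinearMap.apply ℝ ℝ v).hasFDerivAt.comp x hd.hasFDerivAt
  simp only [inner_gradient_eq] at h1
  have := congrArg (fun L => L u) (h1.unique h2)
  simpa [real_inner_comm] using this

lemma inner_hess_le (x u v : Euc d) : |⟪hess V x u, v⟫| ≤ M * ‖u‖ * ‖v‖ := by
  rw [h.inner_hess]
  have := (iteratedFDeriv ℝ 2 V x).le_opNorm ![u, v]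
  simp only [Fin.prod_univ_two, Matrix.cons_val_zero, Matrix.cons_val_one] at this
  refine this.trans ?_
  rw [mul_assoc]
  gcongr
  exact h.bound x

lemma nonneg_M : 0 ≤ M := (norm_nonneg _).trans (h.bound 0)

lemma norm_hess_apply_le (x u : Euc d) : ‖hess V x u‖ ≤ M * ‖u‖ := by
  have := (le_abs_self _).trans (h.inner_hess_le x u (hess V x u))
  rw [real_inner_self_eq_norm_sq] at this
  rcases (norm_nonneg (hess V x u)).eq_or_lt with h0 | h0
  · rw [← h0]; exact mul_nonneg h.nonneg_M (norm_nonneg _)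
  · nlinarith

lemma norm_hess_le (x : Euc d) : ‖hess V x‖ ≤ M :=
  ContinuousLinearMap.opNorm_le_bound _ h.nonneg_M (h.norm_hess_apply_le x)

lemma hess_symm (x u v : Euc d) : ⟪hess V x u, v⟫ = ⟪hess V x v, u⟫ := by
  rw [h.inner_hess, h.inner_hess, iteratedFDeriv_two_apply, iteratedFDeriv_two_apply]
  exact (h.contDiff.contDiffAt.isSymmSndFDerivAt (by simp)) u v

lemma le_inner_hess (x u : Euc d) : m * ‖u‖ ^ 2 ≤ ⟪hess V x u, u⟫ := by
  rw [h.inner_hess]; exact h.lower x u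

lemma norm_gradient_sub_le (x y : Euc d) : ‖gradient V x - gradient V y‖ ≤ M * ‖x - y‖ :=
  Convex.norm_image_sub_le_of_norm_hasFDerivWithin_le
    (fun z _ => (h.hasFDerivAt_gradient z).hasFDerivWithinAt) (fun z _ => h.norm_hess_le z)
    convex_univ (Set.mem_univ y) (Set.mem_univ x)

lemma le_inner_gradient_sub (x y : Euc d) :
    m * ‖x - y‖ ^ 2 ≤ ⟪gradient V x - gradient V y, x - y⟫ := by
  have hd : ∀ t : ℝ, HasDerivAt (fun t : ℝ => ⟪gradient V (y + t • (x - y)), x - y⟫)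
      ⟪hess V (y + t • (x - y)) (x - y), x - y⟫ t := by
    intro t
    have h1 : HasDerivAt (fun t : ℝ => y + t • (x - y)) (x - y) t := by
      simpa using ((hasDerivAt_id t).smul_const (x - y)).const_add y
    have h2 := (h.hasFDerivAt_gradient (y + t • (x - y))).comp_hasDerivAt t h1
    simpa using h2.inner ℝ (hasDerivAt_const t (x - y))
  have := mul_sub_le_image_sub_of_le_deriv (f := fun t : ℝ => ⟪gradient V (y + t • (x - y)), x - y⟫)
    (fun t => (hd t).differentiableAt) (C := m * ‖x - y‖ ^ 2)
    (fun t => by rw [(hd t).deriv]; exact h.le_inner_hess _ _) zero_le_one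
  simpa [inner_sub_left] using this

lemma hasDerivAt_line (x u : Euc d) (t : ℝ) :
    HasDerivAt (fun t : ℝ => V (x + t • u)) ⟪gradient V (x + t • u), u⟫ t := by
  have h1 : HasDerivAt (fun t : ℝ => x + t • u) u t := by
    simpa using ((hasDerivAt_id t).smul_const u).const_add x
  have h2 := (h.differentiable (x + t • u)).hasFDerivAt.comp_hasDerivAt t h1
  rw [inner_gradient_eq]
  exact h2

lemma le_add (x u : Euc d) : V x + ⟪gradient V x, u⟫ + m / 2 * ‖u‖ ^ 2 ≤ V (x + u) := by
  have hd : ∀ t : ℝ, HasDerivAt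
      (fun t : ℝ => V (x + t • u) - t * ⟪gradient V x, u⟫ - m / 2 * ‖u‖ ^ 2 * t ^ 2)
      (⟪gradient V (x + t • u), u⟫ - 1 * ⟪gradient V x, u⟫ - m / 2 * ‖u‖ ^ 2 * (2 * t)) t := by
    intro t
    have h3 : HasDerivAt (fun t : ℝ => t ^ 2) (2 * t) t := by
      simpa using hasDerivAt_pow 2 t
    exact ((h.hasDerivAt_line x u t).sub ((hasDerivAt_id t).mul_const _)).sub (h3.const_mul _)
  have mono := monotoneOn_of_deriv_nonneg (convex_Icc (0 : ℝ) 1)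
    (fun t _ => (hd t).continuousAt.continuousWithinAt)
    (fun t _ => (hd t).differentiableAt.differentiableWithinAt) (fun t ht => by
      rw [(hd t).deriv]
      rw [interior_Icc] at ht
      have h4 := h.le_inner_gradient_sub (x + t • u) x
      rw [add_sub_cancel_left, norm_smul, inner_smul_right, inner_sub_left, mul_pow, norm_eq_abs,
        sq_abs] at h4
      have : t * (m * t * ‖u‖ ^ 2) ≤ t * (⟪gradient V (x + t • u), u⟫ - ⟪gradient V x, u⟫) := by
        nlinarith
      have := le_of_mul_le_mul_left this ht.1
      nlinarith)
  have := mono (Set.left_mem_Icc.2 zero_le_one) (Set.right_mem_Icc.2 zero_le_one) zero_le_one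
  simp at this
  rw [inner_gradient_eq]
  linarith

lemma add_le (x u : Euc d) : V (x + u) ≤ V x + ⟪gradient V x, u⟫ + M / 2 * ‖u‖ ^ 2 := by
  have hd : ∀ t : ℝ, HasDerivAt
      (fun t : ℝ => t * ⟪gradient V x, u⟫ + M / 2 * ‖u‖ ^ 2 * t ^ 2 - V (x + t • u))
      (1 * ⟪gradient V x, u⟫ + M / 2 * ‖u‖ ^ 2 * (2 * t) - ⟪gradient V (x + t • u), u⟫) t := by
    intro t
    have h3 : HasDerivAt (fun t : ℝ => t ^ 2) (2 * t) t := by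
      simpa using hasDerivAt_pow 2 t
    exact (((hasDerivAt_id t).mul_const _).add (h3.const_mul _)).sub (h.hasDerivAt_line x u t)
  have mono := monotoneOn_of_deriv_nonneg (convex_Icc (0 : ℝ) 1)
    (fun t _ => (hd t).continuousAt.continuousWithinAt)
    (fun t _ => (hd t).differentiableAt.differentiableWithinAt) (fun t ht => by
      rw [(hd t).deriv]
      rw [interior_Icc] at ht
      have h4 := (real_inner_le_norm (gradient V (x + t • u) - gradient V x) u).trans
        (mul_le_mul_of_nonneg_right (h.norm_gradient_sub_le _ _) (norm_nonneg u))
      rw [add_sub_cancel_left, norm_smul, inner_sub_left, norm_eq_abs, abs_of_pos ht.1] at h4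
      nlinarith)
  have := mono (Set.left_mem_Icc.2 zero_le_one) (Set.right_mem_Icc.2 zero_le_one) zero_le_one
  simp at this
  rw [inner_gradient_eq]
  linarith

lemma midStrongConvex : MidStrongConvex m V := by
  intro x y
  set z := (1 / 2 : ℝ) • (x + y) with hz
  set u := (1 / 2 : ℝ) • (x - y) with hu
  have hx : x = z + u := by rw [hz, hu]; module
  have hy : y = z + -u := by rw [hz, hu]; module
  have h1 := h.le_add z u
  have h2 := h.le_add z (-u)
  rw [← hx] at h1
  rw [← hy, norm_neg, inner_neg_right] at h2
  have h3 : ‖u‖ = 1 / 2 * ‖x - y‖ := by rw [hu, norm_smul]; norm_num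
  rw [h3] at h1 h2
  nlinarith

end RegPotential

/-- `T` maps each sample to a minimizer of the empirical risk. -/
def IsMLE {d n : ℕ} (V : Euc d → ℝ) (T : (Fin n → Euc d) → Euc d) : Prop :=
  ∀ x θ', ∑ j, V (x j - T x) ≤ ∑ j, V (x j - θ')

namespace IsMLE

variable {d n : ℕ} {M m : ℝ} {V : Euc d → ℝ} {T : (Fin n → Euc d) → Euc d}
  (hT : IsMLE V T) (h : RegPotential M m V) (hM : 0 < M) (hm : 0 < m) (hn : 0 < n)

include hT h hM hn in
lemma sum_gradient_eq_zero (x : Fin n → Euc d) : ∑ j, gradient V (x j - T x) = 0 := by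
  set S := ∑ j, gradient V (x j - T x) with hS
  have hnM : 0 < (n : ℝ) * M := by positivity
  have key : ∀ u : Euc d, ⟪S, u⟫ ≤ n * M / 2 * ‖u‖ ^ 2 := by
    intro u
    have h1 := hT x (T x + u)
    have h2 : ∑ j, V (x j - (T x + u)) ≤
        ∑ j, (V (x j - T x) - ⟪gradient V (x j - T x), u⟫ + M / 2 * ‖u‖ ^ 2) := by
      refine Finset.sum_le_sum fun j _ => ?_
      have := h.add_le (x j - T x) (-u)
      rw [norm_neg, inner_neg_right, show x j - T x + -u = x j - (T x + u) by abel] at this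
      linarith
    rw [Finset.sum_add_distrib, Finset.sum_sub_distrib, ← sum_inner, ← hS] at h2
    simp at h2
    linarith
  have h3 := key ((1 / (n * M)) • S)
  rw [inner_smul_right, real_inner_self_eq_norm_sq, norm_smul, norm_eq_abs, mul_pow, sq_abs] at h3
  have h4 : (n : ℝ) * M / 2 * ((1 / (n * M)) ^ 2 * ‖S‖ ^ 2) = 1 / (n * M) * ‖S‖ ^ 2 / 2 := by
    field_simp
  rw [h4] at h3
  have h5 : 1 / (n * M) * ‖S‖ ^ 2 ≤ 0 := by linarith
  have h6 : 0 < 1 / ((n : ℝ) * M) := by positivity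
  have h7 : ‖S‖ ^ 2 ≤ 0 := by
    by_contra h8
    push Not at h8
    have := mul_pos h6 h8
    linarith
  have : ‖S‖ = 0 := by nlinarith [norm_nonneg S]
  exact norm_eq_zero.1 this

include h in
lemma _root_.RegPotential.le_inner_sum_gradient (x : Fin n → Euc d) (a b : Euc d) :
    n * m * ‖a - b‖ ^ 2 ≤ ⟪∑ j, gradient V (x j - b) - ∑ j, gradient V (x j - a), a - b⟫ := by
  rw [← Finset.sum_sub_distrib, sum_inner]
  have : ∑ j : Fin n, m * ‖a - b‖ ^ 2 ≤
      ∑ j, ⟪gradient V (x j - b) - gradient V (x j - a), a - b⟫ := by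
    refine Finset.sum_le_sum fun j _ => ?_
    have := h.le_inner_gradient_sub (x j - b) (x j - a)
    rwa [show x j - b - (x j - a) = a - b by abel] at this
  simpa [mul_assoc] using this

include hT h hM hm hn in
lemma norm_sub_le (x : Fin n → Euc d) (b : Euc d) :
    ‖T x - b‖ ≤ (n * m)⁻¹ * ‖∑ j, gradient V (x j - b)‖ := by
  have h1 := h.le_inner_sum_gradient x (T x) b
  rw [hT.sum_gradient_eq_zero h hM hn, sub_zero] at h1
  have h2 := h1.trans (real_inner_le_norm _ _)
  have hnm : 0 < (n : ℝ) * m := by positivity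
  rw [← div_eq_inv_mul, le_div_iff₀ hnm]
  rcases (norm_nonneg (T x - b)).eq_or_lt with h0 | h0
  · rw [← h0, zero_mul]; exact norm_nonneg _
  · nlinarith

include hT h hM hm hn in
lemma eq_of_sum_gradient_eq_zero (x : Fin n → Euc d) (b : Euc d)
    (hb : ∑ j, gradient V (x j - b) = 0) : T x = b := by
  have := hT.norm_sub_le h hM hm hn x b
  rw [hb, norm_zero, mul_zero] at this
  exact sub_eq_zero.1 (norm_le_zero_iff.1 this)

include hT h hM hm hn in
lemma add_equivariant (x : Fin n → Euc d) (a : Euc d) : T (fun j => a + x j) = a + T x := by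
  refine hT.eq_of_sum_gradient_eq_zero h hM hm hn _ _ ?_
  simpa using hT.sum_gradient_eq_zero h hM hn x

include hT h hM hm hn in
lemma norm_le (x : Fin n → Euc d) : ‖T x‖ ≤ (n * m)⁻¹ * ‖∑ j, gradient V (x j)‖ := by
  simpa using hT.norm_sub_le h hM hm hn x 0

include hT h hM hm hn in
lemma norm_sub_le_sum (x y : Fin n → Euc d) :
    ‖T x - T y‖ ≤ M / (n * m) * ∑ j, ‖x j - y j‖ := by
  have h1 := hT.norm_sub_le h hM hm hn x (T y)
  have h2 : ‖∑ j, gradient V (x j - T y)‖ ≤ M * ∑ j, ‖x j - y j‖ := by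
    rw [← sub_zero (∑ j, gradient V (x j - T y)), ← hT.sum_gradient_eq_zero h hM hn y,
      ← Finset.sum_sub_distrib, Finset.mul_sum]
    refine (norm_sum_le _ _).trans (Finset.sum_le_sum fun j _ => ?_)
    have := h.norm_gradient_sub_le (x j - T y) (y j - T y)
    rwa [sub_sub_sub_cancel_right] at this
  have h3 : 0 ≤ ((n : ℝ) * m)⁻¹ := by positivity
  calc _ ≤ ((n : ℝ) * m)⁻¹ * (M * ∑ j, ‖x j - y j‖) := h1.trans (by gcongr)
    _ = _ := by rw [div_eq_mul_inv]; ring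

include hT h hM hm hn in
lemma continuous : Continuous T := by
  refine continuous_iff_continuousAt.2 fun y => ?_
  rw [ContinuousAt, tendsto_iff_norm_sub_tendsto_zero]
  refine squeeze_zero (fun _ => norm_nonneg _) (fun x => hT.norm_sub_le_sum h hM hm hn x y) ?_
  have : Continuous fun x : Fin n → Euc d => M / (n * m) * ∑ j, ‖x j - y j‖ := by fun_prop
  simpa using this.tendsto y

include hT h hM hm hn in
lemma norm_update_sub_le (x : Fin n → Euc d) (i : Fin n) (y z : Euc d) :
    ‖T (Function.update x i y) - T (Function.update x i z)‖ ≤ M / (n * m) * ‖y - z‖ := by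
  refine (hT.norm_sub_le_sum h hM hm hn _ _).trans (le_of_eq ?_)
  rw [Finset.sum_eq_single i]
  · simp
  · intro j _ hj
    simp [Function.update_of_ne hj]
  · simp

include hT h hM hm hn in
/-- Shifting the observations indexed by `S` moves the estimator by a comparable amount. -/
lemma norm_sub_le_shift (x : Fin n → Euc d) (S : Finset (Fin n)) (hS : S.Nonempty) (s t : Euc d) :
    ‖s - t‖ ≤ (1 + M * n / (m * S.card)) *
      ‖T (fun j => if j ∈ S then x j + s else x j) - T (fun j => if j ∈ S then x j + t else x j)‖ := by
  set a := T (fun j => if j ∈ S then x j + s else x j) with ha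
  set b := T (fun j => if j ∈ S then x j + t else x j) with hb
  set e := (s - a) - (t - b) with he
  have za := hT.sum_gradient_eq_zero h hM hn (fun j => if j ∈ S then x j + s else x j)
  have zb := hT.sum_gradient_eq_zero h hM hn (fun j => if j ∈ S then x j + t else x j)
  rw [← ha] at za
  rw [← hb] at zb
  have hc : 0 < (S.card : ℝ) := by exact_mod_cast hS.card_pos
  have spl : ∀ (u v : Euc d), ∑ j, gradient V ((if j ∈ S then x j + u else x j) - v) =
      ∑ j ∈ S, gradient V (x j + (u - v)) + ∑ j ∈ Sᶜ, gradient V (x j - v) := by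
    intro u v
    rw [← Finset.sum_add_sum_compl S]
    congr 1
    · refine Finset.sum_congr rfl fun j hj => ?_
      rw [if_pos hj, add_sub_assoc]
    · refine Finset.sum_congr rfl fun j hj => ?_
      rw [if_neg (Finset.mem_compl.1 hj)]
  rw [spl] at za zb
  have low : S.card * (m * ‖e‖ ^ 2) ≤
      ⟪∑ j ∈ S, (gradient V (x j + (s - a)) - gradient V (x j + (t - b))), e⟫ := by
    rw [sum_inner, ← nsmul_eq_mul, ← Finset.sum_const]
    refine Finset.sum_le_sum fun j _ => ?_
    have := h.le_inner_gradient_sub (x j + (s - a)) (x j + (t - b))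
    rwa [add_sub_add_left_eq_sub] at this
  have eq : ∑ j ∈ S, (gradient V (x j + (s - a)) - gradient V (x j + (t - b))) =
      -∑ j ∈ Sᶜ, (gradient V (x j - a) - gradient V (x j - b)) := by
    rw [Finset.sum_sub_distrib, Finset.sum_sub_distrib]
    have h1 := eq_neg_of_add_eq_zero_left za
    have h2 := eq_neg_of_add_eq_zero_left zb
    rw [h1, h2]; abel
  have up : ‖∑ j ∈ Sᶜ, (gradient V (x j - a) - gradient V (x j - b))‖ ≤ n * (M * ‖a - b‖) := by
    refine (norm_sum_le_of_le (f := fun j => gradient V (x j - a) - gradient V (x j - b)) _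
      (n := fun _ => M * ‖a - b‖) fun j _ => ?_).trans ?_
    · have := h.norm_gradient_sub_le (x j - a) (x j - b)
      rwa [sub_sub_sub_cancel_left, norm_sub_rev b a] at this
    · rw [Finset.sum_const, nsmul_eq_mul]
      gcongr
      simpa using Finset.card_le_univ Sᶜ
  rw [eq] at low
  have low2 := low.trans (real_inner_le_norm _ _)
  rw [norm_neg] at low2
  have h3 : ‖e‖ ≤ M * n / (m * S.card) * ‖a - b‖ := by
    rw [div_mul_eq_mul_div, le_div_iff₀ (by positivity)]
    rcases (norm_nonneg e).eq_or_lt with h0 | h0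
    · rw [← h0, zero_mul]; positivity
    · have := low2.trans (mul_le_mul_of_nonneg_right up h0.le)
      nlinarith
  have h4 : s - t = (a - b) + e := by rw [he]; abel
  calc ‖s - t‖ ≤ ‖a - b‖ + ‖e‖ := by rw [h4]; exact norm_add_le _ _
    _ ≤ _ := by linarith

end IsMLE

section Information

variable {d : ℕ} {M m : ℝ} {V : Euc d → ℝ} (h : RegPotential M m V)
  [IsProbabilityMeasure (noiseMeasure V)] {J Jinv : Euc d →L[ℝ] Euc d}
  (hJ : ∀ u v : Euc d, ⟪J u, v⟫ = ∫ x, ⟪hess V x u, v⟫ ∂noiseMeasure V)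

include h in
lemma RegPotential.integrable_inner_hess (u v : Euc d) :
    Integrable (fun x => ⟪hess V x u, v⟫) (noiseMeasure V) := by
  have := h.continuous_hess
  exact Integrable.of_bound (by fun_prop) (M * ‖u‖ * ‖v‖) (ae_of_all _ fun x => h.inner_hess_le x u v)

include h hJ

omit [IsProbabilityMeasure (noiseMeasure V)] in
lemma information_symm (u v : Euc d) : ⟪J u, v⟫ = ⟪J v, u⟫ := by
  rw [hJ, hJ]
  exact integral_congr_ae (ae_of_all _ fun x => h.hess_symm x u v)

lemma le_inner_information (u : Euc d) : m * ‖u‖ ^ 2 ≤ ⟪J u, u⟫ := by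
  rw [hJ]
  have : ∫ _, m * ‖u‖ ^ 2 ∂noiseMeasure V ≤ ∫ x, ⟪hess V x u, u⟫ ∂noiseMeasure V :=
    integral_mono (integrable_const _) (h.integrable_inner_hess u u) fun x => h.le_inner_hess x u
  simpa using this

lemma norm_information_apply_le (u : Euc d) : ‖J u‖ ≤ M * ‖u‖ := by
  have h1 : ⟪J u, J u⟫ ≤ M * ‖u‖ * ‖J u‖ := by
    rw [hJ]
    exact (le_abs_self _).trans (abs_integral_le_of_abs_le fun x => h.inner_hess_le x u (J u))
  rw [real_inner_self_eq_norm_sq] at h1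
  rcases (norm_nonneg (J u)).eq_or_lt with h0 | h0
  · rw [← h0]; exact mul_nonneg h.nonneg_M (norm_nonneg _)
  · nlinarith

lemma norm_information_inv_le (hm : 0 < m) (hJJ : ∀ u, J (Jinv u) = u) (u : Euc d) :
    ‖Jinv u‖ ≤ ‖u‖ / m := by
  have h1 := le_inner_information h hJ (Jinv u)
  rw [hJJ] at h1
  have h2 := h1.trans (real_inner_le_norm _ _)
  rw [le_div_iff₀ hm]
  rcases (norm_nonneg (Jinv u)).eq_or_lt with h0 | h0
  · rw [← h0, zero_mul]; exact norm_nonneg _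
  · nlinarith

end Information

section GaussianMoments

lemma ofReal_exp_add (a b : ℝ) :
    ENNReal.ofReal (rexp (a + b)) = ENNReal.ofReal (rexp a) * ENNReal.ofReal (rexp b) := by
  rw [Real.exp_add, ENNReal.ofReal_mul (Real.exp_pos _).le]

lemma ofReal_exp_sum {ι : Type*} (s : Finset ι) (a : ι → ℝ) :
    ENNReal.ofReal (rexp (∑ i ∈ s, a i)) = ∏ i ∈ s, ENNReal.ofReal (rexp (a i)) := by
  rw [Real.exp_sum, ENNReal.ofReal_prod_of_nonneg fun _ _ => (Real.exp_pos _).le]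

lemma lintegral_ofReal_exp_neg_mul_sq {d : ℕ} {b : ℝ} (hb : 0 < b) :
    ∫⁻ u : Euc d, ENNReal.ofReal (rexp (-b * ‖u‖ ^ 2)) =
      ENNReal.ofReal ((π / b) ^ ((d : ℝ) / 2)) := by
  have e := GaussianFourier.integral_rexp_neg_mul_sq_norm (V := Euc d) hb
  have hpos : 0 < (π / b) ^ ((d : ℝ) / 2) := by positivity
  simp only [finrank_euclideanSpace_fin] at e
  rw [← e, ← ofReal_integral_eq_lintegral_ofReal _ (ae_of_all _ fun _ => (Real.exp_pos _).le)]
  by_contra hni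
  rw [integral_undef hni] at e
  exact hpos.ne e

lemma lintegral_ofReal_exp_inner_sub {d : ℕ} {b : ℝ} (hb : 0 < b) (y : Euc d) :
    ∫⁻ u : Euc d, ENNReal.ofReal (rexp (⟪y, u⟫ - b * ‖u‖ ^ 2)) =
      ENNReal.ofReal (rexp (‖y‖ ^ 2 / (4 * b))) * ENNReal.ofReal ((π / b) ^ ((d : ℝ) / 2)) := by
  have key : ∀ u : Euc d, ENNReal.ofReal (rexp (⟪y, u⟫ - b * ‖u‖ ^ 2)) =
      ENNReal.ofReal (rexp (‖y‖ ^ 2 / (4 * b))) *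
        ENNReal.ofReal (rexp (-b * ‖u + (-(2 * b)⁻¹) • y‖ ^ 2)) := fun u => by
    rw [← ofReal_exp_add]
    congr 2
    rw [norm_add_sq_real, inner_smul_right, norm_smul, real_inner_comm, mul_pow, Real.norm_eq_abs,
      sq_abs]
    field_simp
    ring
  simp_rw [key]
  rw [lintegral_const_mul _ (by fun_prop),
    lintegral_add_right_eq_self (fun u : Euc d => ENNReal.ofReal (rexp (-b * ‖u‖ ^ 2))),
    lintegral_ofReal_exp_neg_mul_sq hb]

/-- A vector with sub-Gaussian exponential moments has a square-exponential moment. -/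
lemma lintegral_exp_sq_le {Ω : Type*} [MeasurableSpace Ω] {μ : Measure Ω} [SFinite μ] {d : ℕ}
    {v : ℝ} (hv : 0 < v) {Y : Ω → Euc d} (hY : Measurable Y)
    (h : ∀ u, ∫⁻ ω, ENNReal.ofReal (rexp ⟪Y ω, u⟫) ∂μ ≤ ENNReal.ofReal (rexp (v * ‖u‖ ^ 2 / 2))) :
    ∫⁻ ω, ENNReal.ofReal (rexp (‖Y ω‖ ^ 2 / (4 * v))) ∂μ ≤ ENNReal.ofReal (rexp d) := by
  have hc : ENNReal.ofReal ((π / v) ^ ((d : ℝ) / 2)) ≠ 0 := by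
    rw [Ne, ENNReal.ofReal_eq_zero, not_le]; positivity
  rw [← ENNReal.mul_le_mul_iff_left hc ENNReal.ofReal_ne_top, ← lintegral_mul_const _ (by fun_prop)]
  simp_rw [← lintegral_ofReal_exp_inner_sub hv]
  rw [lintegral_lintegral_swap (by fun_prop)]
  calc ∫⁻ u : Euc d, ∫⁻ ω, ENNReal.ofReal (rexp (⟪Y ω, u⟫ - v * ‖u‖ ^ 2)) ∂μ
      = ∫⁻ u : Euc d, ENNReal.ofReal (rexp (-(v * ‖u‖ ^ 2))) *
          ∫⁻ ω, ENNReal.ofReal (rexp ⟪Y ω, u⟫) ∂μ := by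
        refine lintegral_congr fun u => ?_
        rw [← lintegral_const_mul _ (by fun_prop)]
        refine lintegral_congr fun ω => ?_
        rw [← ofReal_exp_add, neg_add_eq_sub]
    _ ≤ ∫⁻ u : Euc d, ENNReal.ofReal (rexp (-(v / 2) * ‖u‖ ^ 2)) := by
        refine lintegral_mono fun u => (mul_le_mul_right (h u) _).trans_eq ?_
        rw [← ofReal_exp_add]
        congr 2
        ring
    _ ≤ _ := by
        rw [lintegral_ofReal_exp_neg_mul_sq (by positivity), ← ENNReal.ofReal_mul (by positivity)]
        apply ENNReal.ofReal_le_ofReal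
        rw [show π / (v / 2) = 2 * (π / v) by field_simp, Real.mul_rpow (by norm_num) (by positivity)]
        gcongr
        calc (2 : ℝ) ^ ((d : ℝ) / 2) ≤ (rexp 2) ^ ((d : ℝ) / 2) := by
              apply Real.rpow_le_rpow (by norm_num) _ (by positivity)
              linarith [Real.add_one_le_exp (2 : ℝ)]
          _ = rexp d := by rw [← Real.exp_mul]; congr 1; ring

lemma lintegral_pi_prod {E : Type*} [MeasurableSpace E] (μ : Measure E) [SigmaFinite μ] (n : ℕ)
    (f : Fin n → E → ℝ≥0∞) (hf : ∀ i, Measurable (f i)) :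
    ∫⁻ x, ∏ i, f i (x i) ∂(Measure.pi fun _ : Fin n => μ) = ∏ i, ∫⁻ y, f i y ∂μ := by
  induction n with
  | zero => simp
  | succ n ih =>
    have e := (measurePreserving_piFinSuccAbove (fun _ : Fin (n + 1) => μ) 0).symm
    rw [← e.lintegral_comp_emb (MeasurableEquiv.measurableEmbedding _), Fin.prod_univ_succ, ← ih _ fun i => hf _]
    simp only [Fin.prod_univ_succ, MeasurableEquiv.piFinSuccAbove_symm_apply, Fin.insertNthEquiv_apply]
    simp only [Fin.insertNth_apply_same, Fin.insertNth_zero', Fin.cons_succ]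
    rw [← lintegral_prod_mul (g := fun y : Fin n → E => ∏ i, f i.succ (y i)) (hf 0).aemeasurable
      (Finset.measurable_prod _ fun i _ => (hf _).comp (measurable_pi_apply i)).aemeasurable]

/-- The product of measures with a density has the product density. -/
lemma pi_withDensity {E : Type*} [MeasurableSpace E] (μ : Measure E) [SigmaFinite μ] (n : ℕ)
    {p : E → ℝ≥0∞} (hp : Measurable p) [SigmaFinite (μ.withDensity p)] :
    Measure.pi (fun _ : Fin n => μ.withDensity p) =
      (Measure.pi fun _ : Fin n => μ).withDensity fun x => ∏ i, p (x i) := by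
  refine (Measure.pi_eq fun s hs => ?_)
  rw [withDensity_apply _ (MeasurableSet.univ_pi hs), ← lintegral_indicator (MeasurableSet.univ_pi hs)]
  calc _ = ∫⁻ x, ∏ i, (s i).indicator p (x i) ∂(Measure.pi fun _ : Fin n => μ) := by
        refine lintegral_congr fun x => ?_
        by_cases hx : x ∈ Set.univ.pi s
        · rw [Set.indicator_of_mem hx]
          exact Finset.prod_congr rfl fun i _ => (Set.indicator_of_mem (hx i trivial) _).symm
        · rw [Set.indicator_of_notMem hx]
          simp only [Set.mem_pi, Set.mem_univ, true_implies, not_forall] at hx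
          obtain ⟨i, hi⟩ := hx
          exact (Finset.prod_eq_zero (Finset.mem_univ i) (Set.indicator_of_notMem hi _)).symm
    _ = _ := by
        rw [lintegral_pi_prod _ _ _ fun i => hp.indicator (hs i)]
        refine Finset.prod_congr rfl fun i _ => ?_
        rw [withDensity_apply _ (hs i), lintegral_indicator (hs i)]

/-- Square-exponential moments of sums of i.i.d. sub-Gaussian vectors. -/
lemma lintegral_exp_sq_sum_le {E : Type*} [MeasurableSpace E] {μ : Measure E}
    [IsProbabilityMeasure μ] {d n : ℕ} {v : ℝ} (hv : 0 < v) (hn : 0 < n) {b : E → Euc d}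
    (hb : Measurable b)
    (h : ∀ u, ∫⁻ x, ENNReal.ofReal (rexp ⟪b x, u⟫) ∂μ ≤ ENNReal.ofReal (rexp (v * ‖u‖ ^ 2 / 2)))
    (S : Finset (Fin n)) :
    ∫⁻ x, ENNReal.ofReal (rexp (‖∑ j ∈ S, b (x j)‖ ^ 2 / (4 * (n * v))))
      ∂(Measure.pi fun _ : Fin n => μ) ≤ ENNReal.ofReal (rexp d) := by
  refine lintegral_exp_sq_le (by positivity) (by fun_prop) fun u => ?_
  classical
  have e : ∀ x : Fin n → E, ENNReal.ofReal (rexp ⟪∑ j ∈ S, b (x j), u⟫) =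
      ∏ j, (if j ∈ S then fun y => ENNReal.ofReal (rexp ⟪b y, u⟫) else fun _ => 1) (x j) := by
    intro x
    rw [sum_inner, ofReal_exp_sum]
    simp only [ite_apply, Finset.prod_ite_mem, Finset.univ_inter]
  simp_rw [e]
  rw [lintegral_pi_prod _ _ _ fun j => by split_ifs <;> fun_prop]
  calc _ ≤ ∏ j : Fin n, ENNReal.ofReal (rexp (v * ‖u‖ ^ 2 / 2)) := by
        refine Finset.prod_le_prod' fun j _ => ?_
        split_ifs
        · exact h u
        · simp only [lintegral_const, measure_univ, mul_one]
          rw [ENNReal.one_le_ofReal]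
          exact Real.one_le_exp (by positivity)
    _ = _ := by
        rw [Finset.prod_const, Finset.card_univ, Fintype.card_fin,
          ← ENNReal.ofReal_pow (Real.exp_pos _).le, ← Real.exp_nat_mul]
        congr 2
        ring

/-- Hoeffding's lemma for a bounded random vector. -/
lemma lintegral_exp_inner_sub_integral_le {E : Type*} [MeasurableSpace E] {μ : Measure E}
    [IsProbabilityMeasure μ] {d : ℕ} {K : ℝ} {a : E → Euc d} (ha : Measurable a)
    (hK : ∀ x, ‖a x‖ ≤ K) (u : Euc d) :
    ∫⁻ x, ENNReal.ofReal (rexp ⟪a x - ∫ y, a y ∂μ, u⟫) ∂μ ≤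
      ENNReal.ofReal (rexp (K ^ 2 * ‖u‖ ^ 2 / 2)) := by
  have ia : Integrable a μ := Integrable.of_bound ha.aestronglyMeasurable K (ae_of_all _ hK)
  have hb : ∀ x, ⟪a x, u⟫ ∈ Set.Icc (-(K * ‖u‖)) (K * ‖u‖) := fun x => by
    rw [Set.mem_Icc, ← abs_le]
    exact (abs_real_inner_le_norm _ _).trans (by gcongr; exact hK x)
  have hs := ProbabilityTheory.hasSubgaussianMGF_of_mem_Icc (μ := μ) (X := fun x => ⟪a x, u⟫)
    (by fun_prop) (ae_of_all _ hb)
  have hi : ∫ x, ⟪a x, u⟫ ∂μ = ⟪∫ x, a x ∂μ, u⟫ := by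
    simp_rw [real_inner_comm u]
    rw [integral_inner ia, real_inner_comm]
  simp only [hi, ← inner_sub_left] at hs
  have h1 := hs.mgf_le 1
  have h2 := hs.integrable_exp_mul 1
  simp only [ProbabilityTheory.mgf, one_mul] at h1 h2
  rw [← ofReal_integral_eq_lintegral_ofReal h2 (ae_of_all _ fun _ => (Real.exp_pos _).le)]
  refine ENNReal.ofReal_le_ofReal (h1.trans (Real.exp_le_exp.2 (le_of_eq ?_)))
  push_cast
  rw [Real.norm_eq_abs, div_pow, sq_abs]
  ring

end GaussianMoments

section Noise

lemma isProbabilityMeasure_noiseMeasure {d : ℕ} {V : Euc d → ℝ}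
    (hV : Measurable V) (hint : ∫ x, rexp (-(V x)) = 1) : IsProbabilityMeasure (noiseMeasure V) := by
  have i : Integrable fun x => rexp (-(V x)) := by
    by_contra hni
    rw [integral_undef hni] at hint
    exact zero_ne_one hint
  constructor
  have := lintegral_noiseMeasure hV (f := fun _ => 1) measurable_const
  simp only [lintegral_const, one_mul, mul_one] at this
  rw [this, ← ofReal_integral_eq_lintegral_ofReal i (ae_of_all _ fun _ => (Real.exp_pos _).le), hint,
    ENNReal.ofReal_one]

lemma integral_noiseMeasure {d : ℕ} {V : Euc d → ℝ} (hV : Measurable V) (g : Euc d → ℝ) :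
    ∫ x, g x ∂noiseMeasure V = ∫ x, rexp (-(V x)) * g x := by
  rw [noiseMeasure, integral_withDensity_eq_integral_toReal_smul (by fun_prop)
    (ae_of_all _ fun _ => ENNReal.ofReal_lt_top)]
  simp [ENNReal.toReal_ofReal (Real.exp_pos _).le]

lemma integrable_noiseMeasure_iff {d : ℕ} {V : Euc d → ℝ} (hV : Measurable V) {g : Euc d → ℝ} :
    Integrable g (noiseMeasure V) ↔ Integrable fun x => rexp (-(V x)) * g x := by
  rw [noiseMeasure, integrable_withDensity_iff_integrable_smul' (by fun_prop)
    (ae_of_all _ fun _ => ENNReal.ofReal_lt_top)]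
  simp [ENNReal.toReal_ofReal (Real.exp_pos _).le]

lemma lintegral_pi_noiseMeasure {d : ℕ} {V : Euc d → ℝ} (hV : Measurable V)
    [IsProbabilityMeasure (noiseMeasure V)] (n : ℕ) {f : (Fin n → Euc d) → ℝ≥0∞}
    (hf : Measurable f) :
    ∫⁻ x, f x ∂(Measure.pi fun _ => noiseMeasure V) =
      ∫⁻ x, ENNReal.ofReal (rexp (∑ j, -(V (x j)))) * f x := by
  have : SigmaFinite (volume.withDensity fun x => ENNReal.ofReal (rexp (-(V x)))) :=
    inferInstanceAs (SigmaFinite (noiseMeasure V))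
  simp_rw [ofReal_exp_sum]
  unfold noiseMeasure
  rw [pi_withDensity _ _ (by fun_prop), lintegral_withDensity_eq_lintegral_mul _ (by fun_prop) hf,
    volume_pi]
  rfl

namespace RegPotential

variable {d : ℕ} {M m : ℝ} {V : Euc d → ℝ} (h : RegPotential M m V)

include h

lemma measurable : Measurable V := h.differentiable.continuous.measurable

lemma measurable_gradient : Measurable (gradient V) := h.continuous_gradient.measurable

variable [IsProbabilityMeasure (noiseMeasure V)]

lemma lintegral_exp_inner_gradient_le (u : Euc d) :
    ∫⁻ x, ENNReal.ofReal (rexp ⟪gradient V x, u⟫) ∂noiseMeasure V ≤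
      ENNReal.ofReal (rexp (M * ‖u‖ ^ 2 / 2)) := by
  have hg := h.measurable_gradient
  have hV := h.measurable
  have e1 : ∫⁻ x, ENNReal.ofReal (rexp (-(V x))) = 1 := by
    have := lintegral_noiseMeasure hV (f := fun _ => 1) measurable_const
    simpa using this.symm
  rw [lintegral_noiseMeasure hV (by fun_prop)]
  calc _ ≤ ∫⁻ x, ENNReal.ofReal (rexp (M * ‖u‖ ^ 2 / 2)) *
        ENNReal.ofReal (rexp (-(V (x + -u)))) := by
        refine lintegral_mono fun x => ?_
        rw [← ofReal_exp_add, ← ofReal_exp_add]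
        refine ENNReal.ofReal_le_ofReal (Real.exp_le_exp.2 ?_)
        have := h.add_le x (-u)
        rw [norm_neg, inner_neg_right] at this
        linarith
    _ = _ := by
        rw [lintegral_const_mul _ (by fun_prop),
          lintegral_add_right_eq_self (fun x : Euc d => ENNReal.ofReal (rexp (-(V x)))), e1, mul_one]

lemma integral_exp_inner_gradient_le (u : Euc d) :
    Integrable (fun x => rexp ⟪gradient V x, u⟫) (noiseMeasure V) ∧
      ∫ x, rexp ⟪gradient V x, u⟫ ∂noiseMeasure V ≤ rexp (M * ‖u‖ ^ 2 / 2) := by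
  have hg := h.measurable_gradient
  have key := h.lintegral_exp_inner_gradient_le u
  have hi : Integrable (fun x => rexp ⟪gradient V x, u⟫) (noiseMeasure V) :=
    ⟨(by fun_prop : Measurable _).aestronglyMeasurable, by
      rw [hasFiniteIntegral_iff_ofReal (ae_of_all _ fun _ => (Real.exp_pos _).le)]
      exact key.trans_lt ENNReal.ofReal_lt_top⟩
  refine ⟨hi, ?_⟩
  rwa [← ofReal_integral_eq_lintegral_ofReal hi (ae_of_all _ fun _ => (Real.exp_pos _).le),
    ENNReal.ofReal_le_ofReal_iff (Real.exp_pos _).le] at key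

lemma integral_abs_inner_gradient_le (u : Euc d) :
    Integrable (fun x => |⟪gradient V x, u⟫|) (noiseMeasure V) ∧
      ∫ x, |⟪gradient V x, u⟫| ∂noiseMeasure V ≤ 2 * rexp (M / 2) * ‖u‖ := by
  have hg := h.measurable_gradient
  rcases eq_or_ne u 0 with rfl | hu
  · simp
  have hu' : 0 < ‖u‖ := norm_pos_iff.2 hu
  obtain ⟨i1, b1⟩ := h.integral_exp_inner_gradient_le (‖u‖⁻¹ • u)
  obtain ⟨i2, b2⟩ := h.integral_exp_inner_gradient_le (-(‖u‖⁻¹ • u))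
  have e : ‖‖u‖⁻¹ • u‖ = 1 := by rw [norm_smul, norm_inv, norm_norm, inv_mul_cancel₀ hu'.ne']
  rw [norm_neg, e] at b2
  rw [e] at b1
  have pw : ∀ x, |⟪gradient V x, u⟫| ≤
      ‖u‖ * (rexp ⟪gradient V x, ‖u‖⁻¹ • u⟫ + rexp ⟪gradient V x, -(‖u‖⁻¹ • u)⟫) := fun x => by
    rw [inner_neg_right, inner_smul_right]
    set s := ⟪gradient V x, u⟫
    have e2 : |s| = ‖u‖ * |‖u‖⁻¹ * s| := by
      rw [abs_mul, abs_inv, abs_norm, mul_inv_cancel_left₀ hu'.ne']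
    rw [e2]
    gcongr
    have e3 := Real.add_one_le_exp (‖u‖⁻¹ * s)
    have e4 := Real.add_one_le_exp (-(‖u‖⁻¹ * s))
    have e5 := Real.exp_pos (‖u‖⁻¹ * s)
    have e6 := Real.exp_pos (-(‖u‖⁻¹ * s))
    rcases abs_cases (‖u‖⁻¹ * s) with ⟨e7, _⟩ | ⟨e7, _⟩ <;> linarith
  have hi : Integrable (fun x => |⟪gradient V x, u⟫|) (noiseMeasure V) :=
    ((i1.add i2).const_mul ‖u‖).mono' (by fun_prop : Measurable _).aestronglyMeasurable
      (ae_of_all _ fun x => by rw [Real.norm_eq_abs, abs_abs]; exact pw x)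
  refine ⟨hi, (integral_mono hi ((i1.add i2).const_mul ‖u‖) pw).trans ?_⟩
  have : ∫ x, ‖u‖ * (rexp ⟪gradient V x, ‖u‖⁻¹ • u⟫ + rexp ⟪gradient V x, -(‖u‖⁻¹ • u)⟫)
      ∂noiseMeasure V ≤ ‖u‖ * (rexp (M * 1 ^ 2 / 2) + rexp (M * 1 ^ 2 / 2)) := by
    rw [integral_const_mul, integral_add i1 i2]
    gcongr
  refine this.trans (le_of_eq ?_)
  rw [one_pow, mul_one]; ring

/-- Translation is Lipschitz in total variation. -/
lemma abs_integral_shift_sub_le {φ : Euc d → ℝ} (hφ : Measurable φ) {N : ℝ} (hN : ∀ x, |φ x| ≤ N)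
    (u : Euc d) :
    |∫ x, φ (x - u) ∂noiseMeasure V - ∫ x, φ x ∂noiseMeasure V| ≤
      N * (4 * rexp (M / 2) + M + 2) * ‖u‖ := by
  have hN0 : 0 ≤ N := (abs_nonneg _).trans (hN 0)
  have hM0 := h.nonneg_M
  rcases le_total 1 ‖u‖ with hu | hu
  · have b1 := abs_integral_le_of_abs_le (μ := noiseMeasure V) fun x => hN (x - u)
    have b2 := abs_integral_le_of_abs_le (μ := noiseMeasure V) hN
    have b3 := abs_sub (∫ x, φ (x - u) ∂noiseMeasure V) (∫ x, φ x ∂noiseMeasure V)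
    have : N * 2 * 1 ≤ N * (4 * rexp (M / 2) + M + 2) * ‖u‖ := by
      gcongr
      linarith [Real.exp_pos (M / 2)]
    linarith
  have hg := h.measurable_gradient
  have hV := h.measurable
  obtain ⟨ia, ba⟩ := h.integral_abs_inner_gradient_le u
  set r : Euc d → ℝ := fun x => |⟪gradient V x, u⟫| + M / 2 * ‖u‖ ^ 2 with hr
  have ir : Integrable r (noiseMeasure V) := ia.add (integrable_const _)
  have br : ∫ x, r x ∂noiseMeasure V ≤ 2 * rexp (M / 2) * ‖u‖ + M / 2 * ‖u‖ ^ 2 := by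
    rw [hr, integral_add ia (integrable_const _)]
    simpa using ba
  set q : Euc d → ℝ := fun x => rexp (-(V x)) * r x with hq
  have iq : Integrable q := (integrable_noiseMeasure_iff hV).1 ir
  have eq : ∫ x, q x = ∫ x, r x ∂noiseMeasure V := (integral_noiseMeasure hV r).symm
  have iq' : Integrable fun x => q (x + u) := iq.comp_add_right u
  have eq' : ∫ x, q (x + u) = ∫ x, q x := integral_add_right_eq_self q u
  have iφ : Integrable (fun x => φ x) (noiseMeasure V) := integrable_of_abs_le hφ hN
  have iφ' : Integrable (fun x => φ (x - u)) (noiseMeasure V) :=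
    integrable_of_abs_le (by fun_prop) fun x => hN _
  have i1 := (integrable_noiseMeasure_iff hV).1 iφ
  have i2 := ((integrable_noiseMeasure_iff hV).1 iφ').comp_add_right u
  simp only [add_sub_cancel_right] at i2
  have e2 : ∫ x, φ (x - u) ∂noiseMeasure V = ∫ x, rexp (-(V (x + u))) * φ x := by
    rw [integral_noiseMeasure hV,
      ← integral_add_right_eq_self (fun x => rexp (-(V x)) * φ (x - u)) u]
    simp only [add_sub_cancel_right]
  have pw : ∀ x, |rexp (-(V (x + u))) * φ x - rexp (-(V x)) * φ x| ≤ N * (q x + q (x + u)) := by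
    intro x
    rw [← sub_mul, abs_mul, mul_comm]
    have hq0 : ∀ y, 0 ≤ q y := fun y => by simp only [hq, hr]; positivity
    refine mul_le_mul (hN x) ?_ (abs_nonneg _) hN0
    have up : ∀ a b : ℝ, rexp a - rexp b ≤ rexp a * (a - b) := fun a b => by
      have := Real.add_one_le_exp (b - a)
      have e : rexp b = rexp a * rexp (b - a) := by rw [← Real.exp_add]; congr 1; ring
      have := mul_le_mul_of_nonneg_left this (Real.exp_pos a).le
      rw [e]; linarith
    have a1 := h.add_le x u
    have a2 := h.add_le (x + u) (-u)
    rw [norm_neg, inner_neg_right, add_neg_cancel_right] at a2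
    have l1 : rexp (-(V x)) - rexp (-(V (x + u))) ≤ q x := by
      refine (up _ _).trans (mul_le_mul_of_nonneg_left ?_ (Real.exp_pos _).le)
      simp only [hr]
      linarith [le_abs_self ⟪gradient V x, u⟫]
    have l2 : rexp (-(V (x + u))) - rexp (-(V x)) ≤ q (x + u) := by
      refine (up _ _).trans (mul_le_mul_of_nonneg_left ?_ (Real.exp_pos _).le)
      simp only [hr]
      linarith [neg_abs_le ⟪gradient V (x + u), u⟫]
    rw [abs_le]
    constructor <;> linarith [hq0 x, hq0 (x + u)]
  rw [e2, integral_noiseMeasure hV φ, ← integral_sub i2 i1]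
  refine abs_integral_le_integral_abs.trans
    ((integral_mono (i2.sub i1).abs ((iq.add iq').const_mul N) pw).trans ?_)
  have e3 : ∫ x, N * (q x + q (x + u)) = N * (2 * ∫ x, r x ∂noiseMeasure V) := by
    rw [integral_const_mul, integral_add iq iq', eq', eq]; ring
  refine e3.trans_le ?_
  rw [mul_assoc]
  refine mul_le_mul_of_nonneg_left ?_ hN0
  nlinarith [mul_le_mul_of_nonneg_left hu (norm_nonneg u), Real.exp_pos (M / 2), norm_nonneg u]

end RegPotential

end Noise

section Decoupling

lemma map_volume_le_of_antilipschitz {d : ℕ} {F : Euc d → Euc d} {L : ℝ≥0}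
    (hF : AntilipschitzWith L F) (hFm : Measurable F) :
    (volume : Measure (Euc d)).map F ≤ ((L : ℝ≥0∞) ^ d) • (volume : Measure (Euc d)) := by
  refine Measure.le_iff.2 fun s hs => ?_
  rw [Measure.map_apply hFm hs, ← EuclideanSpace.euclideanHausdorffMeasure_eq_volume,
    Measure.euclideanHausdorffMeasure_def, Measure.smul_apply, Measure.smul_apply, Measure.smul_apply]
  have := hF.hausdorffMeasure_preimage_le (d := d) (Nat.cast_nonneg d) s
  rw [ENNReal.rpow_natCast] at this
  calc _ ≤ _ := smul_le_smul_of_nonneg_left this zero_le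
    _ = _ := by simp only [ENNReal.smul_def, smul_eq_mul]; ring

lemma lintegral_comp_le_of_antilipschitz {d : ℕ} {F : Euc d → Euc d} {L : ℝ≥0}
    (hF : AntilipschitzWith L F) (hFm : Measurable F) {f : Euc d → ℝ≥0∞} (hf : Measurable f) :
    ∫⁻ t, f (F t) ≤ (L : ℝ≥0∞) ^ d * ∫⁻ t, f t := by
  rw [← lintegral_map hf hFm]
  exact (lintegral_mono' (map_volume_le_of_antilipschitz hF hFm) le_rfl).trans_eq
    (lintegral_smul_measure _ _)

/-- The sample shift which is constant on the block `S`. -/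
def blockShift {d n : ℕ} (S : Finset (Fin n)) (t : Euc d) : Fin n → Euc d :=
  fun j => if j ∈ S then t else 0

lemma measurable_blockShift {d n : ℕ} (S : Finset (Fin n)) :
    Measurable (blockShift S : Euc d → Fin n → Euc d) := by
  refine measurable_pi_lambda _ fun j => ?_
  unfold blockShift
  split_ifs <;> fun_prop

/-- The estimator may be replaced by an independent Lebesgue-distributed point inside functionals
which are invariant under shifts of the block `S`. -/
lemma IsMLE.lintegral_decouple_le {d n : ℕ} {M m : ℝ} {V : Euc d → ℝ}
    {T : (Fin n → Euc d) → Euc d} (hT : IsMLE V T) (h : RegPotential M m V) (hM : 0 < M)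
    (hm : 0 < m) (hn : 0 < n) [IsProbabilityMeasure (noiseMeasure V)]
    {S : Finset (Fin n)} (hS : S.Nonempty) {Θ : (Fin n → Euc d) → Euc d → ℝ≥0∞}
    (hΘ : Measurable (Function.uncurry Θ)) (hinv : ∀ ξ t u, Θ (ξ + blockShift S t) u = Θ ξ u) :
    ENNReal.ofReal ((π / (S.card * M / 2)) ^ ((d : ℝ) / 2)) *
        ∫⁻ ξ, Θ ξ (T ξ) ∂(Measure.pi fun _ => noiseMeasure V) ≤
      ENNReal.ofReal (1 + M * n / (m * S.card)) ^ d *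
        ∫⁻ ξ, (∫⁻ u, Θ ξ u) ∂(Measure.pi fun _ => noiseMeasure V) := by
  have hV := h.measurable
  have hTm : Measurable T := (hT.continuous h hM hm hn).measurable
  have hs := measurable_blockShift (d := d) S
  have hcard : (0 : ℝ) < S.card := by exact_mod_cast hS.card_pos
  set c := ENNReal.ofReal ((π / (S.card * M / 2)) ^ ((d : ℝ) / 2)) with hc
  set p : (Fin n → Euc d) → ℝ≥0∞ := fun ξ => ENNReal.ofReal (rexp (∑ j, -(V (ξ j)))) with hp
  have hpm : Measurable p := by fun_prop
  have hΘd : ∀ {α : Type} [MeasurableSpace α] {f : α → Fin n → Euc d} {g : α → Euc d},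
      Measurable f → Measurable g → Measurable fun a => Θ (f a) (g a) :=
    fun hf hg => hΘ.comp (hf.prodMk hg)
  have h1 : ∀ ξ, p ξ * c ≤ ∫⁻ t, p (ξ + blockShift S t) := by
    intro ξ
    set g := ∑ j ∈ S, gradient V (ξ j) with hg
    calc p ξ * c ≤ p ξ * ∫⁻ t : Euc d, ENNReal.ofReal (rexp (⟪-g, t⟫ - S.card * M / 2 * ‖t‖ ^ 2)) := by
          rw [lintegral_ofReal_exp_inner_sub (by positivity)]
          gcongr
          refine le_mul_of_one_le_left' ?_
          rw [ENNReal.one_le_ofReal]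
          exact Real.one_le_exp (by positivity)
      _ = ∫⁻ t : Euc d, p ξ * ENNReal.ofReal (rexp (⟪-g, t⟫ - S.card * M / 2 * ‖t‖ ^ 2)) := by
          rw [lintegral_const_mul _ (by fun_prop)]
      _ ≤ _ := by
          refine lintegral_mono fun t => ?_
          simp only [hp]
          rw [← ofReal_exp_add]
          refine ENNReal.ofReal_le_ofReal (Real.exp_le_exp.2 ?_)
          have : ∑ j, V ((ξ + blockShift S t) j) ≤
              ∑ j, (V (ξ j) + if j ∈ S then ⟪gradient V (ξ j), t⟫ + M / 2 * ‖t‖ ^ 2 else 0) := by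
            refine Finset.sum_le_sum fun j _ => ?_
            simp only [Pi.add_apply, blockShift]
            split_ifs
            · rw [← add_assoc]; exact h.add_le _ _
            · simp
          rw [Finset.sum_add_distrib, Finset.sum_ite_mem, Finset.univ_inter, Finset.sum_add_distrib,
            ← sum_inner, ← hg, Finset.sum_const, nsmul_eq_mul] at this
          rw [Finset.sum_neg_distrib, Finset.sum_neg_distrib, inner_neg_left]
          linarith
  have hL : 0 ≤ 1 + M * n / (m * S.card) := by positivity
  have h2 : ∀ ξ, ∫⁻ t, Θ ξ (T (ξ + blockShift S (-t))) ≤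
      ENNReal.ofReal (1 + M * n / (m * S.card)) ^ d * ∫⁻ u, Θ ξ u := by
    intro ξ
    refine lintegral_comp_le_of_antilipschitz (F := fun t => T (ξ + blockShift S (-t)))
      (L := (1 + M * n / (m * S.card)).toNNReal) ?_ (by fun_prop) (hΘd measurable_const measurable_id)
    refine AntilipschitzWith.of_le_mul_dist fun s t => ?_
    have e : ∀ t, ξ + blockShift S t = fun j => if j ∈ S then ξ j + t else ξ j := fun t => by
      ext1 j
      simp only [Pi.add_apply, blockShift]
      split_ifs <;> simp
    rw [Real.coe_toNNReal _ hL, dist_eq_norm, dist_eq_norm, e, e]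
    refine le_trans (le_of_eq ?_) (hT.norm_sub_le_shift h hM hm hn ξ S hS (-s) (-t))
    rw [neg_sub_neg, norm_sub_rev]
  have hΘi : Measurable fun ξ => ∫⁻ u, Θ ξ u := hΘ.lintegral_prod_right'
  rw [lintegral_pi_noiseMeasure hV _ (f := fun ξ => Θ ξ (T ξ)) (hΘd measurable_id hTm),
    lintegral_pi_noiseMeasure hV _ hΘi, ← lintegral_const_mul _ (by fun_prop)]
  calc _ ≤ ∫⁻ ξ, ∫⁻ t, p (ξ + blockShift S t) * Θ ξ (T ξ) := by
        refine lintegral_mono fun ξ => ?_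
        rw [lintegral_mul_const _ (by fun_prop), ← mul_assoc, mul_comm c]
        gcongr
        exact h1 ξ
    _ = ∫⁻ t, ∫⁻ ξ, p (ξ + blockShift S t) * Θ ξ (T ξ) := by
        refine lintegral_lintegral_swap (Measurable.aemeasurable ?_)
        exact (by fun_prop : Measurable fun x : (Fin n → Euc d) × Euc d =>
          p (x.1 + blockShift S x.2)).mul (hΘd measurable_fst (hTm.comp measurable_fst))
    _ = ∫⁻ t, ∫⁻ ξ, p ξ * Θ ξ (T (ξ + blockShift S (-t))) := by
        refine lintegral_congr fun t => ?_
        have e0 : blockShift (n := n) S (-t) = -blockShift S t := by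
          ext1 j; simp only [blockShift, Pi.neg_apply]; split_ifs <;> simp
        rw [← lintegral_add_right_eq_self
          (fun ξ => p ξ * Θ ξ (T (ξ + blockShift S (-t)))) (blockShift S t)]
        refine lintegral_congr fun ξ => ?_
        rw [hinv, e0, add_neg_cancel_right]
    _ = ∫⁻ ξ, ∫⁻ t, p ξ * Θ ξ (T (ξ + blockShift S (-t))) := by
        refine (lintegral_lintegral_swap (Measurable.aemeasurable ?_)).symm
        exact (by fun_prop : Measurable fun x : (Fin n → Euc d) × Euc d => p x.1).mul
          (hΘd measurable_fst (by fun_prop))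
    _ ≤ ∫⁻ ξ, ENNReal.ofReal (1 + M * n / (m * S.card)) ^ d * (p ξ * ∫⁻ u, Θ ξ u) := by
        refine lintegral_mono fun ξ => ?_
        rw [lintegral_const_mul _ (hΘd measurable_const (by fun_prop)), mul_left_comm]
        gcongr
        exact h2 ξ
    _ = _ := by
        exact lintegral_const_mul _ (hpm.mul hΘi)

end Decoupling

namespace IsMLE

variable {d n : ℕ} {M m : ℝ} {V : Euc d → ℝ} {T : (Fin n → Euc d) → Euc d}
  (hT : IsMLE V T) (h : RegPotential M m V) (hM : 0 < M) (hm : 0 < m) (hn : 0 < n)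
  [IsProbabilityMeasure (noiseMeasure V)]

include hT h hM hm hn

lemma lintegral_exp_norm_sq_le :
    ∫⁻ x, ENNReal.ofReal (rexp (m ^ 2 / (4 * M) * (n * ‖T x‖ ^ 2)))
      ∂(Measure.pi fun _ => noiseMeasure V) ≤ ENNReal.ofReal (rexp d) := by
  refine le_trans (lintegral_mono fun x => ENNReal.ofReal_le_ofReal (Real.exp_le_exp.2 ?_))
    (lintegral_exp_sq_sum_le hM hn h.measurable_gradient h.lintegral_exp_inner_gradient_le
      Finset.univ)
  have hn' : (0 : ℝ) < n := by exact_mod_cast hn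
  have := pow_le_pow_left₀ (norm_nonneg _) (hT.norm_le h hM hm hn x) 2
  calc _ ≤ m ^ 2 / (4 * M) * (n * ((n * m)⁻¹ * ‖∑ j, gradient V (x j)‖) ^ 2) := by gcongr
    _ = _ := by field_simp

/-- Square-exponential moment of a centred block sum of a random field, evaluated at the
estimator. -/
lemma lintegral_exp_block_le {K : ℝ} (hK : 0 < K) {a : Euc d → Euc d → Euc d}
    (ha : Measurable (Function.uncurry a)) (haK : ∀ u x, ‖a u x‖ ≤ K) (R : Finset (Fin n))
    (hR : n ≤ 3 * (Rᶜ).card) :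
    ∫⁻ x, ENNReal.ofReal (rexp (‖∑ j ∈ R, (a (T x) (x j) - ∫ y, a (T x) y ∂noiseMeasure V)‖ ^ 2 /
        (8 * (n * K ^ 2)))) ∂(Measure.pi fun _ => noiseMeasure V) ≤
      ENNReal.ofReal (((1 + 3 * M / m) * rexp 1 * (2 * M ^ 2 / m ^ 2 + 1)) ^ d) +
        ENNReal.ofReal (rexp d) := by
  have hn' : (0 : ℝ) < n := by exact_mod_cast hn
  set b := m ^ 2 / (4 * M) with hb
  have hb0 : 0 < b := by positivity
  have hcard : 0 < (Rᶜ).card := by omega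
  have hcard' : (0 : ℝ) < (Rᶜ).card := by exact_mod_cast hcard
  have hcn : ((Rᶜ).card : ℝ) ≤ n := by
    exact_mod_cast (Finset.card_le_univ _).trans_eq (Fintype.card_fin n)
  have hcn3 : (n : ℝ) ≤ 3 * (Rᶜ).card := by exact_mod_cast hR
  have hTm : Measurable T := (hT.continuous h hM hm hn).measurable
  have ham : Measurable fun u => ∫ y, a u y ∂noiseMeasure V :=
    (StronglyMeasurable.integral_prod_right' ha.stronglyMeasurable).measurable
  set Y : (Fin n → Euc d) → Euc d → Euc d := fun x u =>
    ∑ j ∈ R, (a u (x j) - ∫ y, a u y ∂noiseMeasure V) with hY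
  have hYm : Measurable (Function.uncurry Y) := by
    refine Finset.measurable_sum _ fun j _ => ?_
    exact (ha.comp (measurable_snd.prodMk ((measurable_pi_apply j).comp measurable_fst))).sub
      (ham.comp measurable_snd)
  set Θ : (Fin n → Euc d) → Euc d → ℝ≥0∞ := fun x u =>
    ENNReal.ofReal (rexp (‖Y x u‖ ^ 2 / (4 * (n * K ^ 2)) - b * n * ‖u‖ ^ 2)) with hΘ
  have hΘm : Measurable (Function.uncurry Θ) := by
    have : Measurable fun p : (Fin n → Euc d) × Euc d => ‖Y p.1 p.2‖ := hYm.norm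
    exact (by fun_prop : Measurable fun p : (Fin n → Euc d) × Euc d =>
      ENNReal.ofReal (rexp (‖Y p.1 p.2‖ ^ 2 / (4 * (n * K ^ 2)) - b * n * ‖p.2‖ ^ 2)))
  have hinv : ∀ ξ t u, Θ (ξ + blockShift Rᶜ t) u = Θ ξ u := fun ξ t u => by
    have : Y (ξ + blockShift Rᶜ t) u = Y ξ u := by
      refine Finset.sum_congr rfl fun j hj => ?_
      simp [blockShift, hj]
    simp only [hΘ, this]
  have hdec := hT.lintegral_decouple_le h hM hm hn (Finset.card_pos.1 hcard) hΘm hinv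
  have hint : ∫⁻ ξ, (∫⁻ u, Θ ξ u) ∂(Measure.pi fun _ => noiseMeasure V) ≤
      ENNReal.ofReal (rexp d) * ENNReal.ofReal ((π / (b * n)) ^ ((d : ℝ) / 2)) := by
    rw [lintegral_lintegral_swap hΘm.aemeasurable]
    calc _ ≤ ∫⁻ u : Euc d, ENNReal.ofReal (rexp d) * ENNReal.ofReal (rexp (-(b * n) * ‖u‖ ^ 2)) := by
          refine lintegral_mono fun u => ?_
          have hau : Measurable (a u) := ha.of_uncurry_left
          have hs := lintegral_exp_sq_sum_le (μ := noiseMeasure V) (v := K ^ 2) (n := n)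
            (b := fun x => a u x - ∫ y, a u y ∂noiseMeasure V) (by positivity) hn
            (hau.sub_const _) (fun w => lintegral_exp_inner_sub_integral_le hau (haK u) w) R
          have e : ∀ x, Θ x u = ENNReal.ofReal (rexp (‖Y x u‖ ^ 2 / (4 * (n * K ^ 2)))) *
              ENNReal.ofReal (rexp (-(b * n) * ‖u‖ ^ 2)) := fun x => by
            rw [← ofReal_exp_add]
            exact congrArg (fun z => ENNReal.ofReal (rexp z)) (by ring)
          have hYu : Measurable fun x => Y x u := hYm.of_uncurry_right
          simp_rw [e]
          rw [lintegral_mul_const _ (by fun_prop)]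
          gcongr
      _ = _ := by rw [lintegral_const_mul _ (by fun_prop),
                lintegral_ofReal_exp_neg_mul_sq (by positivity)]
  have hmain : ∫⁻ x, Θ x (T x) ∂(Measure.pi fun _ => noiseMeasure V) ≤
      ENNReal.ofReal (((1 + 3 * M / m) * rexp 1 * (2 * M ^ 2 / m ^ 2 + 1)) ^ d) := by
    have hc : ENNReal.ofReal ((π / ((Rᶜ).card * M / 2)) ^ ((d : ℝ) / 2)) ≠ 0 := by
      rw [Ne, ENNReal.ofReal_eq_zero, not_le]; positivity
    rw [← ENNReal.mul_le_mul_iff_right hc ENNReal.ofReal_ne_top]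
    refine hdec.trans ((mul_le_mul_right hint _).trans ?_)
    rw [← ENNReal.ofReal_pow (by positivity), ← ENNReal.ofReal_mul (by positivity),
      ← ENNReal.ofReal_mul (by positivity), ← ENNReal.ofReal_mul (by positivity)]
    apply ENNReal.ofReal_le_ofReal
    have hr : π / (b * n) ≤ π / ((Rᶜ).card * M / 2) * (2 * M ^ 2 / m ^ 2 + 1) ^ 2 := by
      have h1 : π / (b * n) = π / (n * M / 2) * (2 * M ^ 2 / m ^ 2) := by rw [hb]; field_simp; ring
      rw [h1]
      have : 0 ≤ 2 * M ^ 2 / m ^ 2 := by positivity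
      gcongr
      nlinarith
    have hpow : (π / (b * n)) ^ ((d : ℝ) / 2) ≤
        (π / ((Rᶜ).card * M / 2)) ^ ((d : ℝ) / 2) * (2 * M ^ 2 / m ^ 2 + 1) ^ d := by
      refine (Real.rpow_le_rpow (by positivity) hr (by positivity)).trans_eq ?_
      rw [Real.mul_rpow (by positivity) (by positivity), ← Real.rpow_natCast (_ + 1) 2,
        ← Real.rpow_mul (by positivity), ← Real.rpow_natCast (_ + 1) d]
      congr 2
      push_cast; ring
    have hL : 1 + M * n / (m * (Rᶜ).card) ≤ 1 + 3 * M / m := by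
      rw [add_le_add_iff_left, div_le_div_iff₀ (by positivity) hm]
      nlinarith [mul_le_mul_of_nonneg_left hcn3 (mul_pos hM hm).le]
    have he : rexp d = rexp 1 ^ d := by rw [← Real.exp_nat_mul, mul_one]
    calc _ ≤ (1 + 3 * M / m) ^ d * (rexp 1 ^ d *
          ((π / ((Rᶜ).card * M / 2)) ^ ((d : ℝ) / 2) * (2 * M ^ 2 / m ^ 2 + 1) ^ d)) := by
          rw [he]; gcongr
      _ = _ := by rw [mul_pow, mul_pow]; ring
  refine le_trans ?_ (add_le_add hmain (hT.lintegral_exp_norm_sq_le h hM hm hn))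
  rw [← lintegral_add_right _ (by fun_prop)]
  refine lintegral_mono fun x => ?_
  rw [hΘ, ← ENNReal.ofReal_add (Real.exp_pos _).le (Real.exp_pos _).le]
  apply ENNReal.ofReal_le_ofReal
  set p := ‖Y x (T x)‖ ^ 2 / (8 * (n * K ^ 2))
  set q := b * (n * ‖T x‖ ^ 2) / 2
  have e1 : ‖Y x (T x)‖ ^ 2 / (4 * (n * K ^ 2)) - b * n * ‖T x‖ ^ 2 = 2 * (p - q) := by
    simp only [p, q]; field_simp; ring
  have e2 : b * (n * ‖T x‖ ^ 2) = 2 * q := by simp only [q]; ring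
  rw [e1, e2, two_mul, two_mul, Real.exp_add, Real.exp_add]
  have e3 : rexp p = rexp (p - q) * rexp q := by rw [← Real.exp_add]; congr 1; ring
  rw [e3]
  nlinarith [sq_nonneg (rexp (p - q) - rexp q), mul_pos (Real.exp_pos (p - q)) (Real.exp_pos q)]

end IsMLE

lemma exp_add_add_le (a b c : ℝ) : rexp (a + b + c) ≤ rexp (3 * a) + rexp (3 * b) + rexp (3 * c) := by
  rcases le_total a b with h1 | h1 <;> rcases le_total b c with h2 | h2 <;>
    rcases le_total a c with h3 | h3 <;>
  first
  | exact (Real.exp_le_exp.2 (by linarith : _ ≤ 3 * c)).trans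
      (by linarith [Real.exp_pos (3 * a), Real.exp_pos (3 * b)])
  | exact (Real.exp_le_exp.2 (by linarith : _ ≤ 3 * b)).trans
      (by linarith [Real.exp_pos (3 * a), Real.exp_pos (3 * c)])
  | exact (Real.exp_le_exp.2 (by linarith : _ ≤ 3 * a)).trans
      (by linarith [Real.exp_pos (3 * c), Real.exp_pos (3 * b)])

/-- Uniform square-exponential moments of normalized sums of a bounded random field whose mean is
Lipschitz at the origin, evaluated at the estimator. -/
lemma exists_exp_moment_field {M m K L : ℝ} (hM : 0 < M) (hm : 0 < m) (hK : 0 < K) :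
    ∃ c A : ℝ, 0 < c ∧ 0 ≤ A ∧ ∀ (d n : ℕ) (V : Euc d → ℝ) (T : (Fin n → Euc d) → Euc d)
      (a : Euc d → Euc d → Euc d), RegPotential M m V → IsProbabilityMeasure (noiseMeasure V) →
      IsMLE V T → 2 ≤ n → 0 < d → Measurable (Function.uncurry a) → (∀ u x, ‖a u x‖ ≤ K) →
      (∀ u, ‖∫ x, a u x ∂noiseMeasure V‖ ≤ L * ‖u‖) →
      ∫⁻ x, ENNReal.ofReal (rexp (c * ((n : ℝ)⁻¹ * ‖∑ j, a (T x) (x j)‖ ^ 2)))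
        ∂(Measure.pi fun _ => noiseMeasure V) ≤ ENNReal.ofReal (rexp (A * d)) := by
  set D : ℝ := (1 + 3 * M / m) * rexp 1 * (2 * M ^ 2 / m ^ 2 + 1) with hD
  have hD0 : 0 < D := by positivity
  set c : ℝ := min (1 / (72 * K ^ 2)) (m ^ 2 / (4 * M) / (9 * (L ^ 2 + 1))) with hc
  have hc0 : 0 < c := by positivity
  refine ⟨c, |Real.log D| + 6, hc0, by positivity, ?_⟩
  intro d n V T a h hprob hT hn hd ha haK haL
  have hn0 : 0 < n := by omega
  have hn' : (0 : ℝ) < n := by exact_mod_cast hn0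
  have hd1 : (1 : ℝ) ≤ d := by exact_mod_cast hd
  have hTm : Measurable T := (hT.continuous h hM hm hn0).measurable
  have ham : Measurable fun u => ∫ y, a u y ∂noiseMeasure V :=
    (StronglyMeasurable.integral_prod_right' ha.stronglyMeasurable).measurable
  obtain ⟨R, -, hR⟩ := Finset.exists_subset_card_eq (s := (Finset.univ : Finset (Fin n)))
    (n := n / 2) (by rw [Finset.card_univ, Fintype.card_fin]; omega)
  have hRc : (Rᶜ).card = n - n / 2 := by rw [Finset.card_compl, Fintype.card_fin, hR]
  set Y : Finset (Fin n) → (Fin n → Euc d) → Euc d := fun R x =>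
    ∑ j ∈ R, (a (T x) (x j) - ∫ y, a (T x) y ∂noiseMeasure V) with hY
  have hYm : ∀ R, Measurable (Y R) := fun R => by
    refine Finset.measurable_sum _ fun j _ => ?_
    exact (ha.comp (hTm.prodMk (measurable_pi_apply j))).sub (ham.comp hTm)
  have b1 := hT.lintegral_exp_block_le h hM hm hn0 hK ha haK R (by omega)
  have b2 := hT.lintegral_exp_block_le h hM hm hn0 hK ha haK Rᶜ (by rw [compl_compl]; omega)
  have b3 := hT.lintegral_exp_norm_sq_le h hM hm hn0
  have bb : ENNReal.ofReal (D ^ d) ≤ ENNReal.ofReal (rexp ((|Real.log D| + 1) * d)) := by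
    apply ENNReal.ofReal_le_ofReal
    rw [mul_comm, Real.exp_nat_mul]
    gcongr
    calc D = rexp (Real.log D) := (Real.exp_log hD0).symm
      _ ≤ _ := Real.exp_le_exp.2 (by linarith [le_abs_self (Real.log D)])
  have bb' : ENNReal.ofReal (rexp d) ≤ ENNReal.ofReal (rexp ((|Real.log D| + 1) * d)) := by
    apply ENNReal.ofReal_le_ofReal
    rw [Real.exp_le_exp]
    nlinarith [abs_nonneg (Real.log D)]
  set E := ENNReal.ofReal (rexp ((|Real.log D| + 1) * d)) with hE
  have hfin : E + E + (E + E) + E ≤ ENNReal.ofReal (rexp ((|Real.log D| + 6) * d)) := by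
    rw [hE, ← ENNReal.ofReal_add, ← ENNReal.ofReal_add, ← ENNReal.ofReal_add] <;> try positivity
    apply ENNReal.ofReal_le_ofReal
    have : (|Real.log D| + 6) * d = (|Real.log D| + 1) * d + 5 * d := by ring
    rw [this, Real.exp_add]
    have h5 : (5 : ℝ) ≤ rexp (5 * d) := by linarith [Real.add_one_le_exp (5 * (d : ℝ))]
    nlinarith [Real.exp_pos ((|Real.log D| + 1) * d)]
  refine le_trans ?_ ((add_le_add (add_le_add (b1.trans (add_le_add bb bb'))
    (b2.trans (add_le_add bb bb'))) (b3.trans bb')).trans hfin)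
  have hY1 := hYm R
  have hY2 := hYm Rᶜ
  have hY2' : Measurable fun x => ENNReal.ofReal (rexp (‖Y Rᶜ x‖ ^ 2 / (8 * (n * K ^ 2)))) := by
    fun_prop
  rw [← lintegral_add_right _ hY2', ← lintegral_add_right _ (by fun_prop)]
  refine lintegral_mono fun x => ?_
  rw [← ENNReal.ofReal_add (by positivity) (by positivity),
    ← ENNReal.ofReal_add (by positivity) (by positivity)]
  apply ENNReal.ofReal_le_ofReal
  set p := ‖Y R x‖ ^ 2 / (8 * (n * K ^ 2)) with hp
  set q := ‖Y Rᶜ x‖ ^ 2 / (8 * (n * K ^ 2)) with hq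
  set r := m ^ 2 / (4 * M) * (n * ‖T x‖ ^ 2) with hr
  have key : c * ((n : ℝ)⁻¹ * ‖∑ j, a (T x) (x j)‖ ^ 2) ≤ p / 3 + q / 3 + r / 3 := by
    have hsum : ∑ j, a (T x) (x j) = Y R x + Y Rᶜ x + (n : ℝ) • ∫ y, a (T x) y ∂noiseMeasure V := by
      simp only [hY]
      rw [Finset.sum_add_sum_compl, Finset.sum_sub_distrib, Finset.sum_const, Finset.card_univ,
        Fintype.card_fin, Nat.cast_smul_eq_nsmul, sub_add_cancel]
    have hno : ‖∑ j, a (T x) (x j)‖ ≤ ‖Y R x‖ + ‖Y Rᶜ x‖ + n * (L * ‖T x‖) := by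
      rw [hsum]
      refine norm_add₃_le.trans ?_
      rw [norm_smul, Real.norm_of_nonneg hn'.le]
      gcongr
      exact haL _
    have hsq : ‖∑ j, a (T x) (x j)‖ ^ 2 ≤
        3 * (‖Y R x‖ ^ 2 + ‖Y Rᶜ x‖ ^ 2 + (n * (L * ‖T x‖)) ^ 2) := by
      refine (pow_le_pow_left₀ (norm_nonneg _) hno 2).trans ?_
      nlinarith [sq_nonneg (‖Y R x‖ - ‖Y Rᶜ x‖), sq_nonneg (‖Y R x‖ - n * (L * ‖T x‖)),
        sq_nonneg (‖Y Rᶜ x‖ - n * (L * ‖T x‖))]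
    have c1 : c ≤ 1 / (72 * K ^ 2) := min_le_left _ _
    have c2 : c * (L ^ 2 + 1) ≤ m ^ 2 / (4 * M) / 9 := by
      have := min_le_right (1 / (72 * K ^ 2)) (m ^ 2 / (4 * M) / (9 * (L ^ 2 + 1)))
      calc c * (L ^ 2 + 1) ≤ m ^ 2 / (4 * M) / (9 * (L ^ 2 + 1)) * (L ^ 2 + 1) := by gcongr
        _ = _ := by field_simp
    have c3 : c * L ^ 2 ≤ m ^ 2 / (4 * M) / 9 := le_trans (by nlinarith) c2
    calc c * ((n : ℝ)⁻¹ * ‖∑ j, a (T x) (x j)‖ ^ 2)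
        ≤ c * ((n : ℝ)⁻¹ * (3 * (‖Y R x‖ ^ 2 + ‖Y Rᶜ x‖ ^ 2 + (n * (L * ‖T x‖)) ^ 2))) := by gcongr
      _ = 3 * (c * (‖Y R x‖ ^ 2 / n)) + 3 * (c * (‖Y Rᶜ x‖ ^ 2 / n)) +
          3 * ((c * L ^ 2) * (n * ‖T x‖ ^ 2)) := by field_simp
      _ ≤ 3 * (1 / (72 * K ^ 2) * (‖Y R x‖ ^ 2 / n)) + 3 * (1 / (72 * K ^ 2) * (‖Y Rᶜ x‖ ^ 2 / n)) +
          3 * ((m ^ 2 / (4 * M) / 9) * (n * ‖T x‖ ^ 2)) := by gcongr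
      _ = _ := by rw [hp, hq, hr]; field_simp; ring
  refine (Real.exp_le_exp.2 key).trans ((exp_add_add_le _ _ _).trans_eq ?_)
  rw [mul_div_cancel₀ p three_ne_zero, mul_div_cancel₀ q three_ne_zero,
    mul_div_cancel₀ r three_ne_zero]

section Fields

lemma norm_le_of_abs_inner_le {d : ℕ} {y : Euc d} {c : ℝ} (hc : 0 ≤ c)
    (hy : ∀ v, |⟪y, v⟫| ≤ c * ‖v‖) : ‖y‖ ≤ c := by
  have h1 := (le_abs_self _).trans (hy y)
  rw [real_inner_self_eq_norm_sq] at h1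
  rcases (norm_nonneg y).eq_or_lt with h0 | h0
  · rwa [← h0]
  · nlinarith

lemma inner_integral_left {α : Type*} [MeasurableSpace α] {μ : Measure α} {d : ℕ} {f : α → Euc d}
    (hf : Integrable f μ) (v : Euc d) : ⟪∫ x, f x ∂μ, v⟫ = ∫ x, ⟪f x, v⟫ ∂μ := by
  rw [real_inner_comm, ← integral_inner hf]
  simp_rw [real_inner_comm]

/-- The Lipschitz constant of translations in total variation. -/
def tvConst (M : ℝ) : ℝ := 4 * rexp (M / 2) + M + 2

variable {d : ℕ} {M m : ℝ} {V : Euc d → ℝ} (h : RegPotential M m V)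

include h

lemma tvConst_pos : 0 < tvConst M := by
  have := h.nonneg_M
  unfold tvConst
  positivity

variable [IsProbabilityMeasure (noiseMeasure V)] {J : Euc d →L[ℝ] Euc d}
  (hJ : ∀ u v : Euc d, ⟪J u, v⟫ = ∫ x, ⟪hess V x u, v⟫ ∂noiseMeasure V)

include hJ

lemma abs_integral_hess_shift_sub_le (w v u : Euc d) :
    |∫ x, ⟪hess V (x - u) w, v⟫ ∂noiseMeasure V - ⟪J w, v⟫| ≤
      M * tvConst M * ‖w‖ * ‖v‖ * ‖u‖ := by
  have hc := h.continuous_hess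
  have := h.abs_integral_shift_sub_le (φ := fun x => ⟪hess V x w, v⟫)
    (by fun_prop : Continuous fun x => ⟪hess V x w, v⟫).measurable (h.inner_hess_le · w v) u
  rw [hJ]
  refine this.trans_eq ?_
  rw [tvConst]; ring

lemma norm_integral_hess_field_le (w u : Euc d) :
    ‖∫ x, (hess V (x - u) w - J w) ∂noiseMeasure V‖ ≤ M * tvConst M * ‖w‖ * ‖u‖ := by
  have hM0 := h.nonneg_M
  have hC := tvConst_pos h
  have hc := h.continuous_hess
  have ic : Integrable (fun x => hess V (x - u) w) (noiseMeasure V) :=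
    Integrable.of_bound (by fun_prop) (M * ‖w‖) (ae_of_all _ fun x => h.norm_hess_apply_le _ w)
  refine norm_le_of_abs_inner_le (by positivity) fun v => ?_
  rw [integral_sub ic (integrable_const _), inner_sub_left, inner_integral_left ic]
  simp only [integral_const, probReal_univ, one_smul]
  refine (abs_integral_hess_shift_sub_le h hJ w v u).trans_eq (by ring)

lemma norm_integral_gradient_field_le (u : Euc d) :
    ‖∫ x, (J u - gradient V x + gradient V (x - u)) ∂noiseMeasure V‖ ≤
      M * tvConst M * ‖u‖ ^ 2 := by
  have hM0 := h.nonneg_M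
  have hC := tvConst_pos h
  have hc := h.continuous_hess
  have hg := h.continuous_gradient
  have hb : ∀ (t : ℝ) x, ‖gradient V (x - t • u) - gradient V x‖ ≤ M * (|t| * ‖u‖) := fun t x => by
    refine (h.norm_gradient_sub_le _ _).trans_eq ?_
    rw [sub_sub_cancel_left, norm_neg, norm_smul, Real.norm_eq_abs]
  have ib : ∀ t : ℝ, Integrable (fun x => gradient V (x - t • u) - gradient V x) (noiseMeasure V) :=
    fun t => Integrable.of_bound (by fun_prop) _ (ae_of_all _ (hb t))
  have ib1 := ib 1
  simp only [one_smul] at ib1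
  have e : ∫ x, (J u - gradient V x + gradient V (x - u)) ∂noiseMeasure V =
      J u + ∫ x, (gradient V (x - u) - gradient V x) ∂noiseMeasure V := by
    have : ∀ x, J u - gradient V x + gradient V (x - u) =
      J u + (gradient V (x - u) - gradient V x) := fun x => by abel
    simp_rw [this]
    rw [integral_add (integrable_const _) ib1]
    simp
  refine norm_le_of_abs_inner_le (by positivity) fun v => ?_
  rw [e]
  set ψ : ℝ → ℝ := fun t =>
    ∫ x, ⟪gradient V (x - t • u) - gradient V x, v⟫ ∂noiseMeasure V + t * ⟪J u, v⟫ with hψ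
  have hd : ∀ t : ℝ, HasDerivAt ψ
      (∫ x, -⟪hess V (x - t • u) u, v⟫ ∂noiseMeasure V + ⟪J u, v⟫) t := by
    intro t
    refine HasDerivAt.add ?_ (by simpa using (hasDerivAt_id t).mul_const ⟪J u, v⟫)
    refine (hasDerivAt_integral_of_dominated_loc_of_deriv_le
      (F := fun t x => ⟪gradient V (x - t • u) - gradient V x, v⟫)
      (F' := fun t x => -⟪hess V (x - t • u) u, v⟫) (bound := fun _ => M * ‖u‖ * ‖v‖)
      Filter.univ_mem (Filter.Eventually.of_forall fun s => ?_)
      ((ib t).inner_const v) ?_ (ae_of_all _ fun x s _ => ?_) (integrable_const _)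
      (ae_of_all _ fun x s _ => ?_)).2
    · exact (by fun_prop : Continuous _).aestronglyMeasurable
    · exact (by fun_prop : Continuous _).aestronglyMeasurable
    · rw [norm_neg, Real.norm_eq_abs]; exact h.inner_hess_le _ _ _
    · have h1 : HasDerivAt (fun s : ℝ => x - s • u) (-u) s := by
        simpa using ((hasDerivAt_id s).smul_const u).const_sub x
      have h2 := (h.hasFDerivAt_gradient (x - s • u)).comp_hasDerivAt s h1
      have h3 := (h2.sub_const (gradient V x)).inner ℝ (hasDerivAt_const s v)
      simpa [Function.comp_def] using h3
  have hbd : ∀ t ∈ Set.Ico (0 : ℝ) 1, ‖∫ x, -⟪hess V (x - t • u) u, v⟫ ∂noiseMeasure V + ⟪J u, v⟫‖ ≤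
      M * tvConst M * ‖u‖ ^ 2 * ‖v‖ := fun t ht => by
    rw [integral_neg, neg_add_eq_sub, Real.norm_eq_abs, abs_sub_comm]
    refine (abs_integral_hess_shift_sub_le h hJ u v (t • u)).trans ?_
    rw [norm_smul, Real.norm_of_nonneg ht.1]
    calc M * tvConst M * ‖u‖ * ‖v‖ * (t * ‖u‖) ≤ M * tvConst M * ‖u‖ * ‖v‖ * (1 * ‖u‖) := by
          gcongr; exact ht.2.le
      _ = _ := by ring
  have := norm_image_sub_le_of_norm_deriv_le_segment_01'
    (fun t _ => (hd t).hasDerivWithinAt) hbd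
  simp only [hψ, one_smul, zero_smul, sub_zero, sub_self, inner_zero_left, integral_zero, one_mul,
    zero_mul, add_zero, Real.norm_eq_abs] at this
  rw [inner_add_left, inner_integral_left ib1, add_comm]
  exact this

end Fields

/-- A single nonnegative statistic with an exponential moment of order `exp (O(d))` controls the
size of the estimator, the fluctuation of the empirical information and the linearization error. -/
lemma exists_exp_moment_statistic {M m : ℝ} (hM : 0 < M) (hm : 0 < m) :
    ∃ c A : ℝ, 0 < c ∧ 0 ≤ A ∧ ∀ (d n : ℕ) (V : Euc d → ℝ) (T : (Fin n → Euc d) → Euc d)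
      (J : Euc d →L[ℝ] Euc d) (w : Euc d), RegPotential M m V →
      IsProbabilityMeasure (noiseMeasure V) → IsMLE V T → 2 ≤ n → 0 < d →
      (∀ u v : Euc d, ⟪J u, v⟫ = ∫ x, ⟪hess V x u, v⟫ ∂noiseMeasure V) → ‖w‖ ≤ 1 →
      ∃ Z : (Fin n → Euc d) → ℝ, Measurable Z ∧ (∀ x, n * ‖T x‖ ^ 2 ≤ Z x) ∧
        (∀ x, n * ‖J w - (n : ℝ)⁻¹ • ∑ j, hess V (x j - T x) w‖ ^ 2 ≤ Z x) ∧
        (∀ x, n * ‖J (T x) - (n : ℝ)⁻¹ • ∑ j, gradient V (x j)‖ ≤ Z x) ∧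
        ∫⁻ x, ENNReal.ofReal (rexp (c * Z x)) ∂(Measure.pi fun _ => noiseMeasure V) ≤
          ENNReal.ofReal (rexp (A * d)) := by
  obtain ⟨c₁, A₁, hc₁, hA₁, H⟩ :=
    exists_exp_moment_field (L := M * tvConst M) hM hm (by positivity : 0 < 2 * M)
  set c := min c₁ (m ^ 2 / (4 * M)) / 3 with hc
  have hc0 : 0 < c := by positivity
  refine ⟨c, A₁ + 3, hc0, by positivity, ?_⟩
  intro d n V T J w h hprob hT hn hd hJ hw
  have hn0 : 0 < n := by omega
  have hn' : (0 : ℝ) < n := by exact_mod_cast hn0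
  have hd1 : (1 : ℝ) ≤ d := by exact_mod_cast hd
  have hTc := hT.continuous h hM hm hn0
  have hTm : Measurable T := hTc.measurable
  have hgc := h.continuous_gradient
  have hhc := h.continuous_hess
  have hC := tvConst_pos h
  set a₁ : Euc d → Euc d → Euc d := fun u x => hess V (x - u) w - J w with ha₁
  set a₂ : Euc d → Euc d → Euc d := fun u x =>
    ‖u‖⁻¹ • (J u - gradient V x + gradient V (x - u)) with ha₂
  have m₁ : Measurable (Function.uncurry a₁) :=
    (by fun_prop : Continuous fun p : Euc d × Euc d => hess V (p.2 - p.1) w - J w).measurable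
  have m₂ : Measurable (Function.uncurry a₂) := by
    have e : Continuous fun p : Euc d × Euc d => J p.1 - gradient V p.2 + gradient V (p.2 - p.1) := by
      fun_prop
    exact measurable_fst.norm.inv.smul e.measurable
  have E₁ := H d n V T a₁ h hprob hT hn hd m₁
    (fun u x => by
      have b1 := h.norm_hess_apply_le (x - u) w
      have b2 := norm_information_apply_le h hJ w
      refine (norm_sub_le _ _).trans ?_
      nlinarith)
    (fun u => by
      refine (norm_integral_hess_field_le h hJ w u).trans ?_
      have : M * tvConst M * ‖w‖ ≤ M * tvConst M * 1 := by gcongr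
      nlinarith [norm_nonneg u])
  have E₂ := H d n V T a₂ h hprob hT hn hd m₂
    (fun u x => by
      rcases eq_or_ne u 0 with rfl | hu
      · simp [ha₂, hM.le]
      · have hu' : 0 < ‖u‖ := norm_pos_iff.2 hu
        have b1 := h.norm_gradient_sub_le (x - u) x
        rw [sub_sub_cancel_left, norm_neg] at b1
        have b2 := norm_information_apply_le h hJ u
        simp only [ha₂]
        rw [norm_smul, norm_inv, norm_norm, inv_mul_le_iff₀ hu',
          show J u - gradient V x + gradient V (x - u) =
            J u + (gradient V (x - u) - gradient V x) by abel]
        exact (norm_add_le _ _).trans (by linarith))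
    (fun u => by
      rcases eq_or_ne u 0 with rfl | hu
      · simp [ha₂]
      · have hu' : 0 < ‖u‖ := norm_pos_iff.2 hu
        simp only [ha₂]
        rw [integral_smul, norm_smul, norm_inv, norm_norm, inv_mul_le_iff₀ hu']
        exact (norm_integral_gradient_field_le h hJ u).trans_eq (by ring))
  have E₃ := hT.lintegral_exp_norm_sq_le h hM hm hn0
  have mS : ∀ a : Euc d → Euc d → Euc d, Measurable (Function.uncurry a) →
      Measurable fun x : Fin n → Euc d => ∑ j, a (T x) (x j) := fun a ha =>
    Finset.measurable_sum _ fun j _ => ha.comp (hTm.prodMk (measurable_pi_apply j))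
  have mS₁ := mS a₁ m₁
  have mS₂ := mS a₂ m₂
  set Q₁ : (Fin n → Euc d) → ℝ := fun x => (n : ℝ)⁻¹ * ‖∑ j, a₁ (T x) (x j)‖ ^ 2 with hQ₁
  set Q₂ : (Fin n → Euc d) → ℝ := fun x => (n : ℝ)⁻¹ * ‖∑ j, a₂ (T x) (x j)‖ ^ 2 with hQ₂
  have mQ₁ : Measurable Q₁ := by fun_prop
  have mQ₂ : Measurable Q₂ := by fun_prop
  have Q₁0 : ∀ x, 0 ≤ Q₁ x := fun x => by positivity
  have Q₂0 : ∀ x, 0 ≤ Q₂ x := fun x => by positivity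
  have X0 : ∀ x, 0 ≤ n * ‖T x‖ ^ 2 := fun x => by positivity
  refine ⟨fun x => n * ‖T x‖ ^ 2 + Q₁ x + Q₂ x, by fun_prop, fun x => ?_, fun x => ?_, fun x => ?_, ?_⟩
  · linarith [Q₁0 x, Q₂0 x]
  · have e : J w - (n : ℝ)⁻¹ • ∑ j, hess V (x j - T x) w = -((n : ℝ)⁻¹ • ∑ j, a₁ (T x) (x j)) := by
      simp only [ha₁]
      rw [Finset.sum_sub_distrib, Finset.sum_const, Finset.card_univ, Fintype.card_fin, smul_sub,
        ← Nat.cast_smul_eq_nsmul ℝ, inv_smul_smul₀ hn'.ne', neg_sub]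
    have e2 : n * ‖J w - (n : ℝ)⁻¹ • ∑ j, hess V (x j - T x) w‖ ^ 2 = Q₁ x := by
      rw [e, norm_neg, norm_smul, norm_inv, Real.norm_of_nonneg hn'.le]
      simp only [hQ₁]
      field_simp
    rw [e2]
    linarith [X0 x, Q₂0 x]
  · set u := T x with hu
    have e0 : ∑ j, (J u - gradient V (x j) + gradient V (x j - u)) =
        (n : ℝ) • (J u - (n : ℝ)⁻¹ • ∑ j, gradient V (x j)) := by
      rw [Finset.sum_add_distrib, hT.sum_gradient_eq_zero h hM hn0 x, Finset.sum_sub_distrib,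
        Finset.sum_const, Finset.card_univ, Fintype.card_fin, smul_sub, smul_inv_smul₀ hn'.ne',
        ← Nat.cast_smul_eq_nsmul ℝ, add_zero]
    have e1 : ‖∑ j, (J u - gradient V (x j) + gradient V (x j - u))‖ = ‖u‖ * ‖∑ j, a₂ u (x j)‖ := by
      simp only [ha₂]
      rw [← Finset.smul_sum, norm_smul, norm_inv, norm_norm, ← mul_assoc]
      rcases eq_or_ne u 0 with hu0 | hu0
      · simp [hu0]
      · rw [mul_inv_cancel₀ (norm_ne_zero_iff.2 hu0), one_mul]
    rw [e0, norm_smul, Real.norm_of_nonneg hn'.le] at e1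
    rw [e1]
    have : ‖u‖ * ‖∑ j, a₂ u (x j)‖ ≤ n * ‖u‖ ^ 2 + Q₂ x := by
      simp only [hQ₂, ← hu]
      set s := ‖∑ j, a₂ u (x j)‖
      have e4 : ‖u‖ * s = (n * ‖u‖) * ((n : ℝ)⁻¹ * s) := by field_simp
      have e5 : n * ‖u‖ ^ 2 + (n : ℝ)⁻¹ * s ^ 2 - ‖u‖ * s =
          (n : ℝ)⁻¹ * ((n * ‖u‖ - s / 2) ^ 2 + 3 / 4 * s ^ 2) := by field_simp; ring
      have : 0 ≤ (n : ℝ)⁻¹ * ((n * ‖u‖ - s / 2) ^ 2 + 3 / 4 * s ^ 2) := by positivity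
      linarith
    linarith [Q₁0 x]
  · have c1 : 3 * c ≤ c₁ := by rw [hc]; linarith [min_le_left c₁ (m ^ 2 / (4 * M))]
    have c2 : 3 * c ≤ m ^ 2 / (4 * M) := by rw [hc]; linarith [min_le_right c₁ (m ^ 2 / (4 * M))]
    have hA : ENNReal.ofReal (rexp d) + ENNReal.ofReal (rexp (A₁ * d)) +
        ENNReal.ofReal (rexp (A₁ * d)) ≤ ENNReal.ofReal (rexp ((A₁ + 3) * d)) := by
      rw [← ENNReal.ofReal_add, ← ENNReal.ofReal_add] <;> try positivity
      apply ENNReal.ofReal_le_ofReal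
      have e1 : (A₁ + 3) * d = A₁ * d + d + 2 * d := by ring
      have e2 : rexp d ≤ rexp (A₁ * d + d) := Real.exp_le_exp.2 (by nlinarith)
      have e3 : rexp (A₁ * d) ≤ rexp (A₁ * d + d) := Real.exp_le_exp.2 (by nlinarith)
      have e4 : (3 : ℝ) ≤ rexp (2 * d) := by linarith [Real.add_one_le_exp (2 * (d : ℝ))]
      rw [e1, Real.exp_add _ (2 * (d : ℝ))]
      nlinarith [Real.exp_pos (A₁ * d + d)]
    refine le_trans ?_ ((add_le_add (add_le_add E₃ E₁) E₂).trans hA)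
    rw [← lintegral_add_right _ (by fun_prop), ← lintegral_add_right _ (by fun_prop)]
    refine lintegral_mono fun x => ?_
    rw [← ENNReal.ofReal_add (by positivity) (by positivity),
      ← ENNReal.ofReal_add (by positivity) (by positivity)]
    apply ENNReal.ofReal_le_ofReal
    rw [mul_add, mul_add]
    refine (exp_add_add_le _ _ _).trans ?_
    have t1 : 3 * (c * (n * ‖T x‖ ^ 2)) ≤ m ^ 2 / (4 * M) * (n * ‖T x‖ ^ 2) := by
      nlinarith [mul_le_mul_of_nonneg_right c2 (X0 x)]
    have t2 : 3 * (c * Q₁ x) ≤ c₁ * Q₁ x := by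
      nlinarith [mul_le_mul_of_nonneg_right c1 (Q₁0 x)]
    have t3 : 3 * (c * Q₂ x) ≤ c₁ * Q₂ x := by
      nlinarith [mul_le_mul_of_nonneg_right c1 (Q₂0 x)]
    exact add_le_add (add_le_add (Real.exp_le_exp.2 t1) (Real.exp_le_exp.2 t2))
      (Real.exp_le_exp.2 t3)

section Moments

lemma exp_mul_le_one_add_exp {a : ℝ} (ha0 : 0 ≤ a) (ha : a ≤ 1) (y : ℝ) :
    rexp (a * y) ≤ 1 + rexp y := by
  rcases le_total 0 y with hy | hy
  · have : rexp (a * y) ≤ rexp y := Real.exp_le_exp.2 (by nlinarith)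
    linarith
  · have : rexp (a * y) ≤ 1 := Real.exp_le_one_iff.2 (by nlinarith)
    linarith [Real.exp_pos y]

/-- Moments of a nonnegative variable controlled by an exponential moment. -/
lemma lintegral_rpow_le_of_exp {Ω : Type*} [MeasurableSpace Ω] {P : Measure Ω}
    [IsProbabilityMeasure P] {Z : Ω → ℝ} (hZ : ∀ x, 0 ≤ Z x) {c A D : ℝ} (hc : 0 < c) (hA : 0 ≤ A)
    (hD : 1 ≤ D) (hE : ∫⁻ x, ENNReal.ofReal (rexp (c * Z x)) ∂P ≤ ENNReal.ofReal (rexp (A * D)))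
    {q : ℝ} (hq : 1 ≤ q) :
    ∫⁻ x, ENNReal.ofReal ((1 + Z x / D) ^ q) ∂P ≤
      ENNReal.ofReal ((2 * rexp (c + A) / c * max 1 (q / D)) ^ q) := by
  have hD0 : 0 < D := by linarith
  have hq0 : 0 < q := by linarith
  set s := max 1 (q / D) / c with hs
  have hmax : 0 < max 1 (q / D) := lt_of_lt_of_le one_pos (le_max_left _ _)
  have hs0 : 0 < s := by positivity
  set l := q / (s * (c * D)) with hl
  have hl0 : 0 ≤ l := by positivity
  have e : s * (c * D) = max D q := by
    rw [hs]
    field_simp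
    rw [mul_max_of_nonneg _ _ hD0.le, mul_one, mul_div_cancel₀ _ hD0.ne']
  have hl1 : l ≤ 1 := by
    rw [hl, e]
    exact div_le_one_of_le₀ (le_max_right _ _) (by positivity)
  have hlD : l * D ≤ q := by
    rw [hl, e, div_mul_eq_mul_div, div_le_iff₀ (by positivity)]
    exact mul_le_mul_of_nonneg_left (le_max_left _ _) hq0.le
  set b := (c + A) * D with hb
  have key : ∀ x, (1 + Z x / D) ^ q ≤
      s ^ q * rexp (q * (c + A)) * (1 + rexp (-(A * D)) * rexp (c * Z x)) := by
    intro x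
    have hY : 0 < 1 + Z x / D := by have := hZ x; positivity
    have h1 : (1 + Z x / D) / s ≤ rexp ((1 + Z x / D) / s) := by
      linarith [Real.add_one_le_exp ((1 + Z x / D) / s)]
    have h2 : ((1 + Z x / D) / s) ^ q ≤ rexp (q * ((1 + Z x / D) / s)) := by
      refine (Real.rpow_le_rpow (by positivity) h1 hq0.le).trans_eq ?_
      rw [← Real.exp_mul, mul_comm]
    rw [Real.div_rpow hY.le hs0.le, div_le_iff₀' (by positivity)] at h2
    have e2 : q * ((1 + Z x / D) / s) = l * b + l * (c * Z x - A * D) := by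
      rw [hl, hb]; field_simp; ring
    have e3 : l * b ≤ q * (c + A) := by
      rw [hb]; nlinarith [mul_le_mul_of_nonneg_right hlD (by linarith : 0 ≤ c + A)]
    rw [e2, Real.exp_add] at h2
    refine h2.trans ?_
    rw [mul_assoc]
    gcongr
    refine (exp_mul_le_one_add_exp hl0 hl1 _).trans_eq ?_
    rw [← Real.exp_add]; ring_nf
  calc ∫⁻ x, ENNReal.ofReal ((1 + Z x / D) ^ q) ∂P
      ≤ ∫⁻ x, ENNReal.ofReal (s ^ q * rexp (q * (c + A))) * (1 + ENNReal.ofReal (rexp (-(A * D))) *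
          ENNReal.ofReal (rexp (c * Z x))) ∂P := by
        refine lintegral_mono fun x => ?_
        refine (ENNReal.ofReal_le_ofReal (key x)).trans_eq ?_
        rw [ENNReal.ofReal_mul (by positivity), ENNReal.ofReal_add (by positivity) (by positivity),
          ENNReal.ofReal_mul (p := rexp (-(A * D))) (by positivity), ENNReal.ofReal_one]
    _ = ENNReal.ofReal (s ^ q * rexp (q * (c + A))) * (1 + ENNReal.ofReal (rexp (-(A * D))) *
          ∫⁻ x, ENNReal.ofReal (rexp (c * Z x)) ∂P) := by
        rw [lintegral_const_mul' _ _ ENNReal.ofReal_ne_top, lintegral_add_left measurable_const,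
          lintegral_const_mul' _ _ ENNReal.ofReal_ne_top]
        simp
    _ ≤ ENNReal.ofReal (s ^ q * rexp (q * (c + A))) * (1 + ENNReal.ofReal (rexp (-(A * D))) *
          ENNReal.ofReal (rexp (A * D))) := by gcongr
    _ = ENNReal.ofReal (s ^ q * rexp (q * (c + A)) * 2) := by
        rw [← ENNReal.ofReal_mul (by positivity), ← Real.exp_add, neg_add_cancel, Real.exp_zero,
          ENNReal.ofReal_mul (by positivity : 0 ≤ s ^ q * rexp (q * (c + A)))]
        norm_num
    _ ≤ _ := by
        apply ENNReal.ofReal_le_ofReal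
        have e4 : 2 * rexp (c + A) / c * max 1 (q / D) = s * rexp (c + A) * 2 := by
          rw [hs]; ring
        rw [e4, Real.mul_rpow (by positivity) two_pos.le,
          Real.mul_rpow hs0.le (by positivity), ← Real.exp_mul, mul_comm q]
        gcongr
        simpa using Real.rpow_le_rpow_of_exponent_le one_le_two hq

lemma mul_add_pow_le {a s : ℝ} (ha : 0 ≤ a) (hs : 0 ≤ s) {q : ℕ} (hq : 1 ≤ q) :
    (q : ℝ) ^ 2 * (a + s) ^ (2 * (q - 1)) * s ^ 2 ≤
      1 / 4 * a ^ (2 * q) + (4 * q * s) ^ (2 * q) := by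
  obtain ⟨r, rfl⟩ : ∃ r, q = r + 1 := ⟨q - 1, by omega⟩
  simp only [Nat.add_sub_cancel]
  set Q : ℝ := ((r + 1 : ℕ) : ℝ) with hQ
  have hQ1 : 1 ≤ Q := by rw [hQ]; exact_mod_cast hq
  rcases le_total a ((4 * Q - 1) * s) with h | h
  · have h1 : (a + s) ^ (2 * r) ≤ (4 * Q * s) ^ (2 * r) := by
      gcongr
      linarith
    have h2 : Q ^ 2 * s ^ 2 ≤ (4 * Q * s) ^ 2 := by nlinarith [mul_nonneg hs hs, sq_nonneg (Q * s)]
    calc Q ^ 2 * (a + s) ^ (2 * r) * s ^ 2 = (a + s) ^ (2 * r) * (Q ^ 2 * s ^ 2) := by ring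
      _ ≤ (4 * Q * s) ^ (2 * r) * (4 * Q * s) ^ 2 := by gcongr
      _ = (4 * Q * s) ^ (2 * (r + 1)) := by ring
      _ ≤ _ := by linarith [show 0 ≤ 1 / 4 * a ^ (2 * (r + 1)) by positivity]
  · rcases ha.eq_or_lt with h0 | h0
    · have : s = 0 := by nlinarith
      rw [← h0, this]; simp
    have hr : (r : ℝ) = Q - 1 := by rw [hQ]; push_cast; ring
    have h1 : a + s ≤ a * rexp (s / a) := by
      have := Real.add_one_le_exp (s / a)
      calc a + s = a * (s / a + 1) := by field_simp; ring
        _ ≤ _ := by gcongr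
    have h2 : (a + s) ^ (2 * r) ≤ a ^ (2 * r) * 2 := by
      refine (pow_le_pow_left₀ (by positivity) h1 _).trans ?_
      rw [mul_pow, ← Real.exp_nat_mul]
      gcongr
      have h3 : ((2 * r : ℕ) : ℝ) * (s / a) ≤ 1 / 2 := by
        push_cast
        rw [hr, ← mul_div_assoc, div_le_iff₀ h0]
        nlinarith
      refine (Real.exp_le_exp.2 h3).trans ?_
      have h4 : rexp (1 / 2) ^ 2 ≤ 2 ^ 2 := by
        rw [← Real.exp_nat_mul]
        have := Real.exp_one_lt_d9
        norm_num
        linarith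
      exact le_of_sq_le_sq h4 (by norm_num)
    have h5 : Q ^ 2 * s ^ 2 ≤ 1 / 9 * a ^ 2 := by
      have : 3 * (Q * s) ≤ a := by nlinarith
      have := pow_le_pow_left₀ (by positivity) this 2
      nlinarith
    calc Q ^ 2 * (a + s) ^ (2 * r) * s ^ 2 = (a + s) ^ (2 * r) * (Q ^ 2 * s ^ 2) := by ring
      _ ≤ (a ^ (2 * r) * 2) * (1 / 9 * a ^ 2) := by gcongr
      _ = 2 / 9 * a ^ (2 * (r + 1)) := by ring
      _ ≤ _ := by
        have : 0 ≤ a ^ (2 * (r + 1)) := by positivity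
        have : 0 ≤ (4 * Q * s) ^ (2 * (r + 1)) := by positivity
        linarith

/-- Truncation of a real number to `[-N, N]`. -/
def clamp (N t : ℝ) : ℝ := max (-N) (min N t)

lemma abs_clamp_le {N : ℝ} (hN : 0 ≤ N) (t : ℝ) : |clamp N t| ≤ N := by
  rw [abs_le, clamp]
  exact ⟨le_max_left _ _, max_le (by linarith) (min_le_left _ _)⟩

lemma abs_clamp_sub_le (N s t : ℝ) : |clamp N s - clamp N t| ≤ |s - t| := by
  unfold clamp
  exact (abs_max_sub_max_le_max _ _ _ _).trans
    (by simpa using abs_min_sub_min_le_max N s N t)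

lemma abs_clamp_le_abs {N : ℝ} (hN : 0 ≤ N) (t : ℝ) : |clamp N t| ≤ |t| := by
  have := abs_clamp_sub_le N t 0
  have h0 : clamp N 0 = 0 := by simp [clamp, hN]
  simpa [h0] using this

lemma clamp_of_abs_le {N t : ℝ} (h : |t| ≤ N) : clamp N t = t := by
  rw [abs_le] at h
  rw [clamp, min_eq_right h.2, max_eq_right h.1]

lemma continuous_clamp (N : ℝ) : Continuous (clamp N) := by
  unfold clamp; fun_prop

lemma abs_pow_sub_pow_le_add (a b : ℝ) (q : ℕ) :
    |a ^ q - b ^ q| ≤ q * (|a| + |a - b|) ^ (q - 1) * |a - b| := by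
  have hb : |b| ≤ |a| + |a - b| := by
    have := abs_sub_abs_le_abs_sub b a
    rw [abs_sub_comm b a] at this
    linarith
  refine (abs_pow_sub_pow_le a b q).trans ?_
  rw [mul_assoc, mul_comm]
  gcongr
  exact max_le (le_add_of_nonneg_right (abs_nonneg _)) hb

lemma tendsto_integral_clamp {Ω : Type*} [MeasurableSpace Ω] {P : Measure Ω} {F : Ω → ℝ}
    (hF : Integrable F P) :
    Filter.Tendsto (fun N : ℕ => ∫ x, clamp N (F x) ∂P) Filter.atTop (nhds (∫ x, F x ∂P)) := by
  refine tendsto_integral_of_dominated_convergence (fun x => |F x|)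
    (fun N => (continuous_clamp N).comp_aestronglyMeasurable hF.1) hF.abs
    (fun N => ae_of_all _ fun x => ?_) (ae_of_all _ fun x => ?_)
  · exact abs_clamp_le_abs N.cast_nonneg _
  · refine tendsto_const_nhds.congr' ?_
    filter_upwards [Filter.eventually_ge_atTop ⌈|F x|⌉₊] with N hN
    exact (clamp_of_abs_le ((Nat.le_ceil _).trans (by exact_mod_cast hN))).symm

/-- Moment bounds by recursion on variances of powers. -/
lemma lintegral_pow_le_of_varSub {Ω : Type*} [MeasurableSpace Ω] {P : Measure Ω}
    [IsProbabilityMeasure P] {F S : Ω → ℝ} (mF : Measurable F) (hF : Integrable F P)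
    (hF0 : ∫ x, F x ∂P = 0) (hS : ∀ x, 0 ≤ S x) {D : ℝ} (hD : 0 < D) {Q : ℕ}
    (hSD : ∀ q : ℕ, 1 ≤ q → q ≤ Q →
      ∫⁻ x, ENNReal.ofReal (S x ^ (2 * q)) ∂P ≤ ENNReal.ofReal (D ^ (2 * q)))
    (hvar : ∀ N : ℝ, 0 ≤ N → ∀ q : ℕ, 1 ≤ q →
      ENNReal.ofReal (varSub P fun x => clamp N (F x) ^ q) ≤
        ∫⁻ x, ENNReal.ofReal ((q : ℝ) ^ 2 * (|clamp N (F x)| + S x) ^ (2 * (q - 1)) * S x ^ 2) ∂P)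
    (j : ℕ) (hj : 2 ^ j ≤ Q) :
    ∫⁻ x, ENNReal.ofReal (|F x| ^ (2 ^ (j + 1))) ∂P ≤
      ENNReal.ofReal ((4 * 2 ^ (j + 1) * D) ^ (2 ^ (j + 1))) := by
  have hbd : ∀ N : ℝ, 0 ≤ N → ∀ (q : ℕ) x, |clamp N (F x) ^ q| ≤ N ^ q := fun N hN q x => by
    rw [abs_pow]; exact pow_le_pow_left₀ (abs_nonneg _) (abs_clamp_le hN _) _
  have hms : ∀ (N : ℝ) (q : ℕ), Measurable fun x => clamp N (F x) ^ q := fun N q =>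
    ((continuous_clamp N).measurable.comp mF).pow_const q
  have hint : ∀ N : ℝ, 0 ≤ N → ∀ q : ℕ, Integrable (fun x => clamp N (F x) ^ q) P :=
    fun N hN q => integrable_of_abs_le (hms N q) (hbd N hN q)
  have step : ∀ N : ℝ, 0 ≤ N → ∀ q : ℕ, 1 ≤ q → q ≤ Q →
      ∫ x, clamp N (F x) ^ (2 * q) ∂P ≤
        4 / 3 * ((∫ x, clamp N (F x) ^ q ∂P) ^ 2 + (4 * q * D) ^ (2 * q)) := by
    intro N hN q hq hqQ
    have h1 : ENNReal.ofReal (varSub P fun x => clamp N (F x) ^ q) ≤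
        ENNReal.ofReal (1 / 4 * (∫ x, clamp N (F x) ^ (2 * q) ∂P) + (4 * q * D) ^ (2 * q)) := by
      refine (hvar N hN q hq).trans ?_
      calc _ ≤ ∫⁻ x, (ENNReal.ofReal (1 / 4 * clamp N (F x) ^ (2 * q)) +
            ENNReal.ofReal ((4 * q) ^ (2 * q)) * ENNReal.ofReal (S x ^ (2 * q))) ∂P := by
            refine lintegral_mono fun x => ?_
            rw [← ENNReal.ofReal_mul (by positivity), ← mul_pow,
              ← ENNReal.ofReal_add (by rw [pow_mul]; positivity)
                (by have := hS x; positivity)]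
            refine ENNReal.ofReal_le_ofReal ((mul_add_pow_le (abs_nonneg _) (hS x) hq).trans_eq ?_)
            rw [pow_mul |_|, sq_abs, ← pow_mul]
        _ ≤ _ := by
            rw [lintegral_add_left (by have := hms N (2 * q); fun_prop),
              lintegral_const_mul' _ _ ENNReal.ofReal_ne_top,
              ENNReal.ofReal_add (mul_nonneg (by norm_num) (integral_nonneg fun x => by
                simp only [pow_mul]; positivity)) (by positivity),
              mul_pow _ D, ENNReal.ofReal_mul (q := D ^ _) (by positivity),
              ← ofReal_integral_eq_lintegral_ofReal ((hint N hN _).const_mul _)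
                (ae_of_all _ fun x => by simp only [pow_mul]; positivity),
              integral_const_mul]
            exact add_le_add le_rfl (mul_le_mul_right (hSD q hq hqQ) _)
    rw [ENNReal.ofReal_le_ofReal_iff (add_nonneg (mul_nonneg (by norm_num)
      (integral_nonneg fun x => by simp only [pow_mul]; positivity)) (by positivity))] at h1
    unfold varSub at h1
    simp_rw [← pow_mul, mul_comm q 2] at h1
    linarith
  have hlim : ∀ᶠ N : ℕ in Filter.atTop, (∫ x, clamp N (F x) ∂P) ^ 2 ≤ D ^ 2 := by
    have h1 := (tendsto_integral_clamp hF).pow 2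
    rw [hF0] at h1
    exact h1.eventually_le_const (by simp only [ne_eq, OfNat.ofNat_ne_zero, not_false_eq_true, zero_pow]; positivity)
  have main : ∀ N : ℝ, 0 ≤ N → (∫ x, clamp N (F x) ∂P) ^ 2 ≤ D ^ 2 → ∀ j : ℕ, 2 ^ j ≤ Q →
      ∫ x, clamp N (F x) ^ (2 ^ (j + 1)) ∂P ≤ (4 * 2 ^ (j + 1) * D) ^ (2 ^ (j + 1)) := by
    intro N hN h0 j
    induction j with
    | zero =>
      intro hj
      have := step N hN 1 le_rfl (by simpa using hj)
      simp only [pow_one, mul_one, Nat.cast_one, zero_add] at this ⊢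
      nlinarith [sq_nonneg D]
    | succ j ih =>
      intro hj
      have hj' : 2 ^ j ≤ Q := le_trans (Nat.pow_le_pow_right (by norm_num) (by omega)) hj
      have h1 := step N hN (2 ^ (j + 1)) Nat.one_le_two_pow hj
      have h2 := ih hj'
      have h3 : 0 ≤ ∫ x, clamp N (F x) ^ (2 ^ (j + 1)) ∂P := integral_nonneg fun x => by
        rw [pow_succ, pow_mul]; positivity
      have h4 := pow_le_pow_left₀ h3 h2 2
      rw [← pow_mul, mul_comm _ 2] at h4
      rw [pow_succ 2 (j + 1), mul_comm _ 2] at *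
      push_cast at h1
      set X := (4 * 2 ^ (j + 1) * D) ^ (2 * 2 ^ (j + 1)) with hX
      have h5 : (4 * (2 * 2 ^ (j + 1)) * D) ^ (2 * 2 ^ (j + 1)) = 2 ^ (2 * 2 ^ (j + 1)) * X := by
        rw [hX, ← mul_pow]; ring
      have h6 : (4 : ℝ) ≤ 2 ^ (2 * 2 ^ (j + 1)) := by
        have : (2 : ℝ) ^ 2 ≤ 2 ^ (2 * 2 ^ (j + 1)) :=
          pow_le_pow_right₀ one_le_two (by have := Nat.one_le_two_pow (n := j + 1); omega)
        linarith
      have hX0 : 0 ≤ X := by positivity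
      have e7 : (2 : ℝ) ^ (j + 1 + 1) = 2 * 2 ^ (j + 1) := by ring
      rw [e7, h5]
      nlinarith [mul_le_mul_of_nonneg_right h6 hX0]
  have hpt : ∀ x, Filter.Tendsto (fun N : ℕ => ENNReal.ofReal (clamp N (F x) ^ (2 ^ (j + 1))))
      Filter.atTop (nhds (ENNReal.ofReal (|F x| ^ (2 ^ (j + 1))))) := fun x => by
    refine tendsto_const_nhds.congr' ?_
    filter_upwards [Filter.eventually_ge_atTop ⌈|F x|⌉₊] with N hN
    rw [clamp_of_abs_le ((Nat.le_ceil _).trans (by exact_mod_cast hN)), pow_succ', pow_mul, sq_abs,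
      ← pow_mul]
  calc _ = ∫⁻ x, Filter.liminf (fun N : ℕ => ENNReal.ofReal (clamp N (F x) ^ (2 ^ (j + 1))))
        Filter.atTop ∂P := lintegral_congr fun x => (hpt x).liminf_eq.symm
    _ ≤ Filter.liminf (fun N : ℕ => ∫⁻ x, ENNReal.ofReal (clamp N (F x) ^ (2 ^ (j + 1))) ∂P)
        Filter.atTop := lintegral_liminf_le fun N => (hms N _).ennreal_ofReal
    _ ≤ _ := by
      refine Filter.liminf_le_of_frequently_le' (Filter.Eventually.frequently ?_)
      filter_upwards [hlim] with N hN
      rw [← ofReal_integral_eq_lintegral_ofReal (hint N N.cast_nonneg _)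
        (ae_of_all _ fun x => by
          show 0 ≤ clamp N (F x) ^ 2 ^ (j + 1)
          rw [pow_succ, pow_mul]; positivity)]
      exact ENNReal.ofReal_le_ofReal (main N N.cast_nonneg hN j hj)

lemma lintegral_abs_rpow_le_of_pow {Ω : Type*} [MeasurableSpace Ω] {P : Measure Ω}
    [IsProbabilityMeasure P] {F : Ω → ℝ} {D : ℝ} (hD : 0 < D) {d : ℕ}
    (hF : ∀ j : ℕ, 2 ^ j ≤ d → ∫⁻ x, ENNReal.ofReal (|F x| ^ (2 ^ (j + 1))) ∂P ≤
      ENNReal.ofReal ((4 * 2 ^ (j + 1) * D) ^ (2 ^ (j + 1)))) {p : ℝ} (hp : 1 ≤ p) (hpd : p ≤ d) :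
    ∫⁻ x, ENNReal.ofReal (|F x| ^ p) ∂P ≤ ENNReal.ofReal ((16 * p * D) ^ p) := by
  obtain ⟨j, hj1, hj2⟩ : ∃ j : ℕ, (2 : ℝ) ^ j ≤ p ∧ p ≤ 2 ^ (j + 1) := by
    obtain ⟨j, hj1, hj2⟩ := exists_nat_pow_near hp one_lt_two
    exact ⟨j, hj1, hj2.le⟩
  have h := hF j (by exact_mod_cast hj1.trans hpd)
  set T := 4 * 2 ^ (j + 1) * D with hT
  have hT0 : 0 < T := by positivity
  set q := 2 ^ (j + 1) with hq
  have hpq : p ≤ (q : ℕ) := by rw [hq]; exact_mod_cast hj2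
  have key : ∀ x, |F x| ^ p ≤ T ^ p * (1 + (T ^ q)⁻¹ * |F x| ^ q) := fun x => by
    have e : |F x| ^ p = T ^ p * (|F x| / T) ^ p := by
      rw [Real.div_rpow (abs_nonneg _) hT0.le]; field_simp
    rw [e, inv_mul_eq_div, ← div_pow]
    gcongr
    set y := |F x| / T
    have hy : 0 ≤ y := by positivity
    rcases le_total y 1 with h1 | h1
    · linarith [Real.rpow_le_one hy h1 (by linarith : 0 ≤ p), pow_nonneg hy q]
    · have := Real.rpow_le_rpow_of_exponent_le h1 hpq
      rw [Real.rpow_natCast] at this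
      linarith
  calc ∫⁻ x, ENNReal.ofReal (|F x| ^ p) ∂P
      ≤ ∫⁻ x, ENNReal.ofReal (T ^ p) * (1 + ENNReal.ofReal (T ^ q)⁻¹ *
          ENNReal.ofReal (|F x| ^ q)) ∂P := by
        refine lintegral_mono fun x => (ENNReal.ofReal_le_ofReal (key x)).trans_eq ?_
        rw [ENNReal.ofReal_mul (by positivity), ENNReal.ofReal_add (by positivity) (by positivity),
          ENNReal.ofReal_mul (by positivity), ENNReal.ofReal_one]
    _ = ENNReal.ofReal (T ^ p) * (1 + ENNReal.ofReal (T ^ q)⁻¹ *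
          ∫⁻ x, ENNReal.ofReal (|F x| ^ q) ∂P) := by
        rw [lintegral_const_mul' _ _ ENNReal.ofReal_ne_top, lintegral_add_left measurable_const,
          lintegral_const_mul' _ _ ENNReal.ofReal_ne_top]
        simp
    _ ≤ ENNReal.ofReal (T ^ p) * (1 + ENNReal.ofReal (T ^ q)⁻¹ * ENNReal.ofReal (T ^ q)) := by
        gcongr
    _ = ENNReal.ofReal (T ^ p * 2) := by
        rw [← ENNReal.ofReal_mul (by positivity), inv_mul_cancel₀ (by positivity),
          ENNReal.ofReal_mul (by positivity : 0 ≤ T ^ p)]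
        norm_num
    _ ≤ _ := by
        apply ENNReal.ofReal_le_ofReal
        have h2 : (2 : ℝ) ≤ 2 ^ p := by
          simpa using Real.rpow_le_rpow_of_exponent_le one_le_two hp
        calc T ^ p * 2 ≤ T ^ p * 2 ^ p := by gcongr
          _ = (T * 2) ^ p := (Real.mul_rpow hT0.le two_pos.le).symm
          _ ≤ _ := by
            have : T * 2 ≤ 16 * p * D := by
              rw [hT, pow_succ]
              nlinarith [mul_le_mul_of_nonneg_right hj1 hD.le]
            gcongr

end Moments

section Increments

/-- The local slope of `g` at `y` is at most `G`. -/
def SlopeLE {E : Type*} [SeminormedAddCommGroup E] (g : E → ℝ) (y : E) (G : ℝ) : Prop :=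
  ∀ a > 0, ∀ᶠ z in nhds y, |g y - g z| ≤ (G + a) * ‖y - z‖

lemma SlopeLE.of_hasFDerivAt {E : Type*} [NormedAddCommGroup E] [NormedSpace ℝ E] {g : E → ℝ}
    {y : E} {L : E →L[ℝ] ℝ} (hg : HasFDerivAt g L y) {c : ℝ} (hc : ∀ v, |L v| ≤ c * ‖v‖) :
    SlopeLE g y c := fun a ha => by
  filter_upwards [hg.isLittleO.def ha] with z hz
  rw [Real.norm_eq_abs] at hz
  rw [abs_sub_comm, norm_sub_rev]
  calc |g z - g y| = |(g z - g y - L (z - y)) + L (z - y)| := by ring_nf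
    _ ≤ |g z - g y - L (z - y)| + |L (z - y)| := abs_add_le _ _
    _ ≤ a * ‖z - y‖ + c * ‖z - y‖ := add_le_add hz (hc _)
    _ = _ := by ring

lemma SlopeLE.mono {E : Type*} [SeminormedAddCommGroup E] {g : E → ℝ} {y : E} {G G' : ℝ}
    (hg : SlopeLE g y G) (h : G ≤ G') : SlopeLE g y G' := fun a ha => by
  filter_upwards [hg a ha] with z hz
  exact hz.trans (by gcongr)

lemma SlopeLE.clamp_pow {E : Type*} [SeminormedAddCommGroup E] {H : E → ℝ} {y : E} {G L : ℝ}
    (hH : SlopeLE H y G) (hL : ∀ y z, |H y - H z| ≤ L * ‖y - z‖) (_ : 0 ≤ G) (N : ℝ) (q : ℕ) :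
    SlopeLE (fun z => clamp N (H z) ^ q) y (q * |clamp N (H y)| ^ (q - 1) * G) := fun a ha => by
  set c := |clamp N (H y)| with hc
  have hc0 : 0 ≤ c := abs_nonneg _
  have t : Filter.Tendsto (fun z => q * (c + L * ‖y - z‖) ^ (q - 1) *
      (G + a / (2 * (q * c ^ (q - 1) + 1)))) (nhds y)
      (nhds (q * (c + L * ‖y - y‖) ^ (q - 1) * (G + a / (2 * (q * c ^ (q - 1) + 1))))) :=
    Continuous.tendsto (by fun_prop) y
  have lt : q * (c + L * ‖y - y‖) ^ (q - 1) * (G + a / (2 * (q * c ^ (q - 1) + 1))) <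
      q * c ^ (q - 1) * G + a := by
    rw [sub_self, norm_zero, mul_zero, add_zero, mul_add]
    gcongr
    set b := q * c ^ (q - 1) with hb
    have hb0 : 0 ≤ b := by positivity
    rw [← mul_div_assoc, div_lt_iff₀ (by positivity)]
    nlinarith
  filter_upwards [t.eventually_le_const lt, hH _ (by positivity :
    0 < a / (2 * (q * c ^ (q - 1) + 1)))] with z hz1 hz2
  have h1 := abs_clamp_sub_le N (H y) (H z)
  have h2 := hL y z
  have h0 := (abs_nonneg _).trans h2
  calc _ ≤ q * (c + |clamp N (H y) - clamp N (H z)|) ^ (q - 1) *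
        |clamp N (H y) - clamp N (H z)| := abs_pow_sub_pow_le_add _ _ _
    _ ≤ q * (c + L * ‖y - z‖) ^ (q - 1) *
        ((G + a / (2 * (q * c ^ (q - 1) + 1))) * ‖y - z‖) := by
        gcongr
        · exact h1.trans h2
        · exact h1.trans hz2
    _ ≤ _ := by
      rw [← mul_assoc]
      gcongr

lemma varSub_le_two_mul_add {α : Type*} [MeasurableSpace α] {μ : Measure α} [IsProbabilityMeasure μ]
    {u g : α → ℝ} {N : ℝ} (hu : Measurable u) (huN : ∀ x, |u x| ≤ N) (hg : Measurable g)
    (hgN : ∀ x, |g x| ≤ N) :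
    varSub μ u ≤ 2 * varSub μ g + 2 * ∫ x, (u x - g x) ^ 2 ∂μ := by
  have hdN : ∀ x, |u x - g x| ≤ N + N := fun x => (abs_sub _ _).trans (add_le_add (huN x) (hgN x))
  have m1 : Measurable fun x => u x - g x := hu.sub hg
  have m2 : Measurable fun x => u x - g x - g x := m1.sub hg
  have h1 := varSub_nonneg (μ := μ) m2 (N := N + N + N) fun x =>
    (abs_sub _ _).trans (add_le_add (hdN x) (hgN x))
  have i1 := integrable_of_abs_le (μ := μ) hu huN
  have i2 := integrable_of_abs_le (μ := μ) hg hgN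
  have i3 := integrable_of_abs_le (μ := μ) (hu.pow_const 2) fun x => abs_sq_le_of_abs_le (huN x)
  have i4 := integrable_of_abs_le (μ := μ) (hg.pow_const 2) fun x => abs_sq_le_of_abs_le (hgN x)
  have i5 := integrable_of_abs_le (μ := μ) (m1.pow_const 2) fun x => abs_sq_le_of_abs_le (hdN x)
  have i6 := integrable_of_abs_le (μ := μ) (m2.pow_const 2) (N := (N + N + N) ^ 2) fun x =>
    abs_sq_le_of_abs_le ((abs_sub _ _).trans (add_le_add (hdN x) (hgN x)))
  have e : ∫ x, (u x - g x - g x) ^ 2 ∂μ =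
      2 * ∫ x, g x ^ 2 ∂μ + 2 * ∫ x, (u x - g x) ^ 2 ∂μ - ∫ x, u x ^ 2 ∂μ := by
    rw [eq_sub_iff_add_eq, ← integral_const_mul, ← integral_const_mul,
      ← integral_add (i4.const_mul _) (i5.const_mul _), ← integral_add i6 i3]
    refine integral_congr_ae (ae_of_all _ fun x => ?_)
    simp only; ring
  have e2 : ∫ x, (u x - g x - g x) ∂μ = ∫ x, u x ∂μ - 2 * ∫ x, g x ∂μ := by
    rw [integral_sub (integrable_of_abs_le m1 hdN) i2, integral_sub i1 i2]; ring
  simp only [varSub] at h1 ⊢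
  rw [e, e2] at h1
  nlinarith [sq_nonneg (∫ x, u x ∂μ - ∫ x, g x ∂μ), sq_nonneg (∫ x, u x ∂μ)]


variable {d n : ℕ} {M m : ℝ} {V : Euc d → ℝ} {T : (Fin n → Euc d) → Euc d}
  (hT : IsMLE V T) (h : RegPotential M m V) (hM : 0 < M) (hm : 0 < m) (hn : 0 < n)

/-- The statistic whose moments are studied. -/
def plugIn (V : Euc d → ℝ) (T : (Fin n → Euc d) → Euc d) (f r : Euc d → ℝ) (w : Euc d)
    (x : Fin n → Euc d) : ℝ :=
  f (T x) + r (T x) - (n : ℝ)⁻¹ * ∑ j, ⟪gradient V (x j), w⟫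

/-- The contribution of a single observation to the linear part, recentred at the estimator. -/
def plugInTerm (V : Euc d → ℝ) (T : (Fin n → Euc d) → Euc d) (w : Euc d) (i : Fin n)
    (x : Fin n → Euc d) : ℝ :=
  (n : ℝ)⁻¹ * ⟪gradient V (x i - T x) - gradient V (x i), w⟫

/-- Bound for the slopes of `plugIn - plugInTerm` as a function of the estimator. -/
def plugInSlope (M : ℝ) (V : Euc d → ℝ) (T : (Fin n → Euc d) → Euc d) (f : Euc d → ℝ) (R : ℝ)
    (w : Euc d) (x : Fin n → Euc d) : ℝ :=
  ‖gradient f (T x) - (n : ℝ)⁻¹ • ∑ j, hess V (x j - T x) w‖ + R + (n : ℝ)⁻¹ * (M * ‖w‖)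

include hT h hM hn in
lemma plugIn_sub_plugInTerm (f r : Euc d → ℝ) (w : Euc d) (i : Fin n) (x : Fin n → Euc d) :
    plugIn V T f r w x - plugInTerm V T w i x =
      f (T x) + (n : ℝ)⁻¹ * ∑ j ∈ Finset.univ.erase i, ⟪gradient V (x j - T x), w⟫ + r (T x) -
        (n : ℝ)⁻¹ * ∑ j ∈ Finset.univ.erase i, ⟪gradient V (x j), w⟫ := by
  have h0 : ∑ j, ⟪gradient V (x j - T x), w⟫ = 0 := by
    rw [← sum_inner, hT.sum_gradient_eq_zero h hM hn, inner_zero_left]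
  rw [Finset.sum_erase_eq_sub (Finset.mem_univ i), Finset.sum_erase_eq_sub (Finset.mem_univ i), h0,
    plugIn, plugInTerm, inner_sub_left]
  ring

include h in
lemma abs_plugInTerm_le (w : Euc d) (i : Fin n) (x : Fin n → Euc d) :
    |plugInTerm V T w i x| ≤ (n : ℝ)⁻¹ * (M * ‖w‖ * ‖T x‖) := by
  have h1 := h.norm_gradient_sub_le (x i - T x) (x i)
  rw [sub_sub_cancel_left, norm_neg] at h1
  rw [plugInTerm, abs_mul, abs_of_nonneg (by positivity : (0 : ℝ) ≤ (n : ℝ)⁻¹)]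
  gcongr
  refine (abs_real_inner_le_norm _ _).trans ?_
  calc _ ≤ M * ‖T x‖ * ‖w‖ := by gcongr
    _ = _ := by ring

include h in
lemma slopeLE_partial {f : Euc d → ℝ} (hf : ContDiff ℝ 1 f) (w : Euc d) (i : Fin n)
    (x : Fin n → Euc d) :
    SlopeLE (fun u => f u + (n : ℝ)⁻¹ * ∑ j ∈ Finset.univ.erase i, ⟪gradient V (x j - u), w⟫) (T x)
      (‖gradient f (T x) - (n : ℝ)⁻¹ • ∑ j, hess V (x j - T x) w‖ + (n : ℝ)⁻¹ * (M * ‖w‖)) := by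
  set u₀ := T x
  have hd : ∀ j, HasFDerivAt (fun u => ⟪gradient V (x j - u), w⟫)
      (-((innerSL ℝ w).comp (hess V (x j - u₀)))) u₀ := fun j => by
    have h1 : HasFDerivAt (fun u => x j - u) (-ContinuousLinearMap.id ℝ (Euc d)) u₀ :=
      (hasFDerivAt_id u₀).const_sub (x j)
    have h2 := (innerSL ℝ w).hasFDerivAt.comp u₀ ((h.hasFDerivAt_gradient (x j - u₀)).comp u₀ h1)
    refine (h2.congr_fderiv ?_).congr_of_eventuallyEq (Filter.Eventually.of_forall fun u => ?_)
    · ext v; simp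
    · simp
  have hf' := (hf.differentiable (by norm_num) u₀).hasFDerivAt
  have hD := hf'.add ((HasFDerivAt.fun_sum (u := Finset.univ.erase i)
    fun j _ => hd j).const_mul (n : ℝ)⁻¹)
  refine SlopeLE.of_hasFDerivAt hD fun v => ?_
  have e : (fderiv ℝ f u₀ + (n : ℝ)⁻¹ • ∑ j ∈ Finset.univ.erase i,
      -((innerSL ℝ w).comp (hess V (x j - u₀)))) v =
      ⟪gradient f u₀ - (n : ℝ)⁻¹ • ∑ j, hess V (x j - u₀) w + (n : ℝ)⁻¹ • hess V (x i - u₀) w, v⟫ := by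
    have e1 : ∀ j, ⟪w, hess V (x j - u₀) v⟫ = ⟪hess V (x j - u₀) w, v⟫ := fun j => by
      rw [real_inner_comm, h.hess_symm]
    simp only [add_apply, smul_apply, sum_apply, neg_apply, ContinuousLinearMap.comp_apply,
      innerSL_apply_apply, Finset.sum_neg_distrib, inner_add_left, inner_sub_left,
      inner_smul_left, sum_inner, inner_gradient_eq, e1, smul_eq_mul, conj_trivial]
    rw [Finset.sum_erase_eq_sub (Finset.mem_univ i)]
    ring
  rw [e]
  refine (abs_real_inner_le_norm _ _).trans ?_
  gcongr
  refine (norm_add_le _ _).trans ?_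
  gcongr
  rw [norm_smul, norm_inv, Real.norm_natCast]
  gcongr
  exact h.norm_hess_apply_le _ _

end Increments

section PlugInVariance

variable {d n : ℕ} {M m : ℝ} {V : Euc d → ℝ} {T : (Fin n → Euc d) → Euc d}
  (hT : IsMLE V T) (h : RegPotential M m V) (hM : 0 < M) (hm : 0 < m) (hn : 0 < n)

lemma continuous_of_abs_sub_le {d : ℕ} {g : Euc d → ℝ} {L : ℝ}
    (hg : ∀ x y, |g x - g y| ≤ L * ‖x - y‖) : Continuous g := by
  have : LipschitzWith (Real.toNNReal L) g := LipschitzWith.of_dist_le_mul fun x y => by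
    rw [Real.dist_eq, dist_eq_norm]
    exact (hg x y).trans (mul_le_mul_of_nonneg_right (Real.le_coe_toNNReal _) (norm_nonneg _))
  exact this.continuous

include hT h hM hm hn

lemma continuous_plugIn {f r : Euc d → ℝ} (hf : Continuous f) (hr : Continuous r) (w : Euc d) :
    Continuous (plugIn V T f r w) := by
  have := hT.continuous h hM hm hn
  have := h.continuous_gradient
  unfold plugIn
  fun_prop

lemma slopeLE_update {f r : Euc d → ℝ} (hf : ContDiff ℝ 1 f) {R : ℝ}
    (hr : ∀ x y, |r x - r y| ≤ R * ‖x - y‖) (hR : 0 ≤ R) (w : Euc d) (i : Fin n)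
    (x : Fin n → Euc d) (y : Euc d) :
    SlopeLE (fun z => plugIn V T f r w (Function.update x i z) -
        plugInTerm V T w i (Function.update x i z)) y
      (M / (n * m) * plugInSlope M V T f R w (Function.update x i y)) := by
  have hκ : 0 < M / (n * m) := by positivity
  intro a ha
  have hT' : Continuous fun z => T (Function.update x i z) :=
    (hT.continuous h hM hm hn).comp (continuous_const.update i continuous_id)
  have hs := slopeLE_partial (T := T) h hf w i (Function.update x i y) (a / (M / (n * m))) (by positivity)
  filter_upwards [(hT'.tendsto y).eventually hs] with z hz
  have hTz := hT.norm_update_sub_le h hM hm hn x i y z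
  have hrz := hr (T (Function.update x i y)) (T (Function.update x i z))
  have hsum : ∀ (z : Euc d) (u : Euc d → Euc d), ∑ j ∈ Finset.univ.erase i,
      ⟪gradient V (u (Function.update x i z j)), w⟫ =
      ∑ j ∈ Finset.univ.erase i, ⟪gradient V (u (x j)), w⟫ := fun z u =>
    Finset.sum_congr rfl fun j hj => by rw [Function.update_of_ne (Finset.ne_of_mem_erase hj)]
  rw [plugIn_sub_plugInTerm hT h hM hn, plugIn_sub_plugInTerm hT h hM hn,
    hsum y fun v => v, hsum z fun v => v, hsum z fun v => v - T (Function.update x i z),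
    hsum y fun v => v - T (Function.update x i y)]
  rw [hsum y fun v => v - T (Function.update x i y),
    hsum y fun v => v - T (Function.update x i z)] at hz
  set D := ‖T (Function.update x i y) - T (Function.update x i z)‖
  have hs0 : 0 ≤ plugInSlope M V T f R w (Function.update x i y) := by unfold plugInSlope; positivity
  have e : (M / (n * m) * plugInSlope M V T f R w (Function.update x i y) + a) * ‖y - z‖ =
      (plugInSlope M V T f R w (Function.update x i y) + a / (M / (n * m))) *
        (M / (n * m) * ‖y - z‖) := by
    field_simp
  rw [e]
  calc _ ≤ (plugInSlope M V T f R w (Function.update x i y) + a / (M / (n * m))) * D := by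
        unfold plugInSlope
        refine le_trans ?_ ((add_le_add hz hrz).trans_eq (by ring))
        refine le_trans (le_of_eq ?_) (abs_add_le _ _)
        ring_nf
    _ ≤ _ := by gcongr

lemma abs_update_sub_le {f r : Euc d → ℝ} {L R : ℝ} (hf : ∀ x y, |f x - f y| ≤ L * ‖x - y‖)
    (hr : ∀ x y, |r x - r y| ≤ R * ‖x - y‖) (hLR : 0 ≤ L + R) (w : Euc d) (i : Fin n)
    (x : Fin n → Euc d) (y z : Euc d) :
    |(plugIn V T f r w (Function.update x i y) - plugInTerm V T w i (Function.update x i y)) -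
      (plugIn V T f r w (Function.update x i z) - plugInTerm V T w i (Function.update x i z))| ≤
      (L + R + M * ‖w‖) * (M / (n * m)) * ‖y - z‖ := by
  have hκ : 0 < M / (n * m) := by positivity
  have hTz := hT.norm_update_sub_le h hM hm hn x i y z
  have hsum : ∀ (z : Euc d) (u : Euc d → Euc d), ∑ j ∈ Finset.univ.erase i,
      ⟪gradient V (u (Function.update x i z j)), w⟫ =
      ∑ j ∈ Finset.univ.erase i, ⟪gradient V (u (x j)), w⟫ := fun z u =>
    Finset.sum_congr rfl fun j hj => by rw [Function.update_of_ne (Finset.ne_of_mem_erase hj)]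
  rw [plugIn_sub_plugInTerm hT h hM hn, plugIn_sub_plugInTerm hT h hM hn,
    hsum y fun v => v, hsum z fun v => v, hsum z fun v => v - T (Function.update x i z),
    hsum y fun v => v - T (Function.update x i y)]
  set a := T (Function.update x i y)
  set b := T (Function.update x i z)
  have hg : |(n : ℝ)⁻¹ * ∑ j ∈ Finset.univ.erase i, ⟪gradient V (x j - a), w⟫ -
      (n : ℝ)⁻¹ * ∑ j ∈ Finset.univ.erase i, ⟪gradient V (x j - b), w⟫| ≤ M * ‖w‖ * ‖a - b‖ := by
    rw [← mul_sub, ← Finset.sum_sub_distrib, abs_mul, abs_of_nonneg (by positivity : 0 ≤ (n : ℝ)⁻¹),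
      inv_mul_le_iff₀ (by positivity)]
    refine (Finset.abs_sum_le_sum_abs _ _).trans ?_
    have hb : ∀ j ∈ Finset.univ.erase i, |⟪gradient V (x j - a), w⟫ - ⟪gradient V (x j - b), w⟫| ≤
        M * ‖w‖ * ‖a - b‖ := fun j _ => by
      rw [← inner_sub_left]
      refine (abs_real_inner_le_norm _ _).trans ?_
      have h1 := h.norm_gradient_sub_le (x j - a) (x j - b)
      rw [sub_sub_sub_cancel_left, norm_sub_rev b a] at h1
      calc _ ≤ M * ‖a - b‖ * ‖w‖ := by gcongr
        _ = _ := by ring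
    refine (Finset.sum_le_card_nsmul _ _ _ hb).trans ?_
    rw [nsmul_eq_mul]
    gcongr
    simp
  calc _ = |(f a - f b) + ((n : ℝ)⁻¹ * ∑ j ∈ Finset.univ.erase i, ⟪gradient V (x j - a), w⟫ -
      (n : ℝ)⁻¹ * ∑ j ∈ Finset.univ.erase i, ⟪gradient V (x j - b), w⟫) + (r a - r b)| := by
        congr 1; ring
    _ ≤ L * ‖a - b‖ + M * ‖w‖ * ‖a - b‖ + R * ‖a - b‖ :=
        (abs_add_three _ _ _).trans (add_le_add (add_le_add (hf a b) hg) (hr a b))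
    _ = (L + R + M * ‖w‖) * ‖a - b‖ := by ring
    _ ≤ _ := by rw [mul_assoc]; gcongr

/-- The variance of powers of the truncated statistic. -/
lemma ofReal_varSub_clamp_plugIn_le [IsProbabilityMeasure (noiseMeasure V)] {f r : Euc d → ℝ}
    (hf : ContDiff ℝ 1 f) {L R : ℝ} (hfL : ∀ x y, |f x - f y| ≤ L * ‖x - y‖)
    (hr : ∀ x y, |r x - r y| ≤ R * ‖x - y‖) (hL : 0 ≤ L) (hR : 0 ≤ R) (w : Euc d) (e : ℝ)
    {S : (Fin n → Euc d) → ℝ} (mS : Measurable S) (hS0 : ∀ x, 0 ≤ S x)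
    (hS : ∀ x, n * (2 * (M / (n * m) * plugInSlope M V T f R w x) ^ 2 / m +
      2 * ((n : ℝ)⁻¹ * (M * ‖w‖ * ‖T x‖)) ^ 2) ≤ S x ^ 2)
    {N : ℝ} (hN : 0 ≤ N) (q : ℕ) :
    ENNReal.ofReal (varSub (Measure.pi fun _ : Fin n => noiseMeasure V)
        fun x => clamp N (plugIn V T f r w x - e) ^ q) ≤
      ∫⁻ x, ENNReal.ofReal ((q : ℝ) ^ 2 * (|clamp N (plugIn V T f r w x - e)| + S x) ^ (2 * (q - 1))
        * S x ^ 2) ∂(Measure.pi fun _ : Fin n => noiseMeasure V) := by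
  set μ := noiseMeasure V
  have hn' : (0 : ℝ) < n := by positivity
  have hn1 : (1 : ℝ) ≤ n := by exact_mod_cast hn
  have hκ : 0 < M / (n * m) := by positivity
  have cF : Continuous (plugIn V T f r w) :=
    continuous_plugIn hT h hM hm hn hf.continuous (continuous_of_abs_sub_le hr) w
  set Φ := fun x => clamp N (plugIn V T f r w x - e) with hΦ
  have cΦ : Continuous Φ := (continuous_clamp N).comp (by fun_prop)
  have bΦ : ∀ x, |Φ x ^ q| ≤ N ^ q := fun x => by
    rw [abs_pow]; exact pow_le_pow_left₀ (abs_nonneg _) (abs_clamp_le hN _) _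
  set b : (Fin n → Euc d) → ℝ≥0∞ := fun x =>
    ENNReal.ofReal ((q : ℝ) ^ 2 * (|Φ x| + S x) ^ (2 * (q - 1)) * S x ^ 2 / n) with hb
  have mb : Measurable b := by
    have := cΦ.measurable
    exact Measurable.ennreal_ofReal (by fun_prop)
  have key : ∀ (i : Fin n) x, ENNReal.ofReal (varSub μ fun y => Φ (Function.update x i y) ^ q) ≤
      ∫⁻ y, b (Function.update x i y) ∂μ := by
    intro i x
    set c : Euc d → Fin n → Euc d := fun y => Function.update x i y with hc
    have cc : Continuous c := continuous_const.update i continuous_id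
    set H : Euc d → ℝ := fun y => plugIn V T f r w (c y) - plugInTerm V T w i (c y) - e with hH
    have hHs : ∀ y, SlopeLE H y (M / (n * m) * plugInSlope M V T f R w (c y)) := fun y => by
      have := slopeLE_update hT h hM hm hn hf hr hR w i x y
      intro a ha
      filter_upwards [this a ha] with z hz
      simpa [hH] using hz
    have hHL : ∀ y z, |H y - H z| ≤ (L + R + M * ‖w‖) * (M / (n * m)) * ‖y - z‖ := fun y z => by
      have := abs_update_sub_le hT h hM hm hn hfL hr (by positivity) w i x y z
      simpa [hH] using this
    have hSl : ∀ x, 0 ≤ plugInSlope M V T f R w x := fun x => by unfold plugInSlope; positivity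
    have cH : Continuous H := continuous_of_abs_sub_le hHL
    set g : Euc d → ℝ := fun y => clamp N (H y) ^ q with hg
    have cg : Continuous g := ((continuous_clamp N).comp cH).pow q
    have bg : ∀ y, |g y| ≤ N ^ q := fun y => by
      rw [hg, abs_pow]; exact pow_le_pow_left₀ (abs_nonneg _) (abs_clamp_le hN _) _
    have hdiff : ∀ y, |Φ (c y) - clamp N (H y)| ≤ (n : ℝ)⁻¹ * (M * ‖w‖ * ‖T (c y)‖) := fun y => by
      refine (abs_clamp_sub_le _ _ _).trans ?_
      have := abs_plugInTerm_le (T := T) h w i (c y)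
      simpa [hH] using this
    have hβS : ∀ y, (n : ℝ)⁻¹ * (M * ‖w‖ * ‖T (c y)‖) ≤ S (c y) := fun y => by
      refine le_of_sq_le_sq ?_ (hS0 _)
      have h1 := hS (c y)
      have h2 : 0 ≤ 2 * (M / (n * m) * plugInSlope M V T f R w (c y)) ^ 2 / m := by positivity
      nlinarith [sq_nonneg ((n : ℝ)⁻¹ * (M * ‖w‖ * ‖T (c y)‖))]
    have hV1 := variance_le_of_slope h.measurable hm h.midStrongConvex bg
      (Λ := q * N ^ (q - 1) * ((L + R + M * ‖w‖) * (M / (n * m))))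
      (fun y z => by
        refine (abs_pow_sub_pow_le _ _ _).trans ?_
        have h1 := (abs_clamp_sub_le N (H y) (H z)).trans (hHL y z)
        have h2 := max_le (abs_clamp_le hN (H y)) (abs_clamp_le hN (H z))
        calc _ ≤ ((L + R + M * ‖w‖) * (M / (n * m)) * ‖y - z‖) * q * N ^ (q - 1) := by gcongr
          _ = _ := by ring)
      (G := fun y => q * |clamp N (H y)| ^ (q - 1) *
        (M / (n * m) * plugInSlope M V T f R w (c y)))
      (fun y a ha => by
        have := (hHs y).clamp_pow hHL (mul_nonneg hκ.le (hSl _)) N q a ha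
        obtain ⟨δ, hδ, hh⟩ := Metric.eventually_nhds_iff.1 this
        exact ⟨δ, hδ, fun z hz => hh (by rwa [dist_comm, dist_eq_norm])⟩)
    have hV2 := varSub_le_two_mul_add (μ := μ) (u := fun y => Φ (c y) ^ q) (g := g)
      ((cΦ.comp cc).pow q).measurable (fun y => bΦ _) cg.measurable bg
    have mg : Measurable fun y => (Φ (c y) ^ q - g y) ^ 2 :=
      ((((cΦ.comp cc).pow q).sub cg).pow 2).measurable
    calc _ ≤ ENNReal.ofReal (2 * varSub μ g + 2 * ∫ y, (Φ (c y) ^ q - g y) ^ 2 ∂μ) :=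
          ENNReal.ofReal_le_ofReal hV2
      _ ≤ ∫⁻ y, ENNReal.ofReal 2 * ENNReal.ofReal ((q * |clamp N (H y)| ^ (q - 1) *
            (M / (n * m) * plugInSlope M V T f R w (c y))) ^ 2 / m) ∂μ +
          ∫⁻ y, ENNReal.ofReal 2 * ENNReal.ofReal ((Φ (c y) ^ q - g y) ^ 2) ∂μ := by
          rw [ENNReal.ofReal_add (mul_nonneg two_pos.le (varSub_nonneg cg.measurable bg))
            (mul_nonneg two_pos.le (integral_nonneg fun y => sq_nonneg _)),
            ENNReal.ofReal_mul two_pos.le, ENNReal.ofReal_mul two_pos.le,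
            lintegral_const_mul' _ _ ENNReal.ofReal_ne_top,
            lintegral_const_mul' _ _ ENNReal.ofReal_ne_top,
            ofReal_integral_eq_lintegral_ofReal (integrable_of_abs_le mg (N := (N ^ q + N ^ q) ^ 2)
              fun y => abs_sq_le_of_abs_le ((abs_sub _ _).trans (add_le_add (bΦ _) (bg y))))
              (ae_of_all _ fun y => sq_nonneg _)]
          exact add_le_add (mul_le_mul_right hV1 _) le_rfl
      _ = ∫⁻ y, (ENNReal.ofReal 2 * ENNReal.ofReal ((q * |clamp N (H y)| ^ (q - 1) *
            (M / (n * m) * plugInSlope M V T f R w (c y))) ^ 2 / m) +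
          ENNReal.ofReal 2 * ENNReal.ofReal ((Φ (c y) ^ q - g y) ^ 2)) ∂μ :=
          (lintegral_add_right _ (by fun_prop)).symm
      _ ≤ _ := by
          refine lintegral_mono fun y => ?_
          rw [← ENNReal.ofReal_mul two_pos.le, ← ENNReal.ofReal_mul two_pos.le,
            ← ENNReal.ofReal_add (by positivity) (by positivity)]
          apply ENNReal.ofReal_le_ofReal
          have hcl : |clamp N (H y)| ≤ |Φ (c y)| + S (c y) := by
            have h1 := abs_sub_abs_le_abs_sub (clamp N (H y)) (Φ (c y))
            rw [abs_sub_comm] at h1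
            linarith [hdiff y, hβS y]
          set X := (|Φ (c y)| + S (c y)) ^ (q - 1) with hX
          have hX0 : 0 ≤ X := by have := hS0 (c y); positivity
          have e0 : (|Φ (c y)| + S (c y)) ^ (2 * (q - 1)) = X ^ 2 := by
            rw [hX, ← pow_mul, mul_comm]
          have e1 : |Φ (c y) ^ q - g y| ≤ q * X * ((n : ℝ)⁻¹ * (M * ‖w‖ * ‖T (c y)‖)) := by
            refine (abs_pow_sub_pow_le_add _ _ _).trans ?_
            have h1 := (hdiff y).trans (hβS y)
            have h2 := hdiff y
            gcongr
            exact pow_le_pow_left₀ (by positivity) (by linarith) _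
          have e2 : (Φ (c y) ^ q - g y) ^ 2 ≤
              (q * X * ((n : ℝ)⁻¹ * (M * ‖w‖ * ‖T (c y)‖))) ^ 2 := sq_le_sq' (by
                linarith [neg_abs_le (Φ (c y) ^ q - g y)]) ((le_abs_self _).trans e1)
          have e3 : (q * |clamp N (H y)| ^ (q - 1) *
              (M / (n * m) * plugInSlope M V T f R w (c y))) ^ 2 / m ≤
              (q * X * (M / (n * m) * plugInSlope M V T f R w (c y))) ^ 2 / m := by
            have := hSl (c y)
            gcongr
            exact pow_le_pow_left₀ (by positivity) hcl _
          have hS' := hS (c y)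
          rw [e0, le_div_iff₀ hn']
          have hq2 : 0 ≤ (q : ℝ) ^ 2 * X ^ 2 := by positivity
          have e4 := mul_le_mul_of_nonneg_left hS' hq2
          calc _ ≤ (2 * ((q * X * (M / (n * m) * plugInSlope M V T f R w (c y))) ^ 2 / m) +
              2 * (q * X * ((n : ℝ)⁻¹ * (M * ‖w‖ * ‖T (c y)‖))) ^ 2) * n := by gcongr
            _ = _ := by ring
            _ ≤ _ := e4
  refine (varSub_pi_le μ n (cΦ.pow q).measurable bΦ (b := fun _ => b) (fun _ => mb) key).trans ?_
  rw [Finset.sum_const, Finset.card_univ, Fintype.card_fin, nsmul_eq_mul,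
    ← lintegral_const_mul' _ _ (ENNReal.natCast_ne_top n)]
  refine lintegral_mono fun x => ?_
  simp only [hb]
  rw [← ENNReal.ofReal_natCast, ← ENNReal.ofReal_mul hn'.le, mul_div_cancel₀ _ hn'.ne']

end PlugInVariance

section ShiftDifference

variable {Ω : Type*} [MeasurableSpace Ω] {d : ℕ} {P : Measure Ω} {ϑ : Ω → Euc d}
  {F : Type*} [NormedAddCommGroup F] [NormedSpace ℝ F]

/-- Expected increment of `g` under the random shift `ϑ`. -/
def shiftDiff (P : Measure Ω) (ϑ : Ω → Euc d) (g : Euc d → F) (x : Euc d) : F :=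
  ∫ ω, g (x + ϑ ω) ∂P - g x

/-- Bounded continuous functions. -/
def BddCont (g : Euc d → F) : Prop := Continuous g ∧ ∃ K, ∀ x, ‖g x‖ ≤ K

/-- The Hölder ball of radius `B` in `C^{l + ρ}`, for vector-valued functions. -/
def HolderBall (l : ℕ) (ρ : ℝ) (g : Euc d → F) (B : ℝ) : Prop :=
  ContDiff ℝ l g ∧
  (∀ j : ℕ, j ≤ l → ∀ x, ‖iteratedFDeriv ℝ j g x‖ ≤ B) ∧
  (∀ x y, ‖iteratedFDeriv ℝ l g x - iteratedFDeriv ℝ l g y‖ ≤ B * ‖x - y‖ ^ ρ)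

namespace HolderBall

variable {l : ℕ} {ρ B : ℝ} {g : Euc d → F}

lemma norm_le (h : HolderBall l ρ g B) (x : Euc d) : ‖g x‖ ≤ B := by
  simpa using h.2.1 0 (Nat.zero_le _) x

lemma bddCont (h : HolderBall l ρ g B) : BddCont g := ⟨h.1.continuous, B, h.norm_le⟩

lemma nonneg (h : HolderBall l ρ g B) : 0 ≤ B := (norm_nonneg _).trans (h.norm_le 0)

lemma norm_sub_le_zero (h : HolderBall 0 ρ g B) (x y : Euc d) :
    ‖g x - g y‖ ≤ B * ‖x - y‖ ^ ρ := by
  have := h.2.2 x y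
  simp only [iteratedFDeriv_zero_eq_comp, Function.comp_apply] at this
  rwa [← map_sub, LinearIsometryEquiv.norm_map] at this

lemma contDiff_one (h : HolderBall (l + 1) ρ g B) : ContDiff ℝ 1 g :=
  h.1.of_le (by exact_mod_cast Nat.le_add_left 1 l)

lemma holderBall_fderiv (h : HolderBall (l + 1) ρ g B) : HolderBall l ρ (fderiv ℝ g) B := by
  refine ⟨h.1.fderiv_right (by exact_mod_cast le_rfl), fun j hj x => ?_, fun x y => ?_⟩
  · rw [norm_iteratedFDeriv_fderiv]
    exact h.2.1 _ (by omega) x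
  · have h1 := h.2.2 x y
    simp only [iteratedFDeriv_succ_eq_comp_right, Function.comp_apply] at h1
    rw [← dist_eq_norm] at h1 ⊢
    exact ((continuousMultilinearCurryRightEquiv' ℝ l (Euc d) F).symm.dist_map _ _).ge.trans h1

/-- Functions in a Hölder ball are `ρ`-Hölder. -/
lemma norm_sub_le (h : HolderBall l ρ g B) (hρ : 0 < ρ) (hρ1 : ρ ≤ 1) (x y : Euc d) :
    ‖g x - g y‖ ≤ 2 * B * ‖x - y‖ ^ ρ := by
  have hB := h.nonneg
  rcases l with _ | l
  · refine (h.norm_sub_le_zero x y).trans ?_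
    have : 0 ≤ ‖x - y‖ ^ ρ := by positivity
    nlinarith [mul_nonneg hB this]
  · rcases le_total ‖x - y‖ 1 with h1 | h1
    · have h2 := convex_univ.norm_image_sub_le_of_norm_fderiv_le (𝕜 := ℝ) (f := g) (C := B)
        (fun z _ => (h.contDiff_one.differentiable one_ne_zero) z)
        (fun z _ => h.holderBall_fderiv.norm_le z) (Set.mem_univ y) (Set.mem_univ x)
      have h3 : ‖x - y‖ ≤ ‖x - y‖ ^ ρ := by
        simpa using Real.rpow_le_rpow_of_exponent_ge_of_imp (norm_nonneg _) h1 hρ1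
          (fun _ h => absurd h one_ne_zero)
      nlinarith [mul_le_mul_of_nonneg_left h3 hB, norm_nonneg (x - y)]
    · have h2 := (_root_.norm_sub_le (g x) (g y)).trans (add_le_add (h.norm_le x) (h.norm_le y))
      have h3 : 1 ≤ ‖x - y‖ ^ ρ := Real.one_le_rpow h1 hρ.le
      nlinarith

end HolderBall

variable [IsProbabilityMeasure P] (hϑ : Measurable ϑ)
include hϑ

omit [NormedSpace ℝ F] in
lemma BddCont.integrable {g : Euc d → F} (h : BddCont g) (x : Euc d) :
    Integrable (fun ω => g (x + ϑ ω)) P := by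
  obtain ⟨K, hK⟩ := h.2
  exact Integrable.of_bound
    ((h.1.comp (continuous_const.add continuous_id)).comp_aestronglyMeasurable
      hϑ.aestronglyMeasurable) K (ae_of_all _ fun ω => hK _)

lemma BddCont.shiftDiff {g : Euc d → F} (h : BddCont g) : BddCont (shiftDiff P ϑ g) := by
  obtain ⟨K, hK⟩ := h.2
  refine ⟨(continuous_of_dominated (bound := fun _ => K)
    (fun x => (h.integrable hϑ x).aestronglyMeasurable)
    (fun x => ae_of_all _ fun ω => hK _) (integrable_const K)
    (ae_of_all _ fun ω => h.1.comp (continuous_id.add continuous_const))).sub h.1,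
    K + K, fun x => ?_⟩
  refine (norm_sub_le _ _).trans (add_le_add ?_ (hK x))
  simpa using norm_integral_le_of_norm_le_const (μ := P) (f := fun ω => g (x + ϑ ω))
    (ae_of_all _ fun ω => hK _)

lemma BddCont.shiftDiff_iterate {g : Euc d → F} (h : BddCont g) (j : ℕ) :
    BddCont ((_root_.shiftDiff P ϑ)^[j] g) := by
  induction j with
  | zero => exact h
  | succ j ih => rw [Function.iterate_succ_apply']; exact ih.shiftDiff hϑ

lemma BddCont.shiftDiff_eq [CompleteSpace F] {g : Euc d → F} (h : BddCont g) (x : Euc d) :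
    _root_.shiftDiff P ϑ g x = ∫ ω, (g (x + ϑ ω) - g x) ∂P := by
  rw [integral_sub (h.integrable hϑ x) (integrable_const _)]
  simp [_root_.shiftDiff]

lemma norm_shiftDiff_le [CompleteSpace F] {g : Euc d → F} (h : BddCont g) (x : Euc d)
    {b : Ω → ℝ} (hb : Integrable b P) (hgb : ∀ ω, ‖g (x + ϑ ω) - g x‖ ≤ b ω) :
    ‖shiftDiff P ϑ g x‖ ≤ ∫ ω, b ω ∂P := by
  rw [h.shiftDiff_eq hϑ]
  exact norm_integral_le_of_norm_le hb (ae_of_all _ hgb)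

lemma hasFDerivAt_shiftDiff [CompleteSpace F] {g : Euc d → F} (hg : Differentiable ℝ g)
    (h : BddCont g) (h' : BddCont (fderiv ℝ g)) (x : Euc d) :
    HasFDerivAt (shiftDiff P ϑ g) (shiftDiff P ϑ (fderiv ℝ g) x) x := by
  obtain ⟨K, hK⟩ := h'.2
  refine HasFDerivAt.sub ?_ (hg x).hasFDerivAt
  exact hasFDerivAt_integral_of_dominated_of_fderiv_le (bound := fun _ => K)
    (F' := fun y ω => fderiv ℝ g (y + ϑ ω)) (s := Set.univ) Filter.univ_mem
    (Filter.Eventually.of_forall fun y => (h.integrable hϑ y).aestronglyMeasurable)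
    (h.integrable hϑ x) (h'.integrable hϑ x).aestronglyMeasurable
    (ae_of_all _ fun ω y _ => hK _) (integrable_const _)
    (ae_of_all _ fun ω y _ => (hasFDerivAt_comp_add_right _).2 (hg _).hasFDerivAt)

lemma differentiable_shiftDiff_iterate [CompleteSpace F] {g : Euc d → F} (hg : Differentiable ℝ g)
    (h : BddCont g) (h' : BddCont (fderiv ℝ g)) (j : ℕ) :
    Differentiable ℝ ((shiftDiff P ϑ)^[j] g) ∧
      fderiv ℝ ((shiftDiff P ϑ)^[j] g) = (shiftDiff P ϑ)^[j] (fderiv ℝ g) := by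
  induction j with
  | zero => exact ⟨hg, rfl⟩
  | succ j ih =>
    rw [Function.iterate_succ_apply', Function.iterate_succ_apply']
    have := hasFDerivAt_shiftDiff (P := P) hϑ ih.1 (h.shiftDiff_iterate hϑ j)
      (by rw [ih.2]; exact h'.shiftDiff_iterate hϑ j)
    rw [ih.2] at this
    exact ⟨fun x => (this x).differentiableAt, funext fun x => (this x).fderiv⟩

/-- Smallness of iterated expected increments of smooth functions. -/
lemma HolderBall.norm_shiftDiff_iterate_le [CompleteSpace F] (hi : Integrable (fun ω => ‖ϑ ω‖) P)
    {j : ℕ} {ρ B : ℝ} {g : Euc d → F} (h : HolderBall j ρ g B) :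
    (∀ x, ‖(shiftDiff P ϑ)^[j] g x‖ ≤ B * (∫ ω, ‖ϑ ω‖ ∂P) ^ j) ∧
      ∀ x y, ‖(shiftDiff P ϑ)^[j] g x - (shiftDiff P ϑ)^[j] g y‖ ≤
        B * (∫ ω, ‖ϑ ω‖ ∂P) ^ j * ‖x - y‖ ^ ρ := by
  induction j generalizing F with
  | zero => exact ⟨fun x => by simpa using h.norm_le x, fun x y => by
      simpa using h.norm_sub_le_zero x y⟩
  | succ j ih =>
    obtain ⟨i1, i2⟩ := ih h.holderBall_fderiv
    obtain ⟨h1, h2⟩ := differentiable_shiftDiff_iterate (P := P) hϑ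
      (h.contDiff_one.differentiable one_ne_zero) h.bddCont h.holderBall_fderiv.bddCont j
    have hu := h.bddCont.shiftDiff_iterate (P := P) hϑ j
    simp only [Function.iterate_succ_apply']
    rw [← h2] at i1 i2
    set u := (shiftDiff P ϑ)^[j] g
    set σ := ∫ ω, ‖ϑ ω‖ ∂P
    refine ⟨fun x => ?_, fun x y => ?_⟩
    · refine (norm_shiftDiff_le hϑ hu x (hi.const_mul (B * σ ^ j)) fun ω => ?_).trans_eq ?_
      · simpa using convex_univ.norm_image_sub_le_of_norm_fderiv_le (𝕜 := ℝ)
          (fun z _ => h1 z) (fun z _ => i1 z) (Set.mem_univ x) (Set.mem_univ (x + ϑ ω))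
      · rw [integral_const_mul]; ring
    · rw [hu.shiftDiff_eq hϑ, hu.shiftDiff_eq hϑ,
        ← integral_sub (f := fun ω => u (x + ϑ ω) - u x) (g := fun ω => u (y + ϑ ω) - u y)
          ((hu.integrable hϑ x).sub (integrable_const _))
          ((hu.integrable hϑ y).sub (integrable_const _))]
      refine (norm_integral_le_of_norm_le (hi.const_mul (B * σ ^ j * ‖x - y‖ ^ ρ))
        (ae_of_all _ fun ω => ?_)).trans_eq ?_
      · have h3 := convex_univ.norm_image_sub_le_of_norm_hasFDerivWithin_le (𝕜 := ℝ)
          (f := fun z => u (x + z) - u (y + z)) (C := B * σ ^ j * ‖x - y‖ ^ ρ)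
          (f' := fun z => fderiv ℝ u (x + z) - fderiv ℝ u (y + z))
          (fun z _ => (((hasFDerivAt_comp_add_left x).2 (h1 _).hasFDerivAt).sub
            ((hasFDerivAt_comp_add_left y).2 (h1 _).hasFDerivAt)).hasFDerivWithinAt)
          (fun z _ => by simpa only [add_sub_add_right_eq_sub] using i2 (x + z) (y + z)) (Set.mem_univ 0) (Set.mem_univ (ϑ ω))
        simp only [add_zero, sub_zero] at h3
        refine le_trans (le_of_eq ?_) h3
        congr 1; abel
      · rw [integral_const_mul]; ring

/-- Uniform bounds on further iterates. -/
lemma norm_shiftDiff_iterate_succ_le [CompleteSpace F] {g : Euc d → F} (h : BddCont g) {K : ℝ}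
    (hK : ∀ x, ‖shiftDiff P ϑ g x‖ ≤ K) (j : ℕ) (x : Euc d) :
    ‖(shiftDiff P ϑ)^[j + 1] g x‖ ≤ 2 ^ j * K := by
  induction j generalizing x with
  | zero => simpa using hK x
  | succ j ih =>
    rw [Function.iterate_succ_apply']
    refine (norm_shiftDiff_le hϑ (h.shiftDiff_iterate hϑ (j + 1)) x
      (integrable_const (2 ^ j * K + 2 ^ j * K)) fun ω =>
        (norm_sub_le _ _).trans (add_le_add (ih _) (ih _))).trans_eq ?_
    simp; ring

/-- The alternating sum of iterated expected increments. -/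
def shiftSum (P : Measure Ω) (ϑ : Ω → Euc d) (k : ℕ) (f : Euc d → ℝ) (x : Euc d) : ℝ :=
  ∑ j ∈ Finset.range (k + 1), (-1 : ℝ) ^ j * (shiftDiff P ϑ)^[j] f x

omit hϑ [IsProbabilityMeasure P] in
lemma shiftSum_succ (k : ℕ) (f : Euc d → ℝ) (x : Euc d) :
    shiftSum P ϑ (k + 1) f x =
      shiftSum P ϑ k f x + (-1 : ℝ) ^ (k + 1) * (shiftDiff P ϑ)^[k + 1] f x :=
  Finset.sum_range_succ _ _

lemma BddCont.shiftSum {f : Euc d → ℝ} (h : BddCont f) (k : ℕ) :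
    BddCont (shiftSum P ϑ k f) := by
  refine ⟨continuous_finsetSum _ fun j _ =>
    continuous_const.mul (h.shiftDiff_iterate hϑ j).1, ?_⟩
  choose K hK using fun j => (h.shiftDiff_iterate (P := P) hϑ j).2
  refine ⟨∑ j ∈ Finset.range (k + 1), K j, fun x => (norm_sum_le _ _).trans
    (Finset.sum_le_sum fun j _ => ?_)⟩
  simpa using hK j x

/-- The bias of the alternating sum is an iterated increment of higher order. -/
lemma integral_shiftSum_sub {f : Euc d → ℝ} (h : BddCont f) (k : ℕ) (x : Euc d) :
    ∫ ω, shiftSum P ϑ k f (x + ϑ ω) ∂P - f x =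
      (-1 : ℝ) ^ k * (shiftDiff P ϑ)^[k + 1] f x := by
  induction k with
  | zero => simp [shiftSum, shiftDiff]
  | succ k ih =>
    have hk := h.shiftDiff_iterate (P := P) hϑ (k + 1)
    simp only [shiftSum_succ]
    rw [integral_add ((h.shiftSum hϑ k).integrable hϑ x) ((hk.integrable hϑ x).const_mul _),
      integral_const_mul, add_sub_right_comm, ih, Function.iterate_succ_apply' _ (k + 1),
      shiftDiff]
    ring

omit hϑ [IsProbabilityMeasure P] in
lemma abs_sub_sub_fderiv_le {u : Euc d → ℝ} (hu : Differentiable ℝ u) {L ρ : ℝ} (hρ : 0 < ρ)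
    (hL : 0 ≤ L) (x v : Euc d)
    (h : ∀ y, ‖fderiv ℝ u y - fderiv ℝ u x‖ ≤ L * ‖y - x‖ ^ ρ) :
    |u (x + v) - u x - fderiv ℝ u x v| ≤ L * ‖v‖ ^ (1 + ρ) := by
  have := (convex_closedBall x ‖v‖).norm_image_sub_le_of_norm_fderiv_le' (𝕜 := ℝ) (f := u)
    (φ := fderiv ℝ u x) (C := L * ‖v‖ ^ ρ) (fun z _ => hu z)
    (fun z hz => (h z).trans (by
      have : ‖z - x‖ ≤ ‖v‖ := by simpa [dist_eq_norm] using hz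
      gcongr)) (Metric.mem_closedBall_self (norm_nonneg v))
    (show x + v ∈ Metric.closedBall x ‖v‖ by simp)
  rw [add_sub_cancel_left] at this
  refine this.trans_eq ?_
  rw [Real.rpow_add_of_nonneg (norm_nonneg _) zero_le_one hρ.le, Real.rpow_one]
  ring

/-- Linearization of the bias. -/
lemma HolderBall.abs_shiftDiff_iterate_sub_le (hi : Integrable (fun ω => ‖ϑ ω‖) P)
    {k : ℕ} {ρ B : ℝ} (hρ : 0 < ρ) (hi' : Integrable (fun ω => ‖ϑ ω‖ ^ (1 + ρ)) P)
    {f : Euc d → ℝ} (h : HolderBall (k + 1) ρ f B) (x : Euc d) :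
    ∃ φ : Euc d →L[ℝ] ℝ, ‖φ‖ ≤ B * (∫ ω, ‖ϑ ω‖ ∂P) ^ k ∧
      |(shiftDiff P ϑ)^[k + 1] f x - ∫ ω, φ (ϑ ω) ∂P| ≤
        B * (∫ ω, ‖ϑ ω‖ ∂P) ^ k * ∫ ω, ‖ϑ ω‖ ^ (1 + ρ) ∂P := by
  obtain ⟨i1, i2⟩ := h.holderBall_fderiv.norm_shiftDiff_iterate_le (P := P) hϑ hi
  obtain ⟨h1, h2⟩ := differentiable_shiftDiff_iterate (P := P) hϑ
    (h.contDiff_one.differentiable one_ne_zero) h.bddCont h.holderBall_fderiv.bddCont k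
  have hu := h.bddCont.shiftDiff_iterate (P := P) hϑ k
  rw [← h2] at i1 i2
  rw [Function.iterate_succ_apply']
  set u := (shiftDiff P ϑ)^[k] f
  have hσ : 0 ≤ ∫ ω, ‖ϑ ω‖ ∂P := integral_nonneg fun _ => norm_nonneg _
  have hB := h.nonneg
  refine ⟨fderiv ℝ u x, i1 x, ?_⟩
  have hϑi : Integrable ϑ P := (integrable_norm_iff hϑ.aestronglyMeasurable).1 hi
  rw [hu.shiftDiff_eq hϑ, ← integral_sub (f := fun ω => u (x + ϑ ω) - u x)
    (g := fun ω => fderiv ℝ u x (ϑ ω)) ((hu.integrable hϑ x).sub (integrable_const _))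
    ((fderiv ℝ u x).integrable_comp hϑi), ← integral_const_mul, ← Real.norm_eq_abs]
  exact norm_integral_le_of_norm_le (hi'.const_mul _) (ae_of_all _ fun ω =>
    abs_sub_sub_fderiv_le h1 hρ (by positivity) x (ϑ ω) fun y => i2 y x)

/-- The bias correction term has a small Lipschitz constant. -/
lemma HolderBall.abs_shiftSum_sub_le {l : ℕ} {ρ B : ℝ} (hρ : 0 < ρ) (hρ1 : ρ ≤ 1)
    (hi : Integrable (fun ω => ‖ϑ ω‖ ^ ρ) P)
    {f : Euc d → ℝ} (h : HolderBall (l + 1) ρ f B) (k : ℕ) (x y : Euc d) :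
    |(shiftSum P ϑ k f x - f x) - (shiftSum P ϑ k f y - f y)| ≤
      2 ^ (k + 1) * B * (∫ ω, ‖ϑ ω‖ ^ ρ ∂P) * ‖x - y‖ := by
  set τ := ∫ ω, ‖ϑ ω‖ ^ ρ ∂P
  have hτ : 0 ≤ τ := integral_nonneg fun _ => by positivity
  have hB := h.nonneg
  have hD : ∀ z, ‖shiftDiff P ϑ (fderiv ℝ f) z‖ ≤ 2 * B * τ := fun z => by
    refine (norm_shiftDiff_le hϑ h.holderBall_fderiv.bddCont z (hi.const_mul (2 * B))
      fun ω => ?_).trans_eq (integral_const_mul _ _)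
    simpa using h.holderBall_fderiv.norm_sub_le hρ hρ1 (z + ϑ ω) z
  induction k with
  | zero => simp [shiftSum]; positivity
  | succ k ih =>
    obtain ⟨h1, h2⟩ := differentiable_shiftDiff_iterate (P := P) hϑ
      (h.contDiff_one.differentiable one_ne_zero) h.bddCont h.holderBall_fderiv.bddCont (k + 1)
    have h3 := convex_univ.norm_image_sub_le_of_norm_fderiv_le (𝕜 := ℝ)
      (f := (shiftDiff P ϑ)^[k + 1] f) (C := 2 ^ k * (2 * B * τ))
      (fun z _ => h1 z) (fun z _ => by
        rw [h2]
        exact norm_shiftDiff_iterate_succ_le hϑ h.holderBall_fderiv.bddCont hD k z)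
      (Set.mem_univ y) (Set.mem_univ x)
    rw [shiftSum_succ, shiftSum_succ]
    calc _ = |(shiftSum P ϑ k f x - f x - (shiftSum P ϑ k f y - f y)) +
          (-1) ^ (k + 1) * ((shiftDiff P ϑ)^[k + 1] f x - (shiftDiff P ϑ)^[k + 1] f y)| := by
          congr 1; ring
      _ ≤ 2 ^ (k + 1) * B * τ * ‖x - y‖ + 2 ^ k * (2 * B * τ) * ‖x - y‖ := by
          refine (abs_add_le _ _).trans (add_le_add ih ?_)
          rw [abs_mul, abs_pow, abs_neg, abs_one, one_pow, one_mul]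
          exact h3
      _ = _ := by ring

end ShiftDifference

section MeanZero

variable {d n : ℕ} {M m : ℝ} {V : Euc d → ℝ} (h : RegPotential M m V)
  [IsProbabilityMeasure (noiseMeasure V)]

include h

lemma RegPotential.integrable_inner_gradient (u : Euc d) :
    Integrable (fun x => ⟪gradient V x, u⟫) (noiseMeasure V) := by
  have hg := h.measurable_gradient
  exact (integrable_norm_iff (by fun_prop : Measurable _).aestronglyMeasurable).1
    (h.integral_abs_inner_gradient_le u).1

/-- The score is centred. -/
lemma RegPotential.integral_inner_gradient_eq_zero (u : Euc d) :
    ∫ x, ⟪gradient V x, u⟫ ∂noiseMeasure V = 0 := by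
  have hi := h.integrable_inner_gradient u
  set a := ∫ x, ⟪gradient V x, u⟫ ∂noiseMeasure V
  have key : ∀ t : ℝ, 0 ≤ rexp (M * ‖u‖ ^ 2 / 2 * t ^ 2) - 1 - t * a := fun t => by
    obtain ⟨h1, h2⟩ := h.integral_exp_inner_gradient_le (t • u)
    have h3 : ∫ x, (1 + t * ⟪gradient V x, u⟫) ∂noiseMeasure V ≤
        ∫ x, rexp ⟪gradient V x, t • u⟫ ∂noiseMeasure V :=
      integral_mono ((integrable_const _).add (hi.const_mul t)) h1 fun x => by
        rw [inner_smul_right, add_comm]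
        exact Real.add_one_le_exp _
    rw [integral_add (integrable_const _) (hi.const_mul t), integral_const_mul] at h3
    have h4 : M * ‖t • u‖ ^ 2 / 2 = M * ‖u‖ ^ 2 / 2 * t ^ 2 := by
      rw [norm_smul, mul_pow, Real.norm_eq_abs, sq_abs]; ring
    rw [h4] at h2
    simp only [integral_const, probReal_univ, one_smul] at h3
    linarith
  have hd : HasDerivAt (fun t : ℝ => rexp (M * ‖u‖ ^ 2 / 2 * t ^ 2) - 1 - t * a) (-a) 0 := by
    have h1 := ((((hasDerivAt_pow 2 (0 : ℝ)).const_mul (M * ‖u‖ ^ 2 / 2)).exp.sub_const 1).sub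
      ((hasDerivAt_id (0 : ℝ)).mul_const a))
    refine h1.congr_deriv ?_
    simp
  have hmin : IsLocalMin (fun t : ℝ => rexp (M * ‖u‖ ^ 2 / 2 * t ^ 2) - 1 - t * a) 0 :=
    Filter.Eventually.of_forall fun t => by simpa using key t
  exact neg_eq_zero.1 (hmin.hasDerivAt_eq_zero hd)

lemma RegPotential.integral_inner_gradient_pi (j : Fin n) (u : Euc d) :
    Integrable (fun x : Fin n → Euc d => ⟪gradient V (x j), u⟫)
      (Measure.pi fun _ => noiseMeasure V) ∧
    ∫ x : Fin n → Euc d, ⟪gradient V (x j), u⟫ ∂(Measure.pi fun _ => noiseMeasure V) = 0 := by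
  have mp := measurePreserving_eval (fun _ : Fin n => noiseMeasure V) j
  have hg := h.measurable_gradient
  have hm' : AEStronglyMeasurable (fun y => ⟪gradient V y, u⟫) (noiseMeasure V) :=
    (by fun_prop : Measurable _).aestronglyMeasurable
  refine ⟨mp.integrable_comp_of_integrable (h.integrable_inner_gradient u), ?_⟩
  have e := integral_map (μ := Measure.pi fun _ : Fin n => noiseMeasure V)
    mp.measurable.aemeasurable (by rw [mp.map_eq]; exact hm')
  rw [mp.map_eq, h.integral_inner_gradient_eq_zero u] at e
  exact e.symm

end MeanZero

section Translation

variable {d n : ℕ} {M m : ℝ} {V : Euc d → ℝ} {T : (Fin n → Euc d) → Euc d}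

lemma sampleMeasure_eq_map [IsProbabilityMeasure (noiseMeasure V)] (θ : Euc d) :
    sampleMeasure V n θ =
      (Measure.pi fun _ : Fin n => noiseMeasure V).map
        (MeasurableEquiv.addLeft (fun _ : Fin n => θ)) := by
  have : ∀ _ : Fin n, IsProbabilityMeasure ((noiseMeasure V).map fun x => θ + x) := fun _ =>
    Measure.isProbabilityMeasure_map (by fun_prop)
  exact (Measure.pi_map_pi (μ := fun _ : Fin n => noiseMeasure V) (f := fun _ x => θ + x)
    (fun _ => (by fun_prop : Measurable _).aemeasurable)).symm

lemma integral_sampleMeasure [IsProbabilityMeasure (noiseMeasure V)] (θ : Euc d)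
    (g : (Fin n → Euc d) → ℝ) :
    ∫ x, g x ∂sampleMeasure V n θ =
      ∫ x, g (fun j => θ + x j) ∂(Measure.pi fun _ : Fin n => noiseMeasure V) := by
  rw [sampleMeasure_eq_map, integral_map_equiv]
  rfl

variable (hT : IsMLE V T) (h : RegPotential M m V) (hM : 0 < M) (hm : 0 < m) (hn : 0 < n)
  [IsProbabilityMeasure (noiseMeasure V)]

include hT h hM hm hn

lemma bop_eq_shiftDiff :
    Bop V n T = shiftDiff (Measure.pi fun _ : Fin n => noiseMeasure V) T := by
  ext g θ
  rw [Bop, Texp, integral_sampleMeasure, shiftDiff]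
  simp_rw [hT.add_equivariant h hM hm hn]

lemma biasCorrect_eq_shiftSum (k : ℕ) (f : Euc d → ℝ) :
    biasCorrect V n T k f = shiftSum (Measure.pi fun _ : Fin n => noiseMeasure V) T k f := by
  ext θ
  rw [biasCorrect, shiftSum, bop_eq_shiftDiff hT h hM hm hn]

end Translation

/-- The joint law of the noise. -/
abbrev noisePi {d : ℕ} (V : Euc d → ℝ) (n : ℕ) : Measure (Fin n → Euc d) :=
  Measure.pi fun _ => noiseMeasure V

lemma rpow_le_of_le_mul {t a s β γ : ℝ} (ht : 0 ≤ t) (ha : 0 ≤ a) (hs : 1 ≤ s) (hts : t ≤ a * s)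
    (hβ : 0 ≤ β) (hβγ : β ≤ γ) : t ^ β ≤ a ^ β * s ^ γ :=
  calc t ^ β ≤ (a * s) ^ β := by gcongr
    _ = a ^ β * s ^ β := Real.mul_rpow ha (by linarith)
    _ ≤ _ := by gcongr

section Moments

variable {Ω : Type*} [MeasurableSpace Ω] {d : ℕ} {P : Measure Ω}
  {ϑ : Ω → Euc d} {Y : Ω → ℝ} {a K : ℝ} (ha0 : 0 < a)
  (hY : ∀ x, 1 ≤ Y x) (hϑY : ∀ x, ‖ϑ x‖ ≤ a * √(Y x))

include ha0 hY hϑY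

omit [MeasurableSpace Ω] in
lemma norm_rpow_le_mul_sqrt {β : ℝ} (h0 : 0 ≤ β) (h1 : β ≤ 1) (x : Ω) :
    ‖ϑ x‖ ^ β ≤ a ^ β * √(Y x) := by
  simpa using rpow_le_of_le_mul (norm_nonneg _) ha0.le (Real.one_le_sqrt.2 (hY x)) (hϑY x) h0 h1

omit [MeasurableSpace Ω] in
lemma norm_rpow_le_mul {β : ℝ} (h0 : 0 ≤ β) (h1 : β ≤ 2) (x : Ω) :
    ‖ϑ x‖ ^ β ≤ a ^ β * Y x := by
  have := rpow_le_of_le_mul (norm_nonneg _) ha0.le (Real.one_le_sqrt.2 (hY x)) (hϑY x) h0 h1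
  rwa [Real.rpow_two, Real.sq_sqrt (zero_le_one.trans (hY x))] at this

lemma integral_norm_rpow_le (mϑ : Measurable ϑ) (iY : Integrable Y P) (hYK : ∫ x, Y x ∂P ≤ K)
    {β : ℝ} (h0 : 0 ≤ β) (h1 : β ≤ 2) :
    Integrable (fun x => ‖ϑ x‖ ^ β) P ∧ ∫ x, ‖ϑ x‖ ^ β ∂P ≤ a ^ β * K := by
  have hb := norm_rpow_le_mul ha0 hY hϑY h0 h1
  have hi : Integrable (fun x => ‖ϑ x‖ ^ β) P :=
    (iY.const_mul (a ^ β)).mono' (by fun_prop : Measurable _).aestronglyMeasurable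
      (ae_of_all _ fun x => by
        rw [Real.norm_of_nonneg (by positivity)]; exact hb x)
  refine ⟨hi, (integral_mono hi (iY.const_mul _) hb).trans ?_⟩
  rw [integral_const_mul]
  gcongr

end Moments

section Bias

variable {d n : ℕ} {M m : ℝ} {V : Euc d → ℝ} {T : (Fin n → Euc d) → Euc d}
  (hT : IsMLE V T) (h : RegPotential M m V) (hM : 0 < M) (hm : 0 < m) (hn : 0 < n)
  [IsProbabilityMeasure (noiseMeasure V)] {J Jinv : Euc d →L[ℝ] Euc d}
  (hJ : ∀ u v : Euc d, ⟪J u, v⟫ = ∫ x, ⟪hess V x u, v⟫ ∂noiseMeasure V)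
  (hJJ : ∀ u, J (Jinv u) = u) (hJJ' : ∀ u, Jinv (J u) = u)
  {Y : (Fin n → Euc d) → ℝ} {a K : ℝ} (ha0 : 0 < a) (ha1 : a ≤ 1) (hK : 1 ≤ K)
  (hY : ∀ x, 1 ≤ Y x) (iY : Integrable Y (noisePi V n)) (hYK : ∫ x, Y x ∂noisePi V n ≤ K)
  (hTY : ∀ x, ‖T x‖ ≤ a * √(Y x))
  (hGY : ∀ x, ‖J (T x) - (n : ℝ)⁻¹ • ∑ j, gradient V (x j)‖ ≤ a ^ 2 * Y x)

include h in
lemma integral_score_mean (w : Euc d) :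
    Integrable (fun x : Fin n → Euc d => (n : ℝ)⁻¹ * ∑ j, ⟪gradient V (x j), w⟫) (noisePi V n) ∧
      ∫ x : Fin n → Euc d, (n : ℝ)⁻¹ * ∑ j, ⟪gradient V (x j), w⟫ ∂noisePi V n = 0 := by
  refine ⟨(integrable_finsetSum _ fun j _ => (h.integral_inner_gradient_pi j w).1).const_mul _, ?_⟩
  rw [integral_const_mul, integral_finsetSum _ fun j _ => (h.integral_inner_gradient_pi j w).1,
    Finset.sum_eq_zero fun j _ => (h.integral_inner_gradient_pi j w).2, mul_zero]

include hT h hM hm hn hJ hJJ hJJ' ha0 hY iY hYK hTY hGY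

/-- The estimator has a bias of second order. -/
lemma norm_integral_estimator_le : ‖∫ x, T x ∂noisePi V n‖ ≤ a ^ 2 * K / m := by
  have mT := (hT.continuous h hM hm hn).measurable
  have hi := (integral_norm_rpow_le (P := noisePi V n) ha0 hY hTY mT iY hYK zero_le_one
    one_le_two).1
  simp only [Real.rpow_one] at hi
  have iT : Integrable T (noisePi V n) := (integrable_norm_iff mT.aestronglyMeasurable).1 hi
  have key : ‖J (∫ x, T x ∂noisePi V n)‖ ≤ a ^ 2 * K := by
    have hK0 : 0 ≤ K := (integral_nonneg fun x => zero_le_one.trans (hY x)).trans hYK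
    refine norm_le_of_abs_inner_le (by positivity) fun v => ?_
    have e1 : ⟪J (∫ x, T x ∂noisePi V n), v⟫ =
        ∫ x, ⟪J (T x) - (n : ℝ)⁻¹ • ∑ j, gradient V (x j), v⟫ ∂noisePi V n := by
      have h1 := integral_score_mean (n := n) h v
      rw [← J.integral_comp_comm iT, inner_integral_left (J.integrable_comp iT)]
      have : ∀ x : Fin n → Euc d, ⟪J (T x) - (n : ℝ)⁻¹ • ∑ j, gradient V (x j), v⟫ =
          ⟪J (T x), v⟫ - (n : ℝ)⁻¹ * ∑ j, ⟪gradient V (x j), v⟫ := fun x => by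
        rw [inner_sub_left, real_inner_smul_left, sum_inner]
      simp_rw [this]
      rw [integral_sub ((J.integrable_comp iT).inner_const v) h1.1, h1.2, sub_zero]
    rw [e1, ← Real.norm_eq_abs]
    calc _ ≤ ∫ x, a ^ 2 * ‖v‖ * Y x ∂noisePi V n := by
          refine norm_integral_le_of_norm_le (iY.const_mul _) (ae_of_all _ fun x => ?_)
          refine (abs_real_inner_le_norm _ _).trans ?_
          nlinarith [mul_le_mul_of_nonneg_right (hGY x) (norm_nonneg v)]
      _ ≤ a ^ 2 * ‖v‖ * K := by rw [integral_const_mul]; gcongr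
      _ = _ := by ring
  have h2 := norm_information_inv_le h hJ hm hJJ (J (∫ x, T x ∂noisePi V n))
  rw [hJJ'] at h2
  exact h2.trans (by gcongr)

include ha1 hK in
/-- The bias of the corrected plug-in statistic. -/
lemma abs_integral_plugIn_sub_le {k : ℕ} {ρ B : ℝ} (hρ : 0 < ρ) (hρ1 : ρ ≤ 1) {f : Euc d → ℝ}
    (hf : HolderBall (k + 1) ρ f B) (θ w : Euc d) :
    Integrable (plugIn V T (fun x => f (θ + x))
        (fun x => shiftSum (noisePi V n) T k f (θ + x) - f (θ + x)) w) (noisePi V n) ∧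
      |∫ x, plugIn V T (fun x => f (θ + x))
        (fun x => shiftSum (noisePi V n) T k f (θ + x) - f (θ + x)) w x ∂noisePi V n - f θ| ≤
        K ^ (k + 1) * (1 + 1 / m) * B * a ^ ((k : ℝ) + 1 + ρ) := by
  have mT := (hT.continuous h hM hm hn).measurable
  have hB := hf.nonneg
  obtain ⟨i1, b1⟩ := integral_norm_rpow_le (P := noisePi V n) ha0 hY hTY mT iY hYK zero_le_one
    one_le_two
  obtain ⟨i2, b2⟩ := integral_norm_rpow_le (P := noisePi V n) ha0 hY hTY mT iY hYK
    (β := 1 + ρ) (by linarith) (by linarith)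
  simp only [Real.rpow_one] at i1 b1
  have iT : Integrable T (noisePi V n) := (integrable_norm_iff mT.aestronglyMeasurable).1 i1
  have hS := hf.bddCont.shiftSum (P := noisePi V n) mT k
  obtain ⟨i3, e3⟩ := integral_score_mean (n := n) h w
  have e : plugIn V T (fun x => f (θ + x))
      (fun x => shiftSum (noisePi V n) T k f (θ + x) - f (θ + x)) w =
      fun x => shiftSum (noisePi V n) T k f (θ + T x) -
        (n : ℝ)⁻¹ * ∑ j, ⟪gradient V (x j), w⟫ := by
    ext x; simp only [plugIn]; ring
  refine ⟨by rw [e]; exact (hS.integrable mT θ).sub i3, ?_⟩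
  simp only [e]
  rw [integral_sub (hS.integrable mT θ) i3, e3, sub_zero, integral_shiftSum_sub mT hf.bddCont]
  obtain ⟨φ, hφ, hφ'⟩ := hf.abs_shiftDiff_iterate_sub_le mT i1 hρ i2 θ
  have hb := norm_integral_estimator_le hT h hM hm hn hJ hJJ hJJ' ha0 hY iY hYK hTY hGY
  have hσ : 0 ≤ ∫ x, ‖T x‖ ∂noisePi V n := integral_nonneg fun _ => norm_nonneg _
  rw [φ.integral_comp_comm iT] at hφ'
  have h1 : |φ (∫ x, T x ∂noisePi V n)| ≤ B * (a * K) ^ k * (a ^ 2 * K / m) :=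
    (φ.le_opNorm _).trans (mul_le_mul (hφ.trans (by gcongr)) hb (norm_nonneg _) (by positivity))
  have h2 : B * (∫ x, ‖T x‖ ∂noisePi V n) ^ k * ∫ x, ‖T x‖ ^ (1 + ρ) ∂noisePi V n ≤
      B * (a * K) ^ k * (a ^ (1 + ρ) * K) := by gcongr
  have h3 : a ^ 2 ≤ a ^ (1 + ρ) := by
    rw [← Real.rpow_two]
    exact Real.rpow_le_rpow_of_exponent_ge ha0 ha1 (by linarith)
  have h4 : a ^ ((k : ℝ) + 1 + ρ) = a ^ k * a ^ (1 + ρ) := by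
    rw [add_assoc, Real.rpow_add ha0, Real.rpow_natCast]
  rw [abs_mul, abs_pow, abs_neg, abs_one, one_pow, one_mul, h4]
  calc _ ≤ |φ (∫ x, T x ∂noisePi V n)| + |(shiftDiff (noisePi V n) T)^[k + 1] f θ -
        φ (∫ x, T x ∂noisePi V n)| := by
        have := abs_add_le (φ (∫ x, T x ∂noisePi V n))
          ((shiftDiff (noisePi V n) T)^[k + 1] f θ - φ (∫ x, T x ∂noisePi V n))
        rwa [add_sub_cancel] at this
    _ ≤ B * (a * K) ^ k * (a ^ 2 * K / m) + B * (a * K) ^ k * (a ^ (1 + ρ) * K) :=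
        add_le_add h1 (hφ'.trans h2)
    _ ≤ B * (a * K) ^ k * (a ^ (1 + ρ) * K / m) + B * (a * K) ^ k * (a ^ (1 + ρ) * K) := by
        gcongr
    _ = _ := by rw [mul_pow, pow_succ]; field_simp; ring

end Bias

section PlugInBounds

lemma gradient_comp_add_left {d : ℕ} (f : Euc d → ℝ) (θ x : Euc d) :
    gradient (fun y => f (θ + y)) x = gradient f (θ + x) := by
  rw [gradient, fderiv_comp_add_left, gradient]

lemma norm_gradient_sub_eq {d : ℕ} (f : Euc d → ℝ) (x y : Euc d) :
    ‖gradient f x - gradient f y‖ = ‖fderiv ℝ f x - fderiv ℝ f y‖ := by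
  rw [gradient, gradient, ← map_sub, LinearIsometryEquiv.norm_map]

variable {d n : ℕ} {M m : ℝ} {V : Euc d → ℝ} {T : (Fin n → Euc d) → Euc d}
  (h : RegPotential M m V) (hM : 0 < M) (hm : 0 < m)
  [IsProbabilityMeasure (noiseMeasure V)] {J : Euc d →L[ℝ] Euc d}
  {Y : (Fin n → Euc d) → ℝ} {a K : ℝ} (ha0 : 0 < a) (ha1 : a ≤ 1) (hK : 1 ≤ K)
  (hY : ∀ x, 1 ≤ Y x) (hTY : ∀ x, ‖T x‖ ≤ a * √(Y x))
  {ρ B : ℝ} (hρ : 0 < ρ) (hρ1 : ρ ≤ 1) {l : ℕ} {f : Euc d → ℝ} (hf : HolderBall (l + 1) ρ f B)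
  {θ w : Euc d} (hw : ‖w‖ ≤ B / m) (hJw : J w = gradient f θ)

omit [IsProbabilityMeasure (noiseMeasure V)] in
include hM hm ha0 ha1 hK hY hTY hρ hρ1 hf hw hJw in
lemma plugInSlope_le (hna : (n : ℝ)⁻¹ ≤ a ^ 2) {k : ℕ}
    (hHY : ∀ x, ‖J w - (n : ℝ)⁻¹ • ∑ j, hess V (x j - T x) w‖ ≤ B / m * a * √(Y x))
    (x : Fin n → Euc d) :
    plugInSlope M V T (fun y => f (θ + y)) (2 ^ (k + 1) * B * (a ^ ρ * K)) w x ≤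
      (2 + 1 / m + 2 ^ (k + 1) * K + M / m) * B * a ^ ρ * √(Y x) := by
  have hB := hf.nonneg
  have hs : 1 ≤ √(Y x) := Real.one_le_sqrt.2 (hY x)
  have haρ : a ≤ a ^ ρ := by
    simpa using Real.rpow_le_rpow_of_exponent_ge ha0 ha1 hρ1
  have h1 : ‖gradient (fun y => f (θ + y)) (T x) - J w‖ ≤ 2 * B * (a ^ ρ * √(Y x)) := by
    rw [gradient_comp_add_left, hJw, norm_gradient_sub_eq]
    refine (hf.holderBall_fderiv.norm_sub_le hρ hρ1 _ _).trans ?_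
    rw [add_sub_cancel_left]
    gcongr
    exact norm_rpow_le_mul_sqrt ha0 hY hTY hρ.le hρ1 x
  have h2 : ‖gradient (fun y => f (θ + y)) (T x) - (n : ℝ)⁻¹ • ∑ j, hess V (x j - T x) w‖ ≤
      2 * B * (a ^ ρ * √(Y x)) + B / m * a ^ ρ * √(Y x) := by
    rw [← sub_add_sub_cancel _ (J w)]
    refine (norm_add_le _ _).trans (add_le_add h1 ((hHY x).trans ?_))
    gcongr
  have h3 : 2 ^ (k + 1) * B * (a ^ ρ * K) ≤ 2 ^ (k + 1) * B * (a ^ ρ * K) * √(Y x) :=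
    le_mul_of_one_le_right (by positivity) hs
  have h4 : (n : ℝ)⁻¹ * (M * ‖w‖) ≤ a ^ ρ * (M * (B / m)) * √(Y x) := by
    refine le_trans ?_ (le_mul_of_one_le_right (by positivity) hs)
    have : (n : ℝ)⁻¹ ≤ a ^ ρ := hna.trans ((by nlinarith : a ^ 2 ≤ a).trans haρ)
    gcongr
  rw [plugInSlope]
  calc _ ≤ _ := add_le_add (add_le_add h2 h3) h4
    _ = _ := by ring

omit [IsProbabilityMeasure (noiseMeasure V)] in
include h ha0 hY hTY hρ hρ1 hf hw hJw ha1 hK in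
lemma abs_plugIn_sub_le
    (hJ : ∀ u v : Euc d, ⟪J u, v⟫ = ∫ x, ⟪hess V x u, v⟫ ∂noiseMeasure V) {k : ℕ}
    (hGY : ∀ x, ‖J (T x) - (n : ℝ)⁻¹ • ∑ j, gradient V (x j)‖ ≤ a ^ 2 * Y x)
    {r : Euc d → ℝ} (hr : ∀ x y, |r x - r y| ≤ 2 ^ (k + 1) * B * (a ^ ρ * K) * ‖x - y‖)
    (x : Fin n → Euc d) :
    |plugIn V T (fun y => f (θ + y)) r w x - (f θ + r 0)| ≤
      (2 + 2 ^ (k + 1) * K + 1 / m) * B * (a ^ ρ * a) * Y x := by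
  have hB := hf.nonneg
  have hYx := hY x
  have haρ : a ≤ a ^ ρ := by
    simpa using Real.rpow_le_rpow_of_exponent_ge ha0 ha1 hρ1
  have hap : a ^ (1 + ρ) = a ^ ρ * a := by
    rw [add_comm, Real.rpow_add ha0, Real.rpow_one]
  have h1 : |f (θ + T x) - f θ - fderiv ℝ f θ (T x)| ≤ 2 * B * (a ^ ρ * a * Y x) := by
    refine (abs_sub_sub_fderiv_le (hf.contDiff_one.differentiable one_ne_zero) hρ
      (by positivity) θ (T x) fun y => hf.holderBall_fderiv.norm_sub_le hρ hρ1 _ _).trans ?_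
    rw [← hap]
    gcongr
    exact norm_rpow_le_mul ha0 hY hTY (by linarith) (by linarith) x
  have h2 : |r (T x) - r 0| ≤ 2 ^ (k + 1) * B * (a ^ ρ * K) * (a * Y x) := by
    refine (hr _ _).trans ?_
    rw [sub_zero]
    gcongr
    refine (hTY x).trans ?_
    gcongr
    exact Real.sqrt_le_iff.2 ⟨by linarith, by nlinarith⟩
  have h3 : |fderiv ℝ f θ (T x) - (n : ℝ)⁻¹ * ∑ j, ⟪gradient V (x j), w⟫| ≤
      a ^ ρ * a * Y x * (B / m) := by
    have e1 : fderiv ℝ f θ (T x) - (n : ℝ)⁻¹ * ∑ j, ⟪gradient V (x j), w⟫ =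
        ⟪J (T x) - (n : ℝ)⁻¹ • ∑ j, gradient V (x j), w⟫ := by
      rw [inner_sub_left, real_inner_smul_left, sum_inner, ← inner_gradient_left, ← hJw,
        information_symm h hJ, real_inner_comm]
    rw [e1]
    refine (abs_real_inner_le_norm _ _).trans (mul_le_mul ((hGY x).trans ?_) hw (norm_nonneg _)
      (by positivity))
    rw [sq]
    gcongr
  calc _ = |(f (θ + T x) - f θ - fderiv ℝ f θ (T x)) + (r (T x) - r 0) +
        (fderiv ℝ f θ (T x) - (n : ℝ)⁻¹ * ∑ j, ⟪gradient V (x j), w⟫)| := by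
        rw [plugIn]; congr 1; ring
    _ ≤ _ := (abs_add_three _ _ _).trans (add_le_add (add_le_add h1 h2) h3)
    _ = _ := by ring

end PlugInBounds

section CentredMoments

lemma lintegral_abs_rpow_le_of_le_mul {Ω : Type*} [MeasurableSpace Ω] {P : Measure Ω} {F Y : Ω → ℝ}
    {U K D : ℝ} (hU : 0 ≤ U) (hY : ∀ x, 1 ≤ Y x) (hD : 0 < D) (hF : ∀ x, |F x| ≤ U * Y x)
    (hYq : ∀ q : ℝ, 1 ≤ q →
      ∫⁻ x, ENNReal.ofReal (Y x ^ q) ∂P ≤ ENNReal.ofReal ((K * max 1 (q / D)) ^ q))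
    (hK : 0 ≤ K) {p : ℝ} (hp : 1 ≤ p) (hDp : D ≤ p) :
    ∫⁻ x, ENNReal.ofReal (|F x| ^ p) ∂P ≤ ENNReal.ofReal ((p * (U * K / D)) ^ p) := by
  have hp0 : 0 ≤ p := by linarith
  calc _ ≤ ∫⁻ x, ENNReal.ofReal (U ^ p) * ENNReal.ofReal (Y x ^ p) ∂P := by
        refine lintegral_mono fun x => ?_
        have := hY x
        rw [← ENNReal.ofReal_mul (by positivity), ← Real.mul_rpow hU (by linarith)]
        exact ENNReal.ofReal_le_ofReal (Real.rpow_le_rpow (abs_nonneg _) (hF x) hp0)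
    _ ≤ ENNReal.ofReal (U ^ p) * ENNReal.ofReal ((K * max 1 (p / D)) ^ p) := by
        rw [lintegral_const_mul' _ _ ENNReal.ofReal_ne_top]
        exact mul_le_mul_right (hYq p hp) _
    _ = _ := by
        rw [max_eq_right ((one_le_div hD).2 hDp), ← ENNReal.ofReal_mul (by positivity),
          ← Real.mul_rpow hU (by positivity)]
        congr 2
        field_simp

variable {d n : ℕ} {M m : ℝ} {V : Euc d → ℝ} {T : (Fin n → Euc d) → Euc d}
  (hT : IsMLE V T) (h : RegPotential M m V) (hM : 0 < M) (hm : 0 < m) (hn : 0 < n) (hd : 0 < d)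
  [IsProbabilityMeasure (noiseMeasure V)]
  {Y : (Fin n → Euc d) → ℝ} {a K : ℝ} (ha0 : 0 < a) (hK : 1 ≤ K) (mY : Measurable Y)
  (hY : ∀ x, 1 ≤ Y x) (hTY : ∀ x, ‖T x‖ ≤ a * √(Y x))
  (hYq : ∀ q : ℝ, 1 ≤ q → ∫⁻ x, ENNReal.ofReal (Y x ^ q) ∂noisePi V n ≤
    ENNReal.ofReal ((K * max 1 (q / d)) ^ q))

include hT h hM hm hn hd ha0 hK mY hY hTY hYq in
/-- Moments of orders up to the dimension. -/
lemma lintegral_abs_plugIn_rpow_le_of_le {ρ B C : ℝ} (hρ1 : ρ ≤ 1) (ha1 : a ≤ 1)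
    (hB : 0 < B) (hC : 0 < C) {f r : Euc d → ℝ} {L R : ℝ} (hf : ContDiff ℝ 1 f)
    (hfL : ∀ x y, |f x - f y| ≤ L * ‖x - y‖) (hr : ∀ x y, |r x - r y| ≤ R * ‖x - y‖)
    (hL : 0 ≤ L) (hR : 0 ≤ R) {w : Euc d} (hw : ‖w‖ ≤ B / m)
    (hs : ∀ x, plugInSlope M V T f R w x ≤ C * B * a ^ ρ * √(Y x)) {e : ℝ}
    (hi : Integrable (plugIn V T f r w) (noisePi V n))
    (he : ∫ x, plugIn V T f r w x ∂noisePi V n = e) {p : ℝ} (hp : 1 ≤ p) (hpd : p ≤ d) :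
    ∫⁻ x, ENNReal.ofReal (|plugIn V T f r w x - e| ^ p) ∂noisePi V n ≤
      ENNReal.ofReal ((p * (16 * √(2 * M ^ 2 / m ^ 3 * C ^ 2 + 2 * M ^ 2 / m ^ 2) * √K *
        (B * (a ^ ρ / √n)))) ^ p) := by
  have hn' : (0 : ℝ) < n := by exact_mod_cast hn
  have hd' : (0 : ℝ) < d := by exact_mod_cast hd
  have haρ : a ≤ a ^ ρ := by
    simpa using Real.rpow_le_rpow_of_exponent_ge ha0 ha1 hρ1
  set A := 2 * M ^ 2 / m ^ 3 * C ^ 2 + 2 * M ^ 2 / m ^ 2 with hA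
  have hA0 : 0 < A := by positivity
  set D₀ := √A * (B * (a ^ ρ / √n)) with hD₀
  have hD₀0 : 0 < D₀ := by positivity
  have hD₀2 : D₀ ^ 2 = A * (B ^ 2 * ((a ^ ρ) ^ 2 / n)) := by
    rw [hD₀, mul_pow, mul_pow, div_pow, Real.sq_sqrt hA0.le, Real.sq_sqrt hn'.le]
  have hrc := continuous_of_abs_sub_le hr
  have cF := continuous_plugIn hT h hM hm hn hf.continuous hrc w
  have hS2 : ∀ x, (D₀ * √(Y x)) ^ 2 = D₀ ^ 2 * Y x := fun x => by
    rw [mul_pow, Real.sq_sqrt (zero_le_one.trans (hY x))]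
  have hSl : ∀ x, 0 ≤ plugInSlope M V T f R w x := fun x => by
    rw [plugInSlope]; positivity
  have hS : ∀ x, n * (2 * (M / (n * m) * plugInSlope M V T f R w x) ^ 2 / m +
      2 * ((n : ℝ)⁻¹ * (M * ‖w‖ * ‖T x‖)) ^ 2) ≤ (D₀ * √(Y x)) ^ 2 := fun x => by
    have hYx : 0 ≤ Y x := zero_le_one.trans (hY x)
    have b1 : plugInSlope M V T f R w x ^ 2 ≤ (C * B * a ^ ρ) ^ 2 * Y x := by
      refine (pow_le_pow_left₀ (hSl x) (hs x) 2).trans_eq ?_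
      rw [mul_pow, Real.sq_sqrt hYx]
    have b2 : (‖w‖ * ‖T x‖) ^ 2 ≤ (B / m * a ^ ρ) ^ 2 * Y x := by
      have : ‖w‖ * ‖T x‖ ≤ B / m * (a ^ ρ * √(Y x)) :=
        mul_le_mul hw ((hTY x).trans (by gcongr)) (norm_nonneg _) (by positivity)
      refine (pow_le_pow_left₀ (by positivity) this 2).trans_eq ?_
      rw [← mul_assoc, mul_pow, Real.sq_sqrt hYx]
    rw [hS2, hD₀2]
    calc _ = 2 * M ^ 2 / m ^ 3 / n * plugInSlope M V T f R w x ^ 2 +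
          2 * M ^ 2 / n * (‖w‖ * ‖T x‖) ^ 2 := by field_simp
      _ ≤ 2 * M ^ 2 / m ^ 3 / n * ((C * B * a ^ ρ) ^ 2 * Y x) +
          2 * M ^ 2 / n * ((B / m * a ^ ρ) ^ 2 * Y x) := by gcongr
      _ = _ := by rw [hA]; field_simp
  have hSD : ∀ q : ℕ, 1 ≤ q → q ≤ d →
      ∫⁻ x, ENNReal.ofReal ((D₀ * √(Y x)) ^ (2 * q)) ∂noisePi V n ≤
        ENNReal.ofReal ((D₀ * √K) ^ (2 * q)) := fun q hq hqd => by
    have := hYq q (by exact_mod_cast hq)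
    rw [max_eq_left ((div_le_one hd').2 (by exact_mod_cast hqd)), mul_one] at this
    simp only [Real.rpow_natCast] at this
    calc _ = ∫⁻ x, ENNReal.ofReal ((D₀ ^ 2) ^ q) * ENNReal.ofReal (Y x ^ q) ∂noisePi V n := by
          refine lintegral_congr fun x => ?_
          rw [← ENNReal.ofReal_mul (by positivity), pow_mul, hS2, mul_pow]
      _ ≤ ENNReal.ofReal ((D₀ ^ 2) ^ q) * ENNReal.ofReal (K ^ q) := by
          rw [lintegral_const_mul' _ _ ENNReal.ofReal_ne_top]
          exact mul_le_mul_right this _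
      _ = _ := by
          have hDK : (D₀ * √K) ^ 2 = D₀ ^ 2 * K := by
            rw [mul_pow, Real.sq_sqrt (by linarith)]
          rw [← ENNReal.ofReal_mul (by positivity), pow_mul (D₀ * √K), hDK, ← mul_pow]
  have hF0 : ∫ x, (plugIn V T f r w x - e) ∂noisePi V n = 0 := by
    rw [integral_sub hi (integrable_const _), he]; simp
  have key := lintegral_abs_rpow_le_of_pow (P := noisePi V n)
    (F := fun x => plugIn V T f r w x - e) (D := D₀ * √K) (by positivity) (d := d)
    (lintegral_pow_le_of_varSub (F := fun x => plugIn V T f r w x - e)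
      (S := fun x => D₀ * √(Y x)) (cF.sub continuous_const).measurable
      (hi.sub (integrable_const _)) hF0
      (fun x => by positivity) (by positivity) hSD
      fun N hN q _ => ofReal_varSub_clamp_plugIn_le hT h hM hm hn hf hfL hr hL hR w e
        (by fun_prop) (fun x => by positivity) hS hN q) hp hpd
  refine key.trans_eq ?_
  congr 2
  rw [hD₀]; ring

end CentredMoments

section PsiNorm

lemma integral_le_of_lintegral_ofReal_le {Ω : Type*} [MeasurableSpace Ω] {P : Measure Ω} {g : Ω → ℝ}
    {b : ℝ} (hg : Measurable g) (h0 : ∀ x, 0 ≤ g x) (hb : 0 ≤ b)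
    (h : ∫⁻ x, ENNReal.ofReal (g x) ∂P ≤ ENNReal.ofReal b) : ∫ x, g x ∂P ≤ b := by
  rw [integral_eq_lintegral_of_nonneg_ae (ae_of_all _ h0) hg.aestronglyMeasurable]
  exact ENNReal.toReal_le_of_le_ofReal hb h

/-- Moments of a random variable with a subexponential deviation from a constant. -/
lemma rpow_integral_abs_rpow_le {Ω : Type*} [MeasurableSpace Ω] {P : Measure Ω}
    [IsProbabilityMeasure P] {η : Ω → ℝ} (mη : Measurable η) {b D p : ℝ} (hD : 0 ≤ D) (hp : 1 ≤ p)
    (h : ∫⁻ x, ENNReal.ofReal (|η x - b| ^ p) ∂P ≤ ENNReal.ofReal ((p * D) ^ p)) :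
    p ^ (-(1 / (1 : ℝ))) * (∫ x, |η x| ^ p ∂P) ^ (1 / p) ≤ 2 * D + 2 * |b| := by
  have hp0 : 0 < p := by linarith
  have h1 : ∀ x, ENNReal.ofReal (|η x| ^ p) ≤
      ENNReal.ofReal (2 ^ p) * (ENNReal.ofReal (|η x - b| ^ p) + ENNReal.ofReal (|b| ^ p)) :=
    fun x => by
    rw [← ENNReal.ofReal_add (by positivity) (by positivity), ← ENNReal.ofReal_mul (by positivity)]
    refine ENNReal.ofReal_le_ofReal ?_
    have e1 : |η x| ≤ 2 * max |η x - b| |b| := by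
      have := abs_add_le (η x - b) b
      rw [sub_add_cancel] at this
      linarith [le_max_left |η x - b| |b|, le_max_right |η x - b| |b|]
    calc |η x| ^ p ≤ (2 * max |η x - b| |b|) ^ p := by gcongr
      _ = 2 ^ p * max |η x - b| |b| ^ p := Real.mul_rpow zero_le_two (by positivity)
      _ ≤ _ := by
        gcongr
        rcases max_cases |η x - b| |b| with h | h <;> rw [h.1] <;>
          linarith [Real.rpow_nonneg (abs_nonneg (η x - b)) p, Real.rpow_nonneg (abs_nonneg b) p]
  have h2 : ∫⁻ x, ENNReal.ofReal (|η x| ^ p) ∂P ≤ ENNReal.ofReal ((p * (2 * D + 2 * |b|)) ^ p) := by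
    calc _ ≤ ∫⁻ x, ENNReal.ofReal (2 ^ p) * (ENNReal.ofReal (|η x - b| ^ p) +
          ENNReal.ofReal (|b| ^ p)) ∂P := lintegral_mono h1
      _ = ENNReal.ofReal (2 ^ p) * (∫⁻ x, ENNReal.ofReal (|η x - b| ^ p) ∂P +
          ENNReal.ofReal (|b| ^ p)) := by
        rw [lintegral_const_mul' _ _ ENNReal.ofReal_ne_top, lintegral_add_right _ measurable_const]
        simp
      _ ≤ ENNReal.ofReal (2 ^ p) * (ENNReal.ofReal ((p * D) ^ p) +
          ENNReal.ofReal ((p * |b|) ^ p)) := by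
        gcongr
        exact le_mul_of_one_le_left (abs_nonneg b) hp
      _ ≤ _ := by
        rw [← ENNReal.ofReal_add (by positivity) (by positivity),
          ← ENNReal.ofReal_mul (by positivity)]
        refine ENNReal.ofReal_le_ofReal ?_
        have := Real.add_rpow_le_rpow_add (a := p * D) (b := p * |b|) (by positivity)
          (by positivity) hp
        calc _ ≤ 2 ^ p * (p * D + p * |b|) ^ p := by gcongr
          _ = _ := by
            rw [← Real.mul_rpow zero_le_two (by positivity)]
            congr 1; ring
  have h3 := integral_le_of_lintegral_ofReal_le (by fun_prop : Measurable fun x => |η x| ^ p)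
    (fun x => by positivity) (by positivity) h2
  have h4 : (∫ x, |η x| ^ p ∂P) ^ (1 / p) ≤ p * (2 * D + 2 * |b|) := by
    calc _ ≤ ((p * (2 * D + 2 * |b|)) ^ p) ^ (1 / p) := by
          refine Real.rpow_le_rpow (integral_nonneg fun x => by positivity) h3 (by positivity)
      _ = _ := by
        rw [← Real.rpow_mul (by positivity), mul_one_div_cancel hp0.ne', Real.rpow_one]
  calc _ ≤ p ^ (-(1 / (1 : ℝ))) * (p * (2 * D + 2 * |b|)) := by gcongr
    _ = _ := by
      rw [div_one, Real.rpow_neg_one]; field_simp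

end PsiNorm

section AllMoments

lemma HolderBall.abs_sub_le {d l : ℕ} {ρ B : ℝ} {f : Euc d → ℝ} (hf : HolderBall (l + 1) ρ f B)
    (x y : Euc d) : |f x - f y| ≤ B * ‖x - y‖ := by
  rw [← Real.norm_eq_abs]
  exact convex_univ.norm_image_sub_le_of_norm_fderiv_le
    (fun z _ => (hf.contDiff_one.differentiable one_ne_zero) z)
    (fun z _ => hf.holderBall_fderiv.norm_le z) (Set.mem_univ y) (Set.mem_univ x)

variable {d n : ℕ} {M m : ℝ} {V : Euc d → ℝ} {T : (Fin n → Euc d) → Euc d}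
  (hT : IsMLE V T) (h : RegPotential M m V) (hM : 0 < M) (hm : 0 < m) (hn : 0 < n) (hd : 0 < d)
  [IsProbabilityMeasure (noiseMeasure V)] {J Jinv : Euc d →L[ℝ] Euc d}
  (hJ : ∀ u v : Euc d, ⟪J u, v⟫ = ∫ x, ⟪hess V x u, v⟫ ∂noiseMeasure V)
  {Y : (Fin n → Euc d) → ℝ} {a K : ℝ} (ha0 : 0 < a) (ha1 : a ≤ 1) (had : a ^ 2 = d / n)
  (hK : 1 ≤ K) (mY : Measurable Y) (hY : ∀ x, 1 ≤ Y x) (iY : Integrable Y (noisePi V n))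
  (hYK : ∫ x, Y x ∂noisePi V n ≤ K) (hTY : ∀ x, ‖T x‖ ≤ a * √(Y x))
  (hGY : ∀ x, ‖J (T x) - (n : ℝ)⁻¹ • ∑ j, gradient V (x j)‖ ≤ a ^ 2 * Y x)
  (hYq : ∀ q : ℝ, 1 ≤ q → ∫⁻ x, ENNReal.ofReal (Y x ^ q) ∂noisePi V n ≤
    ENNReal.ofReal ((K * max 1 (q / d)) ^ q))

include hT h hM hm hn hd hJ ha0 ha1 had hK mY hY iY hYK hTY hGY hYq in
/-- Centred moments of the corrected plug-in statistic are subexponential. -/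
lemma lintegral_abs_plugIn_rpow_le {ρ B : ℝ} (hρ : 0 < ρ) (hρ1 : ρ ≤ 1) (hB : 0 < B) {k : ℕ}
    {f r : Euc d → ℝ} (hf : HolderBall (k + 1) ρ f B)
    (hr : ∀ x y, |r x - r y| ≤ 2 ^ (k + 1) * B * (a ^ ρ * K) * ‖x - y‖) {θ w : Euc d}
    (hw : ‖w‖ ≤ B / m) (hJw : J w = gradient f θ)
    (hHY : ∀ x, ‖J w - (n : ℝ)⁻¹ • ∑ j, hess V (x j - T x) w‖ ≤ B / m * a * √(Y x)) {e : ℝ}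
    (hi : Integrable (plugIn V T (fun y => f (θ + y)) r w) (noisePi V n))
    (he : ∫ x, plugIn V T (fun y => f (θ + y)) r w x ∂noisePi V n = e) {p : ℝ} (hp : 1 ≤ p) :
    ∫⁻ x, ENNReal.ofReal (|plugIn V T (fun y => f (θ + y)) r w x - e| ^ p) ∂noisePi V n ≤
      ENNReal.ofReal ((p * ((16 * √(2 * M ^ 2 / m ^ 3 *
        (2 + 1 / m + 2 ^ (k + 1) * K + M / m) ^ 2 + 2 * M ^ 2 / m ^ 2) * √K +
        (2 + 2 ^ (k + 1) * K + 1 / m) * (1 + K) * K) * (B * (a ^ ρ / √n)))) ^ p) := by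
  have hn' : (0 : ℝ) < n := by exact_mod_cast hn
  have hd' : (1 : ℝ) ≤ d := by exact_mod_cast hd
  have hK0 : 0 < K := by linarith
  have hna : (n : ℝ)⁻¹ ≤ a ^ 2 := by
    rw [had, inv_eq_one_div]; gcongr
  have hp0 : 0 ≤ p := by linarith
  rcases le_total p d with hpd | hpd
  · have hfL : ∀ x y, |f (θ + x) - f (θ + y)| ≤ B * ‖x - y‖ := fun x y => by
      simpa using hf.abs_sub_le (θ + x) (θ + y)
    refine (lintegral_abs_plugIn_rpow_le_of_le hT h hM hm hn hd ha0 hK mY hY hTY hYq hρ1 ha1 hB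
      (C := 2 + 1 / m + 2 ^ (k + 1) * K + M / m) (by positivity) (f := fun y => f (θ + y))
      (hf.contDiff_one.comp (contDiff_const.add contDiff_id)) hfL hr hB.le (by positivity) hw
      (plugInSlope_le hM hm ha0 ha1 hK hY hTY hρ hρ1 hf hw hJw hna hHY) hi he hp hpd).trans ?_
    refine ENNReal.ofReal_le_ofReal (Real.rpow_le_rpow (by positivity) ?_ hp0)
    gcongr
    exact le_add_of_nonneg_right (by positivity)
  · set U := (2 + 2 ^ (k + 1) * K + 1 / m) * B * (a ^ ρ * a) with hU
    have hU0 : 0 ≤ U := by positivity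
    have hb := abs_plugIn_sub_le h ha0 ha1 hK hY hTY hρ hρ1 hf hw hJw hJ hGY hr
    have he' : |e - (f θ + r 0)| ≤ U * K := by
      have : e - (f θ + r 0) =
          ∫ x, (plugIn V T (fun y => f (θ + y)) r w x - (f θ + r 0)) ∂noisePi V n := by
        rw [integral_sub hi (integrable_const _), he]; simp
      rw [this, ← Real.norm_eq_abs]
      refine (norm_integral_le_of_norm_le (iY.const_mul U) (ae_of_all _ hb)).trans ?_
      rw [integral_const_mul]
      gcongr
    have hF : ∀ x, |plugIn V T (fun y => f (θ + y)) r w x - e| ≤ U * (1 + K) * Y x := fun x => by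
      have h1 := abs_sub_le (plugIn V T (fun y => f (θ + y)) r w x) (f θ + r 0) e
      rw [abs_sub_comm (f θ + r 0) e] at h1
      have h2 : U * K * 1 ≤ U * K * Y x := by gcongr; exact hY x
      have h3 := hb x
      linarith
    refine (lintegral_abs_rpow_le_of_le_mul (by positivity) hY (by linarith : (0 : ℝ) < d) hF hYq
      hK0.le hp hpd).trans ?_
    refine ENNReal.ofReal_le_ofReal (Real.rpow_le_rpow (by positivity) ?_ hp0)
    have hadn : a / d ≤ 1 / √n := by
      rw [div_le_div_iff₀ (by linarith) (by positivity), one_mul]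
      refine le_of_sq_le_sq ?_ (by positivity)
      rw [mul_pow, had, Real.sq_sqrt hn'.le, div_mul_cancel₀ _ hn'.ne']
      nlinarith
    gcongr
    calc U * (1 + K) * K / d =
          (2 + 2 ^ (k + 1) * K + 1 / m) * (1 + K) * K * (B * (a ^ ρ * (a / d))) := by
          rw [hU]; ring
      _ ≤ (2 + 2 ^ (k + 1) * K + 1 / m) * (1 + K) * K * (B * (a ^ ρ * (1 / √n))) := by gcongr
      _ ≤ _ := by
          rw [add_mul _ _ (B * _), mul_one_div]
          exact le_add_of_nonneg_left (by positivity)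

end AllMoments

section MainBound

lemma HolderBall.mono {d l : ℕ} {ρ B B' : ℝ} {f : Euc d → ℝ} (hf : HolderBall l ρ f B)
    (h : B ≤ B') : HolderBall l ρ f B' :=
  ⟨hf.1, fun j hj x => (hf.2.1 j hj x).trans h,
    fun x y => (hf.2.2 x y).trans (by gcongr)⟩

/-- The main bound, with explicit dependence on the radius of the Hölder ball. -/
lemma exists_psiNorm_le {M m ρ : ℝ} (k : ℕ) (hM : 0 < M) (hm : 0 < m) (hρ : 0 < ρ) (hρ1 : ρ ≤ 1) :
    ∃ C : ℝ, 0 < C ∧ ∀ (d n : ℕ) (V f : Euc d → ℝ) (J Jinv : Euc d →L[ℝ] Euc d)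
      (T : (Fin n → Euc d) → Euc d) (B : ℝ), RegPotential M m V →
      IsProbabilityMeasure (noiseMeasure V) →
      (∀ u v : Euc d, ⟪J u, v⟫ = ∫ x, ⟪hess V x u, v⟫ ∂noiseMeasure V) →
      (∀ u, J (Jinv u) = u) → (∀ u, Jinv (J u) = u) → IsMLE V T →
      HolderBall (k + 1) ρ f B → 0 < B → 2 ≤ n → 0 < d → d ≤ n → ∀ θ : Euc d,
      psiNorm 1 (sampleMeasure V n θ) (fun x => biasCorrect V n T k f (T x) - f θ -
          (n : ℝ)⁻¹ * ∑ j, ⟪gradient V (x j - θ), Jinv (gradient f θ)⟫) ≤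
        C * B * ((√n)⁻¹ * ((d : ℝ) / n) ^ (ρ / 2) + √((d : ℝ) / n) ^ ((k : ℝ) + 1 + ρ)) := by
  obtain ⟨c, A, hc, hA, hstat⟩ := exists_exp_moment_statistic hM hm
  set K := max 1 (2 * rexp (c + A) / c) with hKdef
  have hK : 1 ≤ K := le_max_left _ _
  have hK0 : 0 < K := by linarith
  set C₁ := 16 * √(2 * M ^ 2 / m ^ 3 *
        (2 + 1 / m + 2 ^ (k + 1) * K + M / m) ^ 2 + 2 * M ^ 2 / m ^ 2) * √K +
        (2 + 2 ^ (k + 1) * K + 1 / m) * (1 + K) * K with hC₁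
  set C₂ := K ^ (k + 1) * (1 + 1 / m) with hC₂
  have hC₁0 : 0 < C₁ := by positivity
  have hC₂0 : 0 < C₂ := by positivity
  refine ⟨2 * C₁ + 2 * C₂, by positivity, fun d n V f J Jinv T B h hP hJ hJJ hJJ' hT hf hB hn2 hd
    hdn θ => ?_⟩
  have hn : 0 < n := by omega
  have hn' : (0 : ℝ) < n := by exact_mod_cast hn
  have hd' : (1 : ℝ) ≤ d := by exact_mod_cast hd
  have hd0 : (0 : ℝ) < d := by linarith
  set a := √((d : ℝ) / n) with ha
  have ha0 : 0 < a := by positivity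
  have had : a ^ 2 = d / n := Real.sq_sqrt (by positivity)
  have ha1 : a ≤ 1 := by
    refine Real.sqrt_le_iff.2 ⟨zero_le_one, ?_⟩
    rw [one_pow, div_le_one hn']; exact_mod_cast hdn
  have haρ : a ^ ρ = ((d : ℝ) / n) ^ (ρ / 2) := by
    rw [ha, Real.sqrt_eq_rpow, ← Real.rpow_mul (by positivity)]
    congr 1; ring
  set w := Jinv (gradient f θ) with hw
  have hJw : J w = gradient f θ := hJJ _
  have hwB : ‖w‖ ≤ B / m := by
    refine (norm_information_inv_le h hJ hm hJJ _).trans ?_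
    have : ‖gradient f θ‖ ≤ B := by
      rw [gradient, LinearIsometryEquiv.norm_map]
      exact hf.holderBall_fderiv.norm_le θ
    gcongr
  have hw1 : ‖(m / B) • w‖ ≤ 1 := by
    rw [norm_smul, Real.norm_of_nonneg (by positivity)]
    calc m / B * ‖w‖ ≤ m / B * (B / m) := by gcongr
      _ = 1 := by field_simp
  obtain ⟨Z, mZ, hTZ, hHZ, hGZ, hZ⟩ := hstat d n V T J ((m / B) • w) h hP hT hn2 hd hJ hw1
  have hZ0 : ∀ x, 0 ≤ Z x := fun x => le_trans (by positivity) (hTZ x)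
  set Y : (Fin n → Euc d) → ℝ := fun x => 1 + Z x / d with hYdef
  have mY : Measurable Y := by fun_prop
  have hY : ∀ x, 1 ≤ Y x := fun x => le_add_of_nonneg_right (div_nonneg (hZ0 x) hd0.le)
  have hZY : ∀ x, Z x / n ≤ a ^ 2 * Y x := fun x => by
    have : a ^ 2 * Y x = Z x / n + d / n := by
      rw [had, hYdef]; field_simp; ring
    rw [this]
    exact le_add_of_nonneg_right (by positivity)
  have hYq : ∀ q : ℝ, 1 ≤ q → ∫⁻ x, ENNReal.ofReal (Y x ^ q) ∂noisePi V n ≤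
      ENNReal.ofReal ((K * max 1 (q / d)) ^ q) := fun q hq => by
    refine (lintegral_rpow_le_of_exp hZ0 hc hA hd' hZ hq).trans ?_
    gcongr
    exact le_max_right _ _
  have hY1 : ∫⁻ x, ENNReal.ofReal (Y x) ∂noisePi V n ≤ ENNReal.ofReal K := by
    have := hYq 1 le_rfl
    rw [max_eq_left ((div_le_one hd0).2 hd'), mul_one] at this
    simpa only [Real.rpow_one] using this
  have hY0 : ∀ x, 0 ≤ Y x := fun x => zero_le_one.trans (hY x)
  have iY : Integrable Y (noisePi V n) :=
    ⟨mY.aestronglyMeasurable, (hasFiniteIntegral_iff_ofReal (ae_of_all _ hY0)).2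
      (hY1.trans_lt ENNReal.ofReal_lt_top)⟩
  have hYK : ∫ x, Y x ∂noisePi V n ≤ K := integral_le_of_lintegral_ofReal_le mY hY0 hK0.le hY1
  have hsq : ∀ {t : ℝ} {x}, 0 ≤ t → n * t ^ 2 ≤ Z x → t ≤ a * √(Y x) := fun {t x} ht htZ => by
    refine le_of_sq_le_sq ?_ (by positivity)
    rw [mul_pow, Real.sq_sqrt (hY0 x)]
    refine le_trans ?_ (hZY x)
    rw [le_div_iff₀ hn']; linarith
  have hTY : ∀ x, ‖T x‖ ≤ a * √(Y x) := fun x => hsq (norm_nonneg _) (hTZ x)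
  have hHY : ∀ x, ‖J w - (n : ℝ)⁻¹ • ∑ j, hess V (x j - T x) w‖ ≤ B / m * a * √(Y x) :=
    fun x => by
    have h1 := hsq (norm_nonneg _) (hHZ x)
    simp only [map_smul, ← Finset.smul_sum] at h1
    rw [smul_comm, ← smul_sub, norm_smul, Real.norm_of_nonneg (by positivity)] at h1
    calc _ = B / m * (m / B * ‖J w - (n : ℝ)⁻¹ • ∑ j, hess V (x j - T x) w‖) := by field_simp
      _ ≤ B / m * (a * √(Y x)) := by gcongr
      _ = _ := by ring
  have hGY : ∀ x, ‖J (T x) - (n : ℝ)⁻¹ • ∑ j, gradient V (x j)‖ ≤ a ^ 2 * Y x := fun x => by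
    refine le_trans ?_ (hZY x)
    rw [le_div_iff₀ hn']; linarith [hGZ x]
  have mT := (hT.continuous h hM hm hn).measurable
  obtain ⟨iρ, bρ⟩ := integral_norm_rpow_le (P := noisePi V n) ha0 hY hTY mT iY hYK hρ.le
    (by linarith)
  set r : Euc d → ℝ := fun x => shiftSum (noisePi V n) T k f (θ + x) - f (θ + x) with hrdef
  have hr : ∀ x y, |r x - r y| ≤ 2 ^ (k + 1) * B * (a ^ ρ * K) * ‖x - y‖ := fun x y => by
    have := hf.abs_shiftSum_sub_le mT hρ hρ1 iρ k (θ + x) (θ + y)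
    rw [add_sub_add_left_eq_sub] at this
    exact this.trans (by gcongr)
  obtain ⟨hi, hbias⟩ := abs_integral_plugIn_sub_le hT h hM hm hn hJ hJJ hJJ' ha0 ha1 hK hY iY hYK
    hTY hGY hρ hρ1 hf θ w
  have hmom := fun {p : ℝ} (hp : 1 ≤ p) => lintegral_abs_plugIn_rpow_le hT h hM hm hn hd hJ ha0 ha1
    had hK mY hY iY hYK hTY hGY hYq hρ hρ1 hB hf hr hwB hJw hHY hi rfl hp
  have hpush : ∀ x : Fin n → Euc d, biasCorrect V n T k f (T fun j => θ + x j) - f θ -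
      (n : ℝ)⁻¹ * ∑ j, ⟪gradient V (θ + x j - θ), w⟫ =
      plugIn V T (fun y => f (θ + y)) r w x - f θ := fun x => by
    rw [hT.add_equivariant h hM hm hn, biasCorrect_eq_shiftSum hT h hM hm hn]
    simp only [plugIn, hrdef, add_sub_cancel_left]
    ring
  have mF := (continuous_plugIn hT h hM hm hn (f := fun y => f (θ + y))
    (hf.1.continuous.comp (by fun_prop)) (continuous_of_abs_sub_le hr) w).measurable
  rw [psiNorm]
  refine Real.iSup_le (fun ⟨p, hp⟩ => ?_) (by positivity)
  rw [integral_sampleMeasure]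
  simp only [hpush]
  refine (rpow_integral_abs_rpow_le (P := noisePi V n) (mF.sub_const (f θ))
    (b := ∫ x, plugIn V T (fun y => f (θ + y)) r w x ∂noisePi V n - f θ)
    (D := C₁ * (B * (a ^ ρ / √n))) (by positivity) hp ?_).trans ?_
  · simpa only [sub_sub_sub_cancel_right] using hmom hp
  · calc _ ≤ 2 * (C₁ * (B * (a ^ ρ / √n))) + 2 * (C₂ * B * a ^ ((k : ℝ) + 1 + ρ)) := by gcongr
      _ ≤ 2 * (C₁ * (B * (a ^ ρ / √n))) + 2 * (C₂ * B * a ^ ((k : ℝ) + 1 + ρ)) +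
          (2 * C₂ * (B * (a ^ ρ / √n)) + 2 * C₁ * B * a ^ ((k : ℝ) + 1 + ρ)) :=
        le_add_of_nonneg_right (by positivity)
      _ = _ := by rw [← haρ]; ring

/-- The bias correction is trivial in dimension zero. -/
lemma shiftSum_of_subsingleton {Ω : Type*} [MeasurableSpace Ω] {d : ℕ} [Subsingleton (Euc d)]
    (P : Measure Ω) [IsProbabilityMeasure P] (ϑ : Ω → Euc d) (k : ℕ) (f : Euc d → ℝ) (x : Euc d) :
    shiftSum P ϑ k f x = f x := by
  have h0 : ∀ g : Euc d → ℝ, shiftDiff P ϑ g = 0 := fun g => by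
    ext y
    simp only [shiftDiff, Subsingleton.elim _ y]
    simp
  rw [shiftSum, Finset.sum_range_succ']
  simp [Function.iterate_succ_apply', h0]

end MainBound

end Development

/-- Theorem 2.9 / `main_theorem_AAA`: the `ψ_1`-version of the main theorem
under the stronger assumption `V''(x) ⪰ m I_d` uniformly in `x`. -/
theorem stmt_8 :
    ∃ c₀ : ℝ, 0 < c₀ ∧
      ∀ (M m ρ : ℝ) (k : ℕ),
        0 < M → 0 < m → 0 < ρ → ρ ≤ 1 →
        ∃ C : ℝ, 0 < C ∧
          ∀ (d n : ℕ) (V f : Euc d → ℝ) (J Jinv : Euc d →L[ℝ] Euc d)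
            (hatθ : (Fin n → Euc d) → Euc d) (B : ℝ),
            0 < n →
            ContDiff ℝ 2 V →
            (∫ x, Real.exp (-(V x)) = 1) →
            (∀ x, ‖iteratedFDeriv ℝ 2 V x‖ ≤ M) →
            -- `V''(x) ⪰ m I_d` for all `x`
            (∀ x u : Euc d, m * ‖u‖ ^ 2 ≤ iteratedFDeriv ℝ 2 V x ![u, u]) →
            -- `𝓘 = E[V''(ξ)]` and its inverse
            (∀ u v : Euc d,
              ⟪J u, v⟫ = ∫ x, iteratedFDeriv ℝ 2 V x ![u, v] ∂ noiseMeasure V) →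
            (∀ u, J (Jinv u) = u) →
            (∀ u, Jinv (J u) = u) →
            (∀ (x : Fin n → Euc d) (θ' : Euc d),
              ∑ j, V (x j - hatθ x) ≤ ∑ j, V (x j - θ')) →
            holderCLe (k + 1) ρ f B →
            (d : ℝ) ≤ c₀ * n →
            ∀ θ : Euc d,
              psiNorm 1 (sampleMeasure V n θ)
                (fun x =>
                  biasCorrect V n hatθ k f (hatθ x) - f θ -
                    (n : ℝ)⁻¹ * ∑ j, ⟪gradient V (x j - θ), Jinv (gradient f θ)⟫) ≤
              C * B *
                ((Real.sqrt n)⁻¹ * ((d : ℝ) / n) ^ (ρ / 2) +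
                  Real.sqrt ((d : ℝ) / n) ^ ((k : ℝ) + 1 + ρ)) := by
  refine ⟨1 / 2, by norm_num, fun M m ρ k hM hm hρ hρ1 => ?_⟩
  obtain ⟨C, hC, hmain⟩ := exists_psiNorm_le k hM hm hρ hρ1
  refine ⟨C, hC, fun d n V f J Jinv T B hn hV hint hVM hVm hJ hJJ hJJ' hT hf hdn θ => ?_⟩
  have h : RegPotential M m V := ⟨hV, hVM, hVm⟩
  have hP := isProbabilityMeasure_noiseMeasure hV.continuous.measurable hint
  have hf' : HolderBall (k + 1) ρ f B := hf
  rcases Nat.eq_zero_or_pos d with rfl | hd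
  · refine le_trans (Real.iSup_le (fun ⟨p, hp⟩ => ?_) le_rfl)
      (mul_nonneg (mul_nonneg hC.le hf'.nonneg) (by positivity))
    rw [integral_sampleMeasure]
    have e0 : ∀ x : Fin n → Euc 0, biasCorrect V n T k f (T fun j => θ + x j) - f θ -
        (n : ℝ)⁻¹ * ∑ j, ⟪gradient V (θ + x j - θ), Jinv (gradient f θ)⟫ = 0 := fun x => by
      have hg : gradient f θ = 0 := Subsingleton.elim _ _
      rw [hg, biasCorrect_eq_shiftSum hT h hM hm hn, shiftSum_of_subsingleton]
      simp [Subsingleton.elim (T _) θ]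
    have hp0 : p ≠ 0 := by linarith
    simp only [e0]
    simp [hp0]
  · have hn2 : 2 ≤ n := by
      have h1 : (1 : ℝ) ≤ d := by exact_mod_cast hd
      have : (2 : ℝ) ≤ n := by linarith
      exact_mod_cast this
    have hdn' : d ≤ n := by
      have : (d : ℝ) ≤ n := by linarith [(Nat.cast_nonneg n : (0 : ℝ) ≤ n)]
      exact_mod_cast this
    have hJ' : ∀ u v : Euc d, ⟪J u, v⟫ = ∫ x, ⟪hess V x u, v⟫ ∂noiseMeasure V := fun u v => by
      simp only [hJ, h.inner_hess]
    set S := (√n)⁻¹ * ((d : ℝ) / n) ^ (ρ / 2) + √((d : ℝ) / n) ^ ((k : ℝ) + 1 + ρ) with hS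
    have hn0 : (0 : ℝ) < n := by exact_mod_cast hn
    have hd0 : (0 : ℝ) < d := by exact_mod_cast hd
    have hS0 : 0 < S := by positivity
    refine le_of_forall_pos_le_add fun ε hε => ?_
    have hδ : 0 < ε / (C * S) := by positivity
    refine (hmain d n V f J Jinv T (B + ε / (C * S)) h hP hJ' hJJ hJJ' hT (hf'.mono (by linarith))
      (by linarith [hf'.nonneg]) hn2 hd hdn' θ).trans_eq ?_
    rw [← hS]
    field_simp
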